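/- arXiv:0903.3179 — 2 statements merged into one kernel-verified Lean document; each statement's English description precedes it below -/
import Mathlib

section
/- For simple random walk on ℤ², there exist constants c₂ > 0 and C₂ > 0 such that for all n ∈ ℕ with n ≥ 2, the Shannon entropy of the range satisfies c₂ · n / (log n)² ≤ H(R(n)) ≤ C₂ · n / (log n)². -/
open Real

/-- A single step of the simple random walk on `ℤ^d`: the pair `(i, b)` encodes a move by
`+eᵢ` (if `b = true`) or `-eᵢ` (if `b = false`).  The uniform distribution on `Fin d × Bool`
corresponds to the uniform distribution on the `2d` unit vectors. -/
def step {d : ℕ} (a : Fin d × Bool) : Fin d → ℤ :=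
  fun j => if j = a.1 then (if a.2 then 1 else -1) else 0

/-- The position `S(k)` of the walk started at `z` after `k` steps, driven by the
sequence of i.i.d. uniform steps `ω : Fin n → Fin d × Bool` (meaningful for `k ≤ n`). -/
def walk {d n : ℕ} (z : Fin d → ℤ) (ω : Fin n → Fin d × Bool) (k : ℕ) : Fin d → ℤ :=
  z + ∑ i ∈ Finset.univ.filter (fun i : Fin n => (i : ℕ) < k), step (ω i)

/-- Probability of an event for the `n`-step simple random walk on `ℤ^d`:
the driving step sequences are uniform among the `(2d)^n` possibilities. -/
noncomputable def prW (d n : ℕ) (E : Set (Fin n → Fin d × Bool)) : ℝ :=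
  E.ncard / (2 * d) ^ n

/-- Expectation of a random variable of the `n`-step simple random walk on `ℤ^d`. -/
noncomputable def exW (d n : ℕ) (f : (Fin n → Fin d × Bool) → ℝ) : ℝ :=
  (∑ ω : Fin n → Fin d × Bool, f ω) / (2 * d) ^ n

/-- Shannon entropy (base 2) of a random variable `X` of the `n`-step walk:
`H(X) = ∑ₐ -P[X = a] · log₂ P[X = a]`. -/
noncomputable def entW {α : Type*} (d n : ℕ) (X : (Fin n → Fin d × Bool) → α) : ℝ :=
  ∑' a : α, -(prW d n {ω | X ω = a} * logb 2 (prW d n {ω | X ω = a}))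

/-- The range `R(n) = {S(0), …, S(n)}` of the `n`-step walk started at `z`. -/
def rangeW {d n : ℕ} (z : Fin d → ℤ) (ω : Fin n → Fin d × Bool) : Finset (Fin d → ℤ) :=
  (Finset.range (n + 1)).image (walk z ω)

/-- The inner boundary `∂A` of a finite set `A ⊆ ℤ^d`: the points of `A` adjacent
(at graph distance 1, i.e. reachable by a single step) to some vertex of the complement. -/
def innerBdry {d : ℕ} (A : Finset (Fin d → ℤ)) : Finset (Fin d → ℤ) :=
  A.filter fun x => ∃ a : Fin d × Bool, x + step a ∉ A

/-- The Euclidean (`L²`) norm on `ℤ^d`. -/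
noncomputable def eNorm {d : ℕ} (x : Fin d → ℤ) : ℝ :=
  Real.sqrt (∑ i, ((x i : ℝ)) ^ 2)

namespace PlanarWalk

/-- The position after `k` steps of the walk from the origin driven by an infinite sequence. -/
def pos (w : ℕ → Fin 2 × Bool) (k : ℕ) : Fin 2 → ℤ := ∑ i ∈ Finset.range k, step (w i)

/-- Time shift of a sequence of steps. -/
def shift (s : ℕ) (w : ℕ → Fin 2 × Bool) : ℕ → Fin 2 × Bool := fun i => w (s + i)

/-- Extension of a finite sequence of steps to an infinite one. -/
def ext {n : ℕ} (ω : Fin n → Fin 2 × Bool) : ℕ → Fin 2 × Bool :=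
  fun i => if h : i < n then ω ⟨i, h⟩ else (0, true)

/-- Expectation of a functional of the walk when the first `n` steps are uniform. -/
noncomputable def ex (n : ℕ) (F : (ℕ → Fin 2 × Bool) → ℝ) : ℝ :=
  (∑ ω : Fin n → Fin 2 × Bool, F (ext ω)) / 4 ^ n

open Classical in
/-- The indicator of a proposition. -/
noncomputable def ind (P : Prop) : ℝ := if P then 1 else 0

theorem ind_of_true {P : Prop} (h : P) : ind P = 1 := by simp [ind, h]

theorem ind_of_false {P : Prop} (h : ¬ P) : ind P = 0 := by simp [ind, h]

theorem ind_nonneg (P : Prop) : 0 ≤ ind P := by unfold ind; split_ifs <;> norm_num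

theorem ind_le_one (P : Prop) : ind P ≤ 1 := by unfold ind; split_ifs <;> norm_num

theorem ind_mono {P Q : Prop} (h : P → Q) : ind P ≤ ind Q := by
  by_cases hP : P
  · rw [ind_of_true hP, ind_of_true (h hP)]
  · rw [ind_of_false hP]; exact ind_nonneg Q

theorem ind_congr {P Q : Prop} (h : P ↔ Q) : ind P = ind Q := by rw [propext h]

theorem ind_and (P Q : Prop) : ind (P ∧ Q) = ind P * ind Q := by
  by_cases hP : P <;> by_cases hQ : Q <;> simp [ind, hP, hQ]

/-- A sum of indicators of pairwise incompatible propositions is at most one. -/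
theorem sum_ind_le_one {ι : Type*} (s : Finset ι) (P : ι → Prop)
    (h : ∀ i ∈ s, ∀ j ∈ s, P i → P j → i = j) : ∑ i ∈ s, ind (P i) ≤ 1 := by
  by_cases hex : ∃ i ∈ s, P i
  · obtain ⟨i, hi, hPi⟩ := hex
    rw [Finset.sum_eq_single_of_mem i hi]
    · exact ind_le_one _
    · intro j hj hji
      exact ind_of_false fun hPj => hji (h j hj i hi hPj hPi)
  · push Not at hex
    rw [Finset.sum_eq_zero fun i hi => ind_of_false (hex i hi)]
    norm_num

theorem le_sum_ind {ι : Type*} (s : Finset ι) (P : ι → Prop) {Q : Prop}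
    (h : Q → ∃ i ∈ s, P i) : ind Q ≤ ∑ i ∈ s, ind (P i) := by
  by_cases hQ : Q
  · obtain ⟨i, hi, hPi⟩ := h hQ
    rw [ind_of_true hQ, ← ind_of_true hPi]
    exact Finset.single_le_sum (f := fun i => ind (P i)) (fun j _ => ind_nonneg _) hi
  · rw [ind_of_false hQ]
    exact Finset.sum_nonneg fun _ _ => ind_nonneg _

theorem ext_apply {n : ℕ} (ω : Fin n → Fin 2 × Bool) (i : Fin n) : ext ω i = ω i := by
  simp [ext]

theorem ext_append_left {s t : ℕ} (α : Fin s → Fin 2 × Bool) (β : Fin t → Fin 2 × Bool)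
    {i : ℕ} (hi : i < s) : ext (Fin.append α β) i = ext α i := by
  have h : i < s + t := by omega
  simp only [ext, hi, h, dif_pos]
  exact Fin.append_left α β ⟨i, hi⟩

theorem shift_ext_append {s t : ℕ} (α : Fin s → Fin 2 × Bool) (β : Fin t → Fin 2 × Bool) :
    shift s (ext (Fin.append α β)) = ext β := by
  funext i
  by_cases hi : i < t
  · have h : s + i < s + t := by omega
    simp only [shift, ext, hi, h, dif_pos]
    exact Fin.append_right α β ⟨i, hi⟩
  · simp [shift, ext, hi]

section expectation

variable {n : ℕ} {F G : (ℕ → Fin 2 × Bool) → ℝ}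

theorem card_paths (n : ℕ) : Fintype.card (Fin n → Fin 2 × Bool) = 4 ^ n := by simp

theorem ex_const (n : ℕ) (c : ℝ) : ex n (fun _ => c) = c := by
  have : (4 : ℝ) ^ n ≠ 0 := by positivity
  simp only [ex, Finset.sum_const, Finset.card_univ, card_paths, nsmul_eq_mul]
  push_cast
  field_simp

theorem ex_mono (h : ∀ w, F w ≤ G w) : ex n F ≤ ex n G := by
  unfold ex
  gcongr
  exact h _

theorem ex_nonneg (h : ∀ w, 0 ≤ F w) : 0 ≤ ex n F := by
  simpa [ex_const] using ex_mono (n := n) (F := fun _ => 0) h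

theorem ex_le_one (h : ∀ w, F w ≤ 1) : ex n F ≤ 1 := by
  simpa [ex_const] using ex_mono (n := n) (G := fun _ => 1) h

theorem ex_add : ex n (fun w => F w + G w) = ex n F + ex n G := by
  simp [ex, Finset.sum_add_distrib, add_div]

theorem ex_mul_left (c : ℝ) : ex n (fun w => c * F w) = c * ex n F := by
  simp [ex, ← Finset.mul_sum, mul_div_assoc]

theorem ex_sum {ι : Type*} (s : Finset ι) (F : ι → (ℕ → Fin 2 × Bool) → ℝ) :
    ex n (fun w => ∑ i ∈ s, F i w) = ∑ i ∈ s, ex n (F i) := by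
  simp only [ex]
  rw [Finset.sum_comm, Finset.sum_div]

/-- The Markov property at a deterministic time. -/
theorem ex_mul_shift {s : ℕ} (t : ℕ) (hF : DependsOn F (Set.Iio s))
    (G : (ℕ → Fin 2 × Bool) → ℝ) :
    ex (s + t) (fun w => F w * G (shift s w)) = ex s F * ex t G := by
  simp only [ex]
  rw [← (Fin.appendEquiv s t).sum_comp, Fintype.sum_prod_type, div_mul_div_comm, pow_add,
    Finset.sum_mul_sum]
  congr 1
  refine Finset.sum_congr rfl fun α _ => Finset.sum_congr rfl fun β _ => ?_
  have h1 : F (ext (Fin.append α β)) = F (ext α) := hF fun i hi => ext_append_left α β hi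
  change F (ext (Fin.append α β)) * G (shift s (ext (Fin.append α β))) = _
  rw [h1, shift_ext_append]

theorem ex_mul_shift' {s t : ℕ} (hst : s + t = n) (hF : DependsOn F (Set.Iio s))
    (G : (ℕ → Fin 2 × Bool) → ℝ) :
    ex n (fun w => F w * G (shift s w)) = ex s F * ex t G := by
  subst hst
  exact ex_mul_shift t hF G

theorem ex_of_dependsOn {s : ℕ} (hs : s ≤ n) (hF : DependsOn F (Set.Iio s)) :
    ex n F = ex s F := by
  have := ex_mul_shift' (Nat.add_sub_cancel' hs) hF (fun _ => 1)
  simpa [ex_const] using this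

end expectation

/-- The opposite of a step. -/
def flipStep (a : Fin 2 × Bool) : Fin 2 × Bool := (a.1, !a.2)

theorem flipStep_flipStep (a : Fin 2 × Bool) : flipStep (flipStep a) = a := by
  simp [flipStep]

theorem step_flipStep (a : Fin 2 × Bool) : step (flipStep a) = -step a := by
  funext j
  rcases a with ⟨i, b⟩
  by_cases h : j = i <;> cases b <;> simp [step, flipStep, h]

theorem pos_zero (w : ℕ → Fin 2 × Bool) : pos w 0 = 0 := by simp [pos]

theorem pos_succ (w : ℕ → Fin 2 × Bool) (k : ℕ) : pos w (k + 1) = pos w k + step (w k) := by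
  simp [pos, Finset.sum_range_succ]

theorem pos_add (w : ℕ → Fin 2 × Bool) (s k : ℕ) :
    pos w (s + k) = pos w s + pos (shift s w) k := by
  simp [pos, shift, Finset.sum_range_add]

theorem pos_congr {w w' : ℕ → Fin 2 × Bool} {s k : ℕ} (h : ∀ i ∈ Set.Iio s, w i = w' i)
    (hk : k ≤ s) : pos w k = pos w' k := by
  refine Finset.sum_congr rfl fun i hi => ?_
  rw [h i (by simp at hi ⊢; omega)]

/-- Time reversal of the first `n` steps. -/
def rev (n : ℕ) (w : ℕ → Fin 2 × Bool) : ℕ → Fin 2 × Bool :=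
  fun i => if i < n then flipStep (w (n - 1 - i)) else w i

theorem pos_rev {n k : ℕ} (hk : k ≤ n) (w : ℕ → Fin 2 × Bool) :
    pos (rev n w) k = pos w (n - k) - pos w n := by
  induction k with
  | zero => simp [pos_zero]
  | succ k ih =>
    rw [pos_succ, ih (by omega)]
    have h1 : n - k = (n - (k + 1)) + 1 := by omega
    have h2 : n - 1 - k = n - (k + 1) := by omega
    rw [h1, pos_succ, rev, if_pos (by omega), step_flipStep, h2]
    abel

theorem rev_ext {n : ℕ} (ω : Fin n → Fin 2 × Bool) :
    rev n (ext ω) = ext (fun i => flipStep (ω (Fin.rev i))) := by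
  funext i
  by_cases hi : i < n
  · have h2 : n - 1 - i < n := by omega
    simp only [rev, ext, hi, h2, dif_pos, if_pos, Fin.rev]
    congr 2
    ext
    simp
    omega
  · simp [rev, ext, hi]

theorem ex_rev (n : ℕ) (F : (ℕ → Fin 2 × Bool) → ℝ) : ex n (fun w => F (rev n w)) = ex n F := by
  simp only [ex, rev_ext]
  congr 1
  have hinv : Function.Involutive
      (fun ω : Fin n → Fin 2 × Bool => fun i => flipStep (ω (Fin.rev i))) := by
    intro ω
    funext i
    simp [flipStep_flipStep]
  exact Equiv.sum_comp hinv.toPerm (fun ω : Fin n → Fin 2 × Bool => F (ext ω))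

/-- Reflection of the walk through the origin (only the first `n` steps are affected). -/
def refl (n : ℕ) (w : ℕ → Fin 2 × Bool) : ℕ → Fin 2 × Bool :=
  fun i => if i < n then flipStep (w i) else w i

theorem pos_refl {n k : ℕ} (hk : k ≤ n) (w : ℕ → Fin 2 × Bool) :
    pos (refl n w) k = -pos w k := by
  induction k with
  | zero => simp [pos_zero]
  | succ k ih =>
    rw [pos_succ, ih (by omega), pos_succ, refl, if_pos (by omega), step_flipStep]
    abel

theorem ex_refl (n : ℕ) (F : (ℕ → Fin 2 × Bool) → ℝ) :
    ex n (fun w => F (refl n w)) = ex n F := by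
  have hext : ∀ ω : Fin n → Fin 2 × Bool, refl n (ext ω) = ext (fun i => flipStep (ω i)) := by
    intro ω
    funext i
    by_cases hi : i < n <;> simp [refl, ext, hi]
  simp only [ex, hext]
  congr 1
  have hinv : Function.Involutive
      (fun ω : Fin n → Fin 2 × Bool => fun i => flipStep (ω i)) := by
    intro ω
    funext i
    simp [flipStep_flipStep]
  exact Equiv.sum_comp hinv.toPerm (fun ω : Fin n → Fin 2 × Bool => F (ext ω))

/-- The walk visits `y` within its first `n` steps. -/
def Visits (w : ℕ → Fin 2 × Bool) (n : ℕ) (y : Fin 2 → ℤ) : Prop := ∃ k ≤ n, pos w k = y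

theorem visits_congr {w w' : ℕ → Fin 2 × Bool} {s k : ℕ} (h : ∀ i ∈ Set.Iio s, w i = w' i)
    (hk : k ≤ s) (y : Fin 2 → ℤ) : Visits w k y ↔ Visits w' k y := by
  refine exists_congr fun j => and_congr_right fun hj => ?_
  rw [pos_congr h (hj.trans hk)]

theorem Visits.mono {w : ℕ → Fin 2 × Bool} {m n : ℕ} (hmn : m ≤ n) {y : Fin 2 → ℤ}
    (h : Visits w m y) : Visits w n y := by
  obtain ⟨k, hk, rfl⟩ := h
  exact ⟨k, hk.trans hmn, rfl⟩

theorem visits_add_iff {w : ℕ → Fin 2 × Bool} {s t : ℕ} {y : Fin 2 → ℤ} :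
    Visits w (s + t) y ↔ Visits w s y ∨ Visits (shift s w) t (y - pos w s) := by
  constructor
  · rintro ⟨k, hk, rfl⟩
    rcases le_total k s with h | h
    · exact Or.inl ⟨k, h, rfl⟩
    · obtain ⟨j, rfl⟩ := Nat.exists_eq_add_of_le h
      exact Or.inr ⟨j, by omega, by rw [pos_add]; abel⟩
  · rintro (h | ⟨k, hk, h⟩)
    · exact h.mono (by omega)
    · exact ⟨s + k, by omega, by rw [pos_add, h]; abel⟩

/-- The probability that the walk is at `x` after `s` steps. -/
noncomputable def tp (s : ℕ) (x : Fin 2 → ℤ) : ℝ := ex s (fun w => ind (pos w s = x))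

theorem tp_nonneg (s : ℕ) (x : Fin 2 → ℤ) : 0 ≤ tp s x := ex_nonneg fun _ => ind_nonneg _

theorem tp_le_one (s : ℕ) (x : Fin 2 → ℤ) : tp s x ≤ 1 := ex_le_one fun _ => ind_le_one _

theorem dependsOn_pos_eq {s k : ℕ} (hk : k ≤ s) (x : Fin 2 → ℤ) :
    DependsOn (fun w => ind (pos w k = x)) (Set.Iio s) := by
  intro w w' h
  simp only [pos_congr h hk]

theorem ex_pos_eq {s n : ℕ} (hs : s ≤ n) (x : Fin 2 → ℤ) :
    ex n (fun w => ind (pos w s = x)) = tp s x :=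
  ex_of_dependsOn hs (dependsOn_pos_eq le_rfl x)

theorem tp_zero (x : Fin 2 → ℤ) : tp 0 x = ind (x = 0) := by
  simp only [tp, pos_zero]
  rw [ex_const]
  exact ind_congr eq_comm

theorem ex_one_ind (a : Fin 2 × Bool) : ex 1 (fun w => ind (w 0 = a)) = 1 / 4 := by
  simp only [ex]
  rw [← (Equiv.funUnique (Fin 1) (Fin 2 × Bool)).symm.sum_comp]
  rw [Finset.sum_eq_single a]
  · simp [ext, ind]
  · intro b _ hb
    simp [ext, ind, hb]
  · simp

theorem tp_succ (s : ℕ) (x : Fin 2 → ℤ) :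
    tp (s + 1) x = (∑ a : Fin 2 × Bool, tp s (x - step a)) / 4 := by
  have h : ∀ w, ind (pos w (s + 1) = x) =
      ∑ a : Fin 2 × Bool, ind (pos w s = x - step a) * ind (shift s w 0 = a) := by
    intro w
    rw [Finset.sum_eq_single (w s)]
    · have : shift s w 0 = w s := by simp [shift]
      rw [ind_of_true this, mul_one]
      refine ind_congr ?_
      rw [pos_succ, eq_sub_iff_add_eq]
    · intro b _ hb
      have : ¬ shift s w 0 = b := by simpa [shift] using hb.symm
      rw [ind_of_false this, mul_zero]
    · simp
  simp only [tp, h]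
  rw [ex_sum, Finset.sum_div]
  refine Finset.sum_congr rfl fun a _ => ?_
  rw [ex_mul_shift 1 (dependsOn_pos_eq le_rfl _) (fun w => ind (w 0 = a)), ex_one_ind]
  simp only [mul_one_div]

/-- The number of `t`-step simple paths on `ℤ` from `0` to `s`. -/
def lineCount : ℕ → ℤ → ℕ
  | 0, s => if s = 0 then 1 else 0
  | t + 1, s => lineCount t (s - 1) + lineCount t (s + 1)

theorem sum_dirs {M : Type*} [AddCommMonoid M] (f : Fin 2 × Bool → M) :
    ∑ a, f a = f (0, true) + f (0, false) + (f (1, true) + f (1, false)) := by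
  rw [Fintype.sum_prod_type]
  simp

/-- In the rotated coordinates the two components of the planar walk are independent. -/
theorem tp_eq (s : ℕ) (x : Fin 2 → ℤ) :
    tp s x = lineCount s (x 0 + x 1) * lineCount s (x 0 - x 1) / 4 ^ s := by
  induction s generalizing x with
  | zero =>
    rw [tp_zero]
    by_cases h : x = 0
    · simp [h, ind, lineCount]
    · have : ¬ (x 0 + x 1 = 0 ∧ x 0 - x 1 = 0) := by
        rintro ⟨h1, h2⟩
        apply h
        funext i
        fin_cases i <;> simp <;> omega
      rw [ind_of_false h]
      simp only [lineCount]
      split_ifs <;> simp_all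
  | succ s ih =>
    rw [tp_succ]
    simp only [ih, sum_dirs, step, Pi.sub_apply, lineCount]
    have e1 : ∀ a b : ℤ, a - 1 + b = a + b - 1 := fun a b => by ring
    have e2 : ∀ a b : ℤ, a - 1 - b = a - b - 1 := fun a b => by ring
    have e3 : ∀ a b : ℤ, a + 1 + b = a + b + 1 := fun a b => by ring
    have e4 : ∀ a b : ℤ, a + 1 - b = a - b + 1 := fun a b => by ring
    have e5 : ∀ a b : ℤ, a + (b - 1) = a + b - 1 := fun a b => by ring
    have e6 : ∀ a b : ℤ, a - (b - 1) = a - b + 1 := fun a b => by ring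
    have e7 : ∀ a b : ℤ, a + (b + 1) = a + b + 1 := fun a b => by ring
    have e8 : ∀ a b : ℤ, a - (b + 1) = a - b - 1 := fun a b => by ring
    simp [e1, e2, e3, e4, e5, e6, e7, e8]
    field_simp
    ring

theorem lineCount_eq_zero {t : ℕ} {s : ℤ} (h : t < s) : lineCount t s = 0 := by
  induction t generalizing s with
  | zero => simp [lineCount]; rintro rfl; simp at h
  | succ t ih =>
    push_cast at h
    rw [lineCount, ih (by omega), ih (by omega)]

theorem lineCount_neg (t : ℕ) (s : ℤ) : lineCount t (-s) = lineCount t s := by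
  induction t generalizing s with
  | zero => simp [lineCount]
  | succ t ih =>
    rw [lineCount, lineCount, show -s - 1 = -(s + 1) by ring, show -s + 1 = -(s - 1) by ring,
      ih, ih, add_comm]

theorem lineCount_sub_two_mul (t j : ℕ) : lineCount t (t - 2 * j) = t.choose j := by
  induction t generalizing j with
  | zero =>
    cases j with
    | zero => simp [lineCount]
    | succ j => simp [lineCount]; omega
  | succ t ih =>
    rw [lineCount]
    have h1 : ((t + 1 : ℕ) : ℤ) - 2 * j - 1 = t - 2 * j := by push_cast; ring
    rw [h1, ih]
    cases j with
    | zero =>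
      rw [lineCount_eq_zero (by push_cast; omega)]
      simp
    | succ j =>
      have h2 : ((t + 1 : ℕ) : ℤ) - 2 * (j + 1 : ℕ) + 1 = t - 2 * j := by push_cast; ring
      rw [h2, ih, Nat.choose_succ_succ]
      ring

theorem lineCount_two_mul (k j : ℕ) (hj : j ≤ k) :
    lineCount (2 * k) (2 * j) = (2 * k).choose (k + j) := by
  have h := lineCount_sub_two_mul (2 * k) (k - j)
  rw [← Nat.choose_symm_of_eq_add (show 2 * k = (k + j) + (k - j) by omega)] at h
  rw [← h]
  congr 1
  push_cast [Nat.cast_sub hj]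
  ring

theorem lineCount_even_le (k : ℕ) (s : ℤ) : lineCount (2 * k) s ≤ k.centralBinom := by
  by_cases hs : ∃ j : ℕ, s = 2 * k - 2 * j
  · obtain ⟨j, rfl⟩ := hs
    have h := lineCount_sub_two_mul (2 * k) j
    push_cast at h
    rw [h]
    exact Nat.choose_le_centralBinom j k
  · suffices lineCount (2 * k) s = 0 by omega
    have hpar : ∀ t : ℕ, ∀ s : ℤ, lineCount t s ≠ 0 → (s - t) % 2 = 0 := by
      intro t
      induction t with
      | zero => intro s; simp [lineCount]; rintro rfl; simp
      | succ t ih =>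
        intro s hs
        rw [lineCount] at hs
        have : lineCount t (s - 1) ≠ 0 ∨ lineCount t (s + 1) ≠ 0 := by omega
        rcases this with h | h <;> have := ih _ h <;> push_cast <;> omega
    by_contra hne
    have h1 := hpar _ _ hne
    have h2 : ¬ ((2 * k : ℕ) : ℤ) < s := fun h => hne (lineCount_eq_zero h)
    refine hs ⟨(k - s / 2).toNat, ?_⟩
    push_cast at h1 h2
    omega

theorem centralBinom_sq_upper (k : ℕ) :
    (2 * k + 1 : ℝ) * (k.centralBinom : ℝ) ^ 2 ≤ (4 ^ (2 * k) : ℝ) := by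
  induction k with
  | zero => simp
  | succ k ih =>
    have h := Nat.succ_mul_centralBinom_succ k
    have h' : ((k : ℝ) + 1) * ((k + 1).centralBinom : ℝ) = 2 * (2 * k + 1) * k.centralBinom := by
      exact_mod_cast h
    have hk : (0 : ℝ) < (k + 1) ^ 2 := by positivity
    rw [← mul_le_mul_iff_right₀ hk]
    calc ((k : ℝ) + 1) ^ 2 * ((2 * (k + 1 : ℕ) + 1) * ((k + 1).centralBinom : ℝ) ^ 2)
        = (2 * k + 3) * (((k : ℝ) + 1) * ((k + 1).centralBinom : ℝ)) ^ 2 := by push_cast; ring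
      _ = 4 * ((2 * k + 3) * (2 * k + 1)) * ((2 * k + 1) * (k.centralBinom : ℝ) ^ 2) := by
          rw [h']; ring
      _ ≤ 4 * ((2 * k + 2) ^ 2) * (4 ^ (2 * k)) := by
          gcongr
          nlinarith
      _ = _ := by rw [show 2 * (k + 1) = 2 * k + 2 by ring, pow_add]; ring

theorem centralBinom_sq_lower {k : ℕ} (hk : 1 ≤ k) :
    (4 ^ (2 * k) : ℝ) ≤ 4 * k * (k.centralBinom : ℝ) ^ 2 := by
  induction k, hk using Nat.le_induction with
  | base => norm_num [Nat.centralBinom, Nat.choose]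
  | succ k hk ih =>
    have h := Nat.succ_mul_centralBinom_succ k
    have h' : ((k : ℝ) + 1) * ((k + 1).centralBinom : ℝ) = 2 * (2 * k + 1) * k.centralBinom := by
      exact_mod_cast h
    have hk : (0 : ℝ) < k + 1 := by positivity
    rw [← mul_le_mul_iff_right₀ hk]
    calc ((k : ℝ) + 1) * 4 ^ (2 * (k + 1))
        = 16 * (k + 1) * (4 ^ (2 * k)) := by rw [show 2 * (k + 1) = 2 * k + 2 by ring, pow_add]; ring
      _ ≤ 16 * (k + 1) * (4 * k * (k.centralBinom : ℝ) ^ 2) := by gcongr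
      _ ≤ 4 * (2 * (2 * k + 1) * k.centralBinom) ^ 2 := by
          have : (0 : ℝ) ≤ (k.centralBinom : ℝ) ^ 2 := by positivity
          nlinarith
      _ = _ := by rw [← h']; push_cast; ring

theorem tp_even_le (k : ℕ) (x : Fin 2 → ℤ) : tp (2 * k) x ≤ 1 / (2 * k + 1) := by
  have h1 : (lineCount (2 * k) (x 0 + x 1) : ℝ) ≤ k.centralBinom := by
    exact_mod_cast lineCount_even_le k _
  have h2 : (lineCount (2 * k) (x 0 - x 1) : ℝ) ≤ k.centralBinom := by
    exact_mod_cast lineCount_even_le k _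
  rw [tp_eq, div_le_div_iff₀ (by positivity) (by positivity), one_mul]
  calc _ ≤ (k.centralBinom : ℝ) * k.centralBinom * (2 * k + 1) := by gcongr
    _ = (2 * k + 1) * (k.centralBinom : ℝ) ^ 2 := by ring
    _ ≤ _ := centralBinom_sq_upper k

/-- On-diagonal heat kernel upper bound. -/
theorem tp_le {s : ℕ} (hs : 1 ≤ s) (x : Fin 2 → ℤ) : tp s x ≤ 1 / s := by
  rcases Nat.even_or_odd' s with ⟨k, rfl | rfl⟩
  · refine (tp_even_le k x).trans ?_
    push_cast
    have : (0 : ℝ) < 2 * k := by exact_mod_cast hs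
    gcongr
    linarith
  · rw [tp_succ, sum_dirs]
    push_cast
    have h := fun a => tp_even_le k (x - step a)
    linarith [h (0, true), h (0, false), h (1, true), h (1, false)]

theorem le_tp_even_zero {k : ℕ} (hk : 1 ≤ k) : 1 / (4 * k) ≤ tp (2 * k) 0 := by
  have h0 : lineCount (2 * k) 0 = k.centralBinom := by
    simpa [Nat.centralBinom] using lineCount_two_mul k 0 (by omega)
  have hk' : (0 : ℝ) < k := by exact_mod_cast hk
  rw [tp_eq]
  simp only [Pi.zero_apply, add_zero, sub_zero, h0]
  rw [div_le_div_iff₀ (by positivity) (by positivity), one_mul]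
  linarith [centralBinom_sq_lower hk]

theorem choose_add_ge {k : ℕ} (j : ℕ) (hj : j ≤ k) :
    (1 - (j : ℝ) ^ 2 / (k + 1)) * k.centralBinom ≤ (2 * k).choose (k + j) := by
  induction j with
  | zero => simp [Nat.centralBinom]
  | succ j ih =>
    have ih := ih (by omega)
    have hle : ((2 * k).choose (k + j) : ℝ) ≤ k.centralBinom := by
      exact_mod_cast Nat.choose_le_centralBinom _ _
    have h := Nat.choose_succ_right_eq (2 * k) (k + j)
    have h' : ((2 * k).choose (k + j + 1) : ℝ) * (k + j + 1)
        = (2 * k).choose (k + j) * (k - j) := by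
      have : 2 * k - (k + j) = k - j := by omega
      rw [this] at h
      have h2 : (((k - j : ℕ)) : ℝ) = k - j := by rw [Nat.cast_sub (by omega)]
      rw [← h2]
      exact_mod_cast h
    have e : ((2 * k).choose (k + j + 1) : ℝ) = (2 * k).choose (k + j) -
        (2 * k).choose (k + j) * ((2 * j + 1) / (k + j + 1)) := by
      have : (k : ℝ) + j + 1 ≠ 0 := by positivity
      field_simp
      linarith
    have e2 : ((2 * k).choose (k + j) : ℝ) * ((2 * j + 1) / (k + j + 1)) ≤
        k.centralBinom * ((2 * j + 1) / (k + 1)) := by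
      gcongr
      linarith
    rw [← add_assoc, e]
    have e3 : (1 - ((j + 1 : ℕ) : ℝ) ^ 2 / (k + 1)) * k.centralBinom =
        (1 - (j : ℝ) ^ 2 / (k + 1)) * k.centralBinom - k.centralBinom * ((2 * j + 1) / (k + 1)) := by
      push_cast
      field_simp
      ring
    linarith

theorem lineCount_ge {k ρ : ℕ} (hk : 2 * ρ ^ 2 ≤ k) {s : ℤ} (hs : |s| ≤ ρ) :
    (k.centralBinom : ℝ) / 2 ≤ lineCount (2 * k) (2 * s) := by
  wlog h : 0 ≤ s generalizing s
  · rw [← lineCount_neg, ← mul_neg]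
    exact this (by rwa [abs_neg]) (by omega)
  obtain ⟨j, rfl⟩ := Int.eq_ofNat_of_zero_le h
  have hj : j ≤ ρ := by simpa using hs
  have hjk : j ≤ k := by nlinarith
  rw [lineCount_two_mul k j hjk]
  refine le_trans ?_ (choose_add_ge j hjk)
  have h1 : (j : ℝ) ^ 2 / (k + 1) ≤ 1 / 2 := by
    rw [div_le_div_iff₀ (by positivity) (by norm_num)]
    have : 2 * j ^ 2 ≤ k := le_trans (by gcongr) hk
    have : (2 * j ^ 2 : ℝ) ≤ k := by exact_mod_cast this
    linarith
  have : (0 : ℝ) ≤ k.centralBinom := by positivity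
  nlinarith

/-- Off-diagonal heat kernel lower bound for points of even parity. -/
theorem le_tp_even {k ρ : ℕ} (hk : 2 * ρ ^ 2 ≤ k) (hk1 : 1 ≤ k) {x : Fin 2 → ℤ}
    (hx : ∀ i, |x i| ≤ ρ) (hpar : (x 0 + x 1) % 2 = 0) : 1 / (16 * k) ≤ tp (2 * k) x := by
  have h0 := abs_le.1 (hx 0)
  have h1 := abs_le.1 (hx 1)
  have a1 := lineCount_ge hk (s := (x 0 + x 1) / 2) (by rw [abs_le]; omega)
  have a2 := lineCount_ge hk (s := (x 0 - x 1) / 2) (by rw [abs_le]; omega)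
  rw [show 2 * ((x 0 + x 1) / 2) = x 0 + x 1 by omega] at a1
  rw [show 2 * ((x 0 - x 1) / 2) = x 0 - x 1 by omega] at a2
  have hk' : (0 : ℝ) < k := by exact_mod_cast hk1
  rw [tp_eq, div_le_div_iff₀ (by positivity) (by positivity), one_mul]
  have hc : (0 : ℝ) ≤ k.centralBinom := by positivity
  calc (4 ^ (2 * k) : ℝ) ≤ 4 * k * (k.centralBinom : ℝ) ^ 2 := centralBinom_sq_lower hk1
    _ = (k.centralBinom / 2) * (k.centralBinom / 2) * (16 * k) := by ring
    _ ≤ _ := by gcongr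

/-- The truncated Green function: expected number of visits to `x` up to time `n`. -/
noncomputable def green (n : ℕ) (x : Fin 2 → ℤ) : ℝ := ∑ s ∈ Finset.range (n + 1), tp s x

/-- A logarithm that is positive at every natural number. -/
noncomputable def lg (n : ℕ) : ℝ := Real.log (n + 2)

theorem half_lt_lg (n : ℕ) : 1 / 2 < lg n := by
  have h1 : Real.log 2 ≤ lg n := Real.log_le_log (by norm_num) (by simp)
  linarith [Real.log_two_gt_d9]

theorem lg_pos (n : ℕ) : 0 < lg n := by linarith [half_lt_lg n]

theorem lg_mono {m n : ℕ} (h : m ≤ n) : lg m ≤ lg n := by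
  unfold lg
  gcongr

theorem green_nonneg (n : ℕ) (x : Fin 2 → ℤ) : 0 ≤ green n x :=
  Finset.sum_nonneg fun _ _ => tp_nonneg _ _

theorem green_le (n : ℕ) (x : Fin 2 → ℤ) : green n x ≤ 4 * lg n := by
  have h1 : green n x ≤ 1 + (harmonic n : ℝ) := by
    rw [green, Finset.sum_range_succ', add_comm, harmonic]
    push_cast
    gcongr with i
    · exact tp_le_one _ _
    · have := tp_le (s := i + 1) (by omega) x
      simpa using this
  have h2 : (harmonic n : ℝ) ≤ 1 + lg n := by
    rcases Nat.eq_zero_or_pos n with rfl | hn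
    · simp only [harmonic_zero, Rat.cast_zero]
      linarith [lg_pos 0]
    · refine (harmonic_le_one_add_log n).trans ?_
      have : (0 : ℝ) < n := by exact_mod_cast hn
      have : Real.log n ≤ lg n := Real.log_le_log this (by linarith)
      linarith
  have h3 : Real.log 2 ≤ lg n := Real.log_le_log (by norm_num) (by simp)
  linarith [Real.log_two_gt_d9]

theorem lg_le_green_zero (n : ℕ) : lg n ≤ 4 * green n 0 := by
  have h1 : 1 + (harmonic (n / 2) : ℝ) / 4 ≤ green n 0 := by
    have hsub : (Finset.range (n / 2 + 1)).image (fun k => 2 * k) ⊆ Finset.range (n + 1) := by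
      intro k hk
      simp only [Finset.mem_image, Finset.mem_range] at hk ⊢
      omega
    refine le_trans ?_ (Finset.sum_le_sum_of_subset_of_nonneg hsub fun _ _ _ => tp_nonneg _ _)
    rw [Finset.sum_image (by intro a _ b _ h; simpa using h), Finset.sum_range_succ', add_comm,
      harmonic]
    push_cast
    rw [Finset.sum_div]
    gcongr with i
    · have := le_tp_even_zero (k := i + 1) (by omega)
      refine le_trans (le_of_eq ?_) this
      push_cast
      field_simp
    · rw [tp_zero]
      simp [ind]
  have h2 := log_add_one_le_harmonic (n / 2)
  have h3 : lg n ≤ Real.log ((n / 2 : ℕ) + 1 : ℕ) + 2 * Real.log 2 := by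
    have h4 : (n : ℝ) + 2 ≤ 4 * ((n / 2 : ℕ) + 1 : ℕ) := by
      have : n + 2 ≤ 4 * (n / 2 + 1) := by omega
      exact_mod_cast this
    have h5 : (0 : ℝ) < ((n / 2 : ℕ) + 1 : ℕ) := by positivity
    have h6 : 2 * Real.log 2 = Real.log 4 := by
      rw [show (4 : ℝ) = 2 ^ 2 by norm_num, Real.log_pow]
      norm_num
    rw [h6, add_comm, ← Real.log_mul (by norm_num) (by positivity)]
    exact Real.log_le_log (by positivity) h4
  linarith [Real.log_two_lt_d9]

theorem le_green {ρ : ℕ} {y : Fin 2 → ℤ} (hy : ∀ i, |y i| ≤ ρ) :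
    1 / 128 ≤ green (8 * (ρ + 1) ^ 2 + 1) y := by
  set K := 2 * (ρ + 1) ^ 2 with hK
  have hK1 : 1 ≤ K := by exact Nat.succ_le_of_lt (by positivity)
  have hK' : (0 : ℝ) < K := by exact_mod_cast hK1
  have key : ∀ ε : ℕ, ε ≤ 1 → (∀ k ∈ Finset.Ico K (2 * K), 1 / (64 * k : ℝ) ≤ tp (2 * k + ε) y) →
      1 / 128 ≤ green (8 * (ρ + 1) ^ 2 + 1) y := by
    intro ε hε h
    have hsub : (Finset.Ico K (2 * K)).image (fun k => 2 * k + ε) ⊆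
        Finset.range (8 * (ρ + 1) ^ 2 + 1 + 1) := by
      intro k hk
      simp only [Finset.mem_image, Finset.mem_range, Finset.mem_Ico] at hk ⊢
      omega
    refine le_trans ?_ (Finset.sum_le_sum_of_subset_of_nonneg hsub fun _ _ _ => tp_nonneg _ _)
    rw [Finset.sum_image (by intro a _ b _ h; simpa using h)]
    calc (1 / 128 : ℝ) = ∑ k ∈ Finset.Ico K (2 * K), 1 / (128 * K : ℝ) := by
          rw [Finset.sum_const, Nat.card_Ico, show 2 * K - K = K by omega, nsmul_eq_mul]
          field_simp
      _ ≤ ∑ k ∈ Finset.Ico K (2 * K), 1 / (64 * k : ℝ) := by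
          refine Finset.sum_le_sum fun k hk => ?_
          rw [Finset.mem_Ico] at hk
          have h1 : (K : ℝ) ≤ k := by exact_mod_cast hk.1
          have h2 : (k : ℝ) ≤ 2 * K := by exact_mod_cast hk.2.le
          apply one_div_le_one_div_of_le <;> linarith
      _ ≤ _ := Finset.sum_le_sum h
  have hk1 : ∀ k ∈ Finset.Ico K (2 * K), (0 : ℝ) < k := by
    intro k hk
    rw [Finset.mem_Ico] at hk
    exact_mod_cast (by omega : 0 < k)
  rcases Int.emod_two_eq_zero_or_one (y 0 + y 1) with hpar | hpar
  · refine key 0 (by norm_num) fun k hk => ?_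
    have hk0 := hk1 k hk
    rw [Finset.mem_Ico] at hk
    refine le_trans ?_ (le_tp_even (ρ := ρ + 1) hk.1 (by omega) (fun i => ?_) hpar)
    · apply one_div_le_one_div_of_le <;> linarith
    · push_cast
      linarith [hy i]
  · refine key 1 le_rfl fun k hk => ?_
    have hk0 := hk1 k hk
    rw [Finset.mem_Ico] at hk
    have h0 := abs_le.1 (hy 0)
    have h1 := abs_le.1 (hy 1)
    have := le_tp_even (ρ := ρ + 1) (x := y - step (0, true)) hk.1 (by omega) (fun i => by
      fin_cases i <;> simp [step] <;> rw [abs_le] <;> omega) (by simp [step]; omega)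
    have hs : tp (2 * k) (y - step (0, true)) ≤ ∑ a, tp (2 * k) (y - step a) :=
      Finset.single_le_sum (f := fun a => tp (2 * k) (y - step a)) (fun _ _ => tp_nonneg _ _)
        (Finset.mem_univ _)
    rw [tp_succ]
    have e : 1 / (64 * k : ℝ) = 1 / (16 * k) / 4 := by field_simp; norm_num
    rw [e]
    gcongr
    linarith

/-- The walk does not return to its starting point up to time `t`. -/
def NoReturn (w : ℕ → Fin 2 × Bool) (t : ℕ) : Prop := ∀ k, 1 ≤ k → k ≤ t → pos w k ≠ 0

/-- The probability of not returning to the origin up to time `t`. -/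
noncomputable def esc (t : ℕ) : ℝ := ex t (fun w => ind (NoReturn w t))

theorem esc_nonneg (t : ℕ) : 0 ≤ esc t := ex_nonneg fun _ => ind_nonneg _

theorem esc_le_one (t : ℕ) : esc t ≤ 1 := ex_le_one fun _ => ind_le_one _

theorem dependsOn_noReturn (s : ℕ) : DependsOn (fun w => ind (NoReturn w s)) (Set.Iio s) := by
  intro w w' h
  refine ind_congr (forall_congr' fun k => imp_congr_right fun _ => forall_congr' fun hk => ?_)
  rw [pos_congr h hk]

theorem esc_anti {s t : ℕ} (h : s ≤ t) : esc t ≤ esc s := by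
  rw [esc, esc, ← ex_of_dependsOn h (dependsOn_noReturn s)]
  exact ex_mono fun w => ind_mono fun hw k h1 h2 => hw k h1 (h2.trans h)

theorem esc_mul_green_le_one (t : ℕ) : esc t * green t 0 ≤ 1 := by
  have h : ∑ s ∈ Finset.range (t + 1), tp s 0 * esc (t - s) ≤ 1 := by
    have : ∀ s ∈ Finset.range (t + 1), tp s 0 * esc (t - s) =
        ex t (fun w => ind (pos w s = 0) * ind (NoReturn (shift s w) (t - s))) := by
      intro s hs
      rw [Finset.mem_range] at hs
      rw [ex_mul_shift' (t := t - s) (by omega) (dependsOn_pos_eq le_rfl 0)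
        (fun w => ind (NoReturn w (t - s)))]
      rfl
    rw [Finset.sum_congr rfl this, ← ex_sum]
    refine ex_le_one fun w => ?_
    simp only [← ind_and]
    refine sum_ind_le_one _ _ ?_
    have aux : ∀ i j, i < j → j < t + 1 →
        (pos w i = 0 ∧ NoReturn (shift i w) (t - i)) → ¬ pos w j = 0 := by
      rintro i j hij hj ⟨h1, h2⟩ h3
      refine h2 (j - i) (by omega) (by omega) ?_
      have := pos_add w i (j - i)
      rw [show i + (j - i) = j by omega, h1, h3, zero_add] at this
      exact this.symm
    intro i hi j hj hPi hPj
    rw [Finset.mem_range] at hi hj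
    by_contra hne
    rcases lt_or_gt_of_ne hne with hlt | hlt
    · exact aux i j hlt hj hPi hPj.1
    · exact aux j i hlt hi hPj hPi.1
  rw [green, Finset.mul_sum]
  refine le_trans (Finset.sum_le_sum fun s _ => ?_) h
  rw [mul_comm]
  exact mul_le_mul_of_nonneg_left (esc_anti (by omega)) (tp_nonneg _ _)

theorem esc_le (t : ℕ) : esc t ≤ 4 / lg t := by
  have h1 := esc_mul_green_le_one t
  have h2 := lg_le_green_zero t
  rw [le_div_iff₀ (lg_pos t)]
  nlinarith [esc_nonneg t]

/-- The probability of visiting `y` up to time `T`. -/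
noncomputable def hit (T : ℕ) (y : Fin 2 → ℤ) : ℝ := ex T (fun w => ind (Visits w T y))

theorem green_le_hit_mul (T : ℕ) (y : Fin 2 → ℤ) : green T y ≤ hit T y * green T 0 := by
  let FP : ℕ → (ℕ → Fin 2 × Bool) → Prop := fun σ w => pos w σ = y ∧ ∀ k < σ, pos w k ≠ y
  have hdep : ∀ σ, DependsOn (fun w => ind (FP σ w)) (Set.Iio σ) := by
    intro σ w w' h
    refine ind_congr (and_congr (by rw [pos_congr h le_rfl])
      (forall_congr' fun k => forall_congr' fun hk => ?_))
    rw [pos_congr h hk.le]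
  have h1 : ∀ s ∈ Finset.range (T + 1), tp s y ≤
      ∑ σ ∈ Finset.range (s + 1), ex σ (fun w => ind (FP σ w)) * tp (s - σ) 0 := by
    intro s _
    have : ∀ σ ∈ Finset.range (s + 1), ex σ (fun w => ind (FP σ w)) * tp (s - σ) 0 =
        ex s (fun w => ind (FP σ w) * ind (pos (shift σ w) (s - σ) = 0)) := by
      intro σ hσ
      rw [Finset.mem_range] at hσ
      rw [ex_mul_shift' (t := s - σ) (by omega) (hdep σ) (fun w => ind (pos w (s - σ) = 0))]
      rfl
    rw [Finset.sum_congr rfl this, ← ex_sum]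
    refine ex_mono fun w => ?_
    simp only [← ind_and]
    refine le_sum_ind _ _ fun hs => ?_
    classical
    have hex : ∃ k, pos w k = y := ⟨s, hs⟩
    have hle : Nat.find hex ≤ s := Nat.find_min' hex hs
    refine ⟨Nat.find hex, by rw [Finset.mem_range]; omega,
      ⟨Nat.find_spec hex, fun k hk => Nat.find_min hex hk⟩, ?_⟩
    have := pos_add w (Nat.find hex) (s - Nat.find hex)
    rw [show Nat.find hex + (s - Nat.find hex) = s by omega, hs, Nat.find_spec hex] at this
    simpa using this
  have h2 : ∑ σ ∈ Finset.range (T + 1), ex σ (fun w => ind (FP σ w)) ≤ hit T y := by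
    have : ∀ σ ∈ Finset.range (T + 1), ex σ (fun w => ind (FP σ w)) =
        ex T (fun w => ind (FP σ w)) := by
      intro σ hσ
      rw [Finset.mem_range] at hσ
      rw [ex_of_dependsOn (n := T) (by omega) (hdep σ)]
    rw [Finset.sum_congr rfl this, ← ex_sum]
    refine ex_mono fun w => ?_
    by_cases hv : Visits w T y
    · rw [ind_of_true hv]
      refine sum_ind_le_one _ _ fun i _ j _ hi hj => ?_
      by_contra hne
      rcases lt_or_gt_of_ne hne with hlt | hlt
      · exact hj.2 i hlt hi.1
      · exact hi.2 j hlt hj.1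
    · rw [ind_of_false hv]
      refine le_of_eq (Finset.sum_eq_zero fun σ hσ => ind_of_false fun h => hv ?_)
      rw [Finset.mem_range] at hσ
      exact ⟨σ, by omega, h.1⟩
  calc green T y ≤ ∑ s ∈ Finset.range (T + 1), ∑ σ ∈ Finset.range (s + 1),
        ex σ (fun w => ind (FP σ w)) * tp (s - σ) 0 := Finset.sum_le_sum h1
    _ = ∑ σ ∈ Finset.range (T + 1), ∑ s ∈ Finset.Ico σ (T + 1),
        ex σ (fun w => ind (FP σ w)) * tp (s - σ) 0 := by
        refine Finset.sum_comm' fun s σ => ?_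
        simp only [Finset.mem_range, Finset.mem_Ico]
        omega
    _ ≤ ∑ σ ∈ Finset.range (T + 1), ex σ (fun w => ind (FP σ w)) * green T 0 := by
        refine Finset.sum_le_sum fun σ hσ => ?_
        rw [← Finset.mul_sum]
        refine mul_le_mul_of_nonneg_left ?_ (ex_nonneg fun _ => ind_nonneg _)
        rw [Finset.sum_Ico_eq_sum_range]
        simp only [Nat.add_sub_cancel_left]
        exact Finset.sum_le_sum_of_subset_of_nonneg (Finset.range_mono (by omega))
          fun _ _ _ => tp_nonneg _ _
    _ ≤ _ := by
        rw [← Finset.sum_mul]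
        exact mul_le_mul_of_nonneg_right h2 (green_nonneg _ _)

/-- The indicator that the walk is at the origin at time `s`, not having visited `y` before. -/
noncomputable def preVisit (y : Fin 2 → ℤ) (s : ℕ) (w : ℕ → Fin 2 × Bool) : ℝ :=
  ind (pos w s = 0 ∧ ¬ Visits w s y)

/-- The number of visits to the origin before time `m` and before the first visit to `y`. -/
noncomputable def preVisits (y : Fin 2 → ℤ) (m : ℕ) (w : ℕ → Fin 2 × Bool) : ℝ :=
  ∑ s ∈ Finset.range m, preVisit y s w

theorem preVisit_nonneg (y : Fin 2 → ℤ) (s : ℕ) (w : ℕ → Fin 2 × Bool) : 0 ≤ preVisit y s w :=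
  ind_nonneg _

theorem preVisits_nonneg (y : Fin 2 → ℤ) (m : ℕ) (w : ℕ → Fin 2 × Bool) : 0 ≤ preVisits y m w :=
  Finset.sum_nonneg fun _ _ => ind_nonneg _

theorem preVisits_mono (y : Fin 2 → ℤ) {m n : ℕ} (h : m ≤ n) (w : ℕ → Fin 2 × Bool) :
    preVisits y m w ≤ preVisits y n w :=
  Finset.sum_le_sum_of_subset_of_nonneg (Finset.range_mono h) fun _ _ _ => ind_nonneg _

theorem dependsOn_preVisit (y : Fin 2 → ℤ) {s n : ℕ} (h : s ≤ n) :
    DependsOn (preVisit y s) (Set.Iio n) := by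
  intro w w' hw
  refine ind_congr (and_congr (by rw [pos_congr hw h]) (not_congr (visits_congr hw h y)))

theorem dependsOn_preVisits (y : Fin 2 → ℤ) (m : ℕ) :
    DependsOn (preVisits y m) (Set.Iio m) := by
  intro w w' hw
  refine Finset.sum_congr rfl fun s hs => ?_
  rw [Finset.mem_range] at hs
  exact dependsOn_preVisit y hs.le hw

theorem preVisit_mul_add (y : Fin 2 → ℤ) (s t : ℕ) (w : ℕ → Fin 2 × Bool) :
    preVisit y s w * preVisit y (s + t) w = preVisit y s w * preVisit y t (shift s w) := by
  simp only [preVisit, ← ind_and]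
  refine ind_congr (and_congr_right fun h => ?_)
  rw [visits_add_iff, pos_add, h.1]
  simp only [zero_add, sub_zero, not_or]
  exact and_congr_right fun _ => ⟨fun h' => h'.2, fun h' => ⟨h.2, h'⟩⟩

theorem preVisit_mul_sum (y : Fin 2 → ℤ) {s m : ℕ} (w : ℕ → Fin 2 × Bool) :
    preVisit y s w * ∑ t ∈ Finset.Ico s m, preVisit y t w =
      preVisit y s w * preVisits y (m - s) (shift s w) := by
  rw [Finset.sum_Ico_eq_sum_range, preVisits, Finset.mul_sum, Finset.mul_sum]
  exact Finset.sum_congr rfl fun t _ => preVisit_mul_add y s t w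

/-- Moments of the number of visits to the origin before time `m` and before visiting `y`. -/
noncomputable def preMoment (y : Fin 2 → ℤ) (q m : ℕ) : ℝ := ex m (fun w => preVisits y m w ^ q)

theorem preMoment_nonneg (y : Fin 2 → ℤ) (q m : ℕ) : 0 ≤ preMoment y q m :=
  ex_nonneg fun _ => pow_nonneg (preVisits_nonneg _ _ _) _

theorem preMoment_mono (y : Fin 2 → ℤ) (q : ℕ) {m n : ℕ} (h : m ≤ n) :
    preMoment y q m ≤ preMoment y q n := by
  have hd : DependsOn (fun w => preVisits y m w ^ q) (Set.Iio m) := by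
    intro w w' hw
    simp only [dependsOn_preVisits y m hw]
  rw [preMoment, ← ex_of_dependsOn h hd]
  exact ex_mono fun w => pow_le_pow_left₀ (preVisits_nonneg _ _ _) (preVisits_mono y h w) q

theorem pow_sum_le_tail (x : ℕ → ℝ) (hx : ∀ s, 0 ≤ x s) (q m : ℕ) :
    (∑ s ∈ Finset.range m, x s) ^ (q + 1) ≤
      (q + 1) * ∑ s ∈ Finset.range m, x s * (∑ t ∈ Finset.Ico s m, x t) ^ q := by
  have key : ∀ k ≤ m, (∑ t ∈ Finset.Ico (m - k) m, x t) ^ (q + 1) ≤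
      (q + 1) * ∑ s ∈ Finset.Ico (m - k) m, x s * (∑ t ∈ Finset.Ico s m, x t) ^ q := by
    intro k
    induction k with
    | zero => simp
    | succ k ih =>
      intro hk
      have ih := ih (by omega)
      have e : m - k = m - (k + 1) + 1 := by omega
      rw [Finset.sum_eq_sum_Ico_succ_bot (a := m - (k + 1)) (by omega) fun s =>
        x s * (∑ t ∈ Finset.Ico s m, x t) ^ q]
      rw [e] at ih
      set A := ∑ t ∈ Finset.Ico (m - (k + 1) + 1) m, x t with hA
      have hB : ∑ t ∈ Finset.Ico (m - (k + 1)) m, x t = x (m - (k + 1)) + A :=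
        Finset.sum_eq_sum_Ico_succ_bot (by omega) _
      rw [hB]
      have hx0 := hx (m - (k + 1))
      have hA0 : 0 ≤ A := Finset.sum_nonneg fun _ _ => hx _
      generalize x (m - (k + 1)) = a at *
      have hb : (a + A) ^ (q + 1) ≤ A ^ (q + 1) + (q + 1) * (a * (a + A) ^ q) := by
        rcases eq_or_lt_of_le (add_nonneg hx0 hA0) with h0 | h0
        · have ha : a = 0 := by linarith
          have hA' : A = 0 := by linarith
          simp [ha, hA']
        · have h1 := one_add_mul_le_pow (a := A / (a + A) - 1) (by
            have : 0 ≤ A / (a + A) := by positivity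
            linarith) (q + 1)
          have h2 : 1 + (A / (a + A) - 1) = A / (a + A) := by ring
          rw [h2, div_pow] at h1
          have h3 : A / (a + A) - 1 = -a / (a + A) := by field_simp; ring
          rw [h3, le_div_iff₀ (by positivity)] at h1
          push_cast at h1
          have h4 : (1 + ((q : ℝ) + 1) * (-a / (a + A))) * (a + A) ^ (q + 1) =
              (a + A) ^ (q + 1) - (q + 1) * (a * (a + A) ^ q) := by
            field_simp
            ring
          linarith
      linarith
  have := key m le_rfl
  simpa using this

theorem preMoment_succ_le (y : Fin 2 → ℤ) (q m : ℕ) :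
    preMoment y (q + 1) m ≤ (q + 1) * (preMoment y 1 m * preMoment y q m) := by
  calc preMoment y (q + 1) m
      ≤ ex m (fun w => (q + 1) * ∑ s ∈ Finset.range m, preVisit y s w *
          (preVisits y (m - s) (shift s w)) ^ q) := by
        refine ex_mono fun w => ?_
        refine (pow_sum_le_tail _ (fun s => preVisit_nonneg y s w) q m).trans (le_of_eq ?_)
        congr 1
        refine Finset.sum_congr rfl fun s _ => ?_
        by_cases h : pos w s = 0 ∧ ¬ Visits w s y
        · have := preVisit_mul_sum y (s := s) (m := m) w
          have h1 : preVisit y s w = 1 := ind_of_true h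
          rw [h1, one_mul, one_mul] at this
          rw [this]
        · have h1 : preVisit y s w = 0 := ind_of_false h
          rw [h1, zero_mul, zero_mul]
    _ = (q + 1) * ∑ s ∈ Finset.range m, ex s (preVisit y s) * preMoment y q (m - s) := by
        rw [ex_mul_left, ex_sum]
        congr 1
        refine Finset.sum_congr rfl fun s hs => ?_
        rw [Finset.mem_range] at hs
        rw [ex_mul_shift' (t := m - s) (by omega) (dependsOn_preVisit y le_rfl)
          (fun w => preVisits y (m - s) w ^ q)]
        rfl
    _ ≤ (q + 1) * ∑ s ∈ Finset.range m, ex s (preVisit y s) * preMoment y q m := by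
        gcongr with s hs
        · exact ex_nonneg fun _ => preVisit_nonneg _ _ _
        · exact preMoment_mono y q (by omega)
    _ = _ := by
        rw [← Finset.sum_mul]
        congr 2
        simp only [preMoment, pow_one, preVisits]
        rw [ex_sum]
        refine Finset.sum_congr rfl fun s hs => ?_
        rw [Finset.mem_range] at hs
        rw [ex_of_dependsOn hs.le (dependsOn_preVisit y le_rfl)]

theorem preVisits_le_first (y : Fin 2 → ℤ) (T m : ℕ) (w : ℕ → Fin 2 × Bool) :
    preVisits y m w ≤ ∑ s ∈ Finset.range (T + 1), ind (pos w s = 0) +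
      ∑ σ ∈ Finset.Ioo T m,
        ind ((pos w σ = 0 ∧ ∀ k, T < k → k < σ → pos w k ≠ 0) ∧ ¬ Visits w σ y) *
          preVisits y (m - σ) (shift σ w) := by
  have hsplit : preVisits y m w ≤ ∑ s ∈ Finset.range (T + 1), preVisit y s w +
      ∑ s ∈ Finset.Ioo T m, preVisit y s w := by
    rw [← Finset.sum_union]
    · refine Finset.sum_le_sum_of_subset_of_nonneg ?_ fun _ _ _ => ind_nonneg _
      intro s
      simp only [Finset.mem_range, Finset.mem_union, Finset.mem_Ioo]
      omega
    · rw [Finset.disjoint_left]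
      intro s
      simp only [Finset.mem_range, Finset.mem_Ioo]
      omega
  refine hsplit.trans (add_le_add (Finset.sum_le_sum fun s _ => ind_mono fun h => h.1) ?_)
  have hnn : ∀ σ ∈ Finset.Ioo T m,
      0 ≤ ind ((pos w σ = 0 ∧ ∀ k, T < k → k < σ → pos w k ≠ 0) ∧ ¬ Visits w σ y) *
          preVisits y (m - σ) (shift σ w) := fun σ _ =>
    mul_nonneg (ind_nonneg _) (preVisits_nonneg _ _ _)
  by_cases hex : ∃ s, T < s ∧ s < m ∧ pos w s = 0 ∧ ¬ Visits w s y
  · obtain ⟨s, hTs, hsm, hs0, hsv⟩ := hex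
    classical
    have hex' : ∃ k, T < k ∧ pos w k = 0 := ⟨s, hTs, hs0⟩
    obtain ⟨hT, h0⟩ := Nat.find_spec hex'
    have hmin : ∀ k, T < k → k < Nat.find hex' → pos w k ≠ 0 := fun k h1 h2 h3 =>
      Nat.find_min hex' h2 ⟨h1, h3⟩
    have hle : Nat.find hex' ≤ s := Nat.find_min' hex' ⟨hTs, hs0⟩
    generalize Nat.find hex' = σ at *
    have hσv : ¬ Visits w σ y := fun h => hsv (h.mono hle)
    have hσ1 : preVisit y σ w = 1 := ind_of_true ⟨h0, hσv⟩
    refine le_trans ?_ (Finset.single_le_sum hnn (Finset.mem_Ioo.2 ⟨hT, by omega⟩ : σ ∈ _))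
    have := preVisit_mul_sum y (s := σ) (m := m) w
    rw [hσ1, one_mul, one_mul] at this
    rw [ind_of_true ⟨⟨h0, hmin⟩, hσv⟩, one_mul, ← this]
    refine le_of_eq (Finset.sum_subset_zero_on_sdiff ?_ ?_ fun _ _ => rfl).symm
    · intro t
      simp only [Finset.mem_Ico, Finset.mem_Ioo]
      omega
    · intro t ht
      simp only [Finset.mem_sdiff, Finset.mem_Ico, Finset.mem_Ioo] at ht
      exact ind_of_false fun h => hmin t ht.1.1 (by omega) h.1
  · push Not at hex
    rw [Finset.sum_eq_zero]
    · exact Finset.sum_nonneg hnn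
    · intro s hs
      rw [Finset.mem_Ioo] at hs
      exact ind_of_false fun h => h.2 (hex s hs.1 hs.2 h.1)

theorem preMoment_one_le (y : Fin 2 → ℤ) (T m : ℕ) :
    hit T y * preMoment y 1 m ≤ green T 0 := by
  let E : ℕ → (ℕ → Fin 2 × Bool) → Prop := fun σ w =>
    (pos w σ = 0 ∧ ∀ k, T < k → k < σ → pos w k ≠ 0) ∧ ¬ Visits w σ y
  have hdep : ∀ σ, DependsOn (fun w => ind (E σ w)) (Set.Iio σ) := by
    intro σ w w' h
    refine ind_congr (and_congr (and_congr (by rw [pos_congr h le_rfl])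
      (forall_congr' fun k => imp_congr_right fun _ => forall_congr' fun hk => ?_))
      (not_congr (visits_congr h le_rfl y)))
    rw [pos_congr h hk.le]
  set N := max (T + 1) m with hN
  have h1 : preMoment y 1 m ≤ green T 0 +
      ∑ σ ∈ Finset.Ioo T m, ex σ (fun w => ind (E σ w)) * preMoment y 1 (m - σ) := by
    have e : preMoment y 1 m = ex N (preVisits y m) := by
      rw [ex_of_dependsOn (le_max_right _ _) (dependsOn_preVisits y m), preMoment]
      simp only [pow_one]
    rw [e]
    refine (ex_mono (preVisits_le_first y T m)).trans (le_of_eq ?_)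
    rw [ex_add, ex_sum, ex_sum]
    congr 1
    · refine Finset.sum_congr rfl fun s hs => ?_
      rw [Finset.mem_range] at hs
      exact ex_pos_eq (by omega) 0
    · refine Finset.sum_congr rfl fun σ hσ => ?_
      rw [Finset.mem_Ioo] at hσ
      rw [ex_mul_shift' (t := N - σ) (by omega) (hdep σ) (fun w => preVisits y (m - σ) w),
        ex_of_dependsOn (n := N - σ) (by omega) (dependsOn_preVisits y (m - σ)), preMoment]
      simp only [pow_one]
  have h2 : ∑ σ ∈ Finset.Ioo T m, ex σ (fun w => ind (E σ w)) ≤ 1 - hit T y := by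
    have : ∀ σ ∈ Finset.Ioo T m, ex σ (fun w => ind (E σ w)) = ex N (fun w => ind (E σ w)) := by
      intro σ hσ
      rw [Finset.mem_Ioo] at hσ
      rw [ex_of_dependsOn (n := N) (by omega) (hdep σ)]
    rw [Finset.sum_congr rfl this, ← ex_sum]
    have hh : hit T y = ex N (fun w => ind (Visits w T y)) := by
      rw [hit]
      exact (ex_of_dependsOn (by omega)
        (fun w w' h => ind_congr (visits_congr h le_rfl y))).symm
    have hone : ex N (fun w => ∑ σ ∈ Finset.Ioo T m, ind (E σ w)) +
        ex N (fun w => ind (Visits w T y)) ≤ 1 := by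
      rw [← ex_add]
      refine ex_le_one fun w => ?_
      by_cases hv : Visits w T y
      · rw [ind_of_true hv, Finset.sum_eq_zero]
        · norm_num
        · intro σ hσ
          rw [Finset.mem_Ioo] at hσ
          exact ind_of_false fun h => h.2 (hv.mono hσ.1.le)
      · rw [ind_of_false hv, add_zero]
        refine sum_ind_le_one _ _ fun i hi j hj hPi hPj => ?_
        rw [Finset.mem_Ioo] at hi hj
        by_contra hne
        rcases lt_or_gt_of_ne hne with hlt | hlt
        · exact hPj.1.2 i hi.1 hlt hPi.1.1
        · exact hPi.1.2 j hj.1 hlt hPj.1.1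
    linarith
  have h3 : ∑ σ ∈ Finset.Ioo T m, ex σ (fun w => ind (E σ w)) * preMoment y 1 (m - σ) ≤
      (1 - hit T y) * preMoment y 1 m := by
    refine le_trans ?_ (mul_le_mul_of_nonneg_right h2 (preMoment_nonneg y 1 m))
    rw [Finset.sum_mul]
    refine Finset.sum_le_sum fun σ _ => ?_
    exact mul_le_mul_of_nonneg_left (preMoment_mono y 1 (by omega))
      (ex_nonneg fun _ => ind_nonneg _)
  linarith

/-- The number of visits to the origin before visiting a point at distance at most `ρ` has
expectation polylogarithmic in `ρ`. -/
theorem preMoment_one_le_lg {ρ : ℕ} {y : Fin 2 → ℤ} (hy : ∀ i, |y i| ≤ ρ) (m : ℕ) :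
    preMoment y 1 m ≤ 2048 * lg (8 * (ρ + 1) ^ 2 + 1) ^ 2 := by
  set T := 8 * (ρ + 1) ^ 2 + 1
  have h1 := preMoment_one_le y T m
  have h2 := green_le_hit_mul T y
  have h3 := le_green hy
  have h4 := green_le T 0
  have h5 := green_nonneg T 0
  have h6 := preMoment_nonneg y 1 m
  have h7 : 0 ≤ hit T y := ex_nonneg fun _ => ind_nonneg _
  have h8 : 1 / 128 * preMoment y 1 m ≤ green T 0 * green T 0 := by
    calc 1 / 128 * preMoment y 1 m ≤ hit T y * green T 0 * preMoment y 1 m := by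
          gcongr
          linarith
      _ = (hit T y * preMoment y 1 m) * green T 0 := by ring
      _ ≤ _ := by gcongr
  have h9 : green T 0 * green T 0 ≤ (4 * lg T) * (4 * lg T) :=
    mul_le_mul h4 h4 h5 (by have := lg_pos T; linarith)
  linarith

/-- The cube of radius `ρ` around the origin. -/
noncomputable def cube (ρ : ℕ) : Finset (Fin 2 → ℤ) := Fintype.piFinset fun _ => Finset.Icc (-(ρ : ℤ)) ρ

theorem mem_cube {ρ : ℕ} {y : Fin 2 → ℤ} : y ∈ cube ρ ↔ ∀ i, |y i| ≤ ρ := by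
  simp [cube, Fintype.mem_piFinset, abs_le]

theorem zero_mem_cube (ρ : ℕ) : (0 : Fin 2 → ℤ) ∈ cube ρ := by
  simp [mem_cube]

theorem card_cube (ρ : ℕ) : (cube ρ).card = (2 * ρ + 1) ^ 2 := by
  simp only [cube, Fintype.card_piFinset, Int.card_Icc, Finset.prod_const, Finset.card_univ,
    Fintype.card_fin]
  congr 1
  omega

/-- Some point of the cube of radius `ρ` is not visited up to time `s`. -/
def Uncov (ρ : ℕ) (w : ℕ → Fin 2 × Bool) (s : ℕ) : Prop := ∃ y ∈ cube ρ, ¬ Visits w s y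

theorem Uncov.anti {ρ : ℕ} {w : ℕ → Fin 2 × Bool} {m n : ℕ} (h : m ≤ n) (hn : Uncov ρ w n) :
    Uncov ρ w m := by
  obtain ⟨y, hy, hv⟩ := hn
  exact ⟨y, hy, fun h' => hv (h'.mono h)⟩

theorem uncov_congr {ρ : ℕ} {w w' : ℕ → Fin 2 × Bool} {s k : ℕ}
    (h : ∀ i ∈ Set.Iio s, w i = w' i) (hk : k ≤ s) : Uncov ρ w k ↔ Uncov ρ w' k :=
  exists_congr fun y => and_congr_right fun _ => not_congr (visits_congr h hk y)

/-- The probability that the cube of radius `ρ` is not covered up to time `m`. -/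
noncomputable def unc (ρ m : ℕ) : ℝ := ex m fun w => ind (Uncov ρ w m)

theorem unc_nonneg (ρ m : ℕ) : 0 ≤ unc ρ m := ex_nonneg fun _ => ind_nonneg _

theorem unc_le_one (ρ m : ℕ) : unc ρ m ≤ 1 := ex_le_one fun _ => ind_le_one _

/-- The number of visits to the origin before time `m` and before covering the cube. -/
noncomputable def uncovVisits (ρ m : ℕ) (w : ℕ → Fin 2 × Bool) : ℝ :=
  ∑ s ∈ Finset.range m, ind (pos w s = 0 ∧ Uncov ρ w s)

theorem exists_uncovVisits_le (ρ m : ℕ) (w : ℕ → Fin 2 × Bool) :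
    ∃ y ∈ cube ρ, uncovVisits ρ m w ≤ preVisits y m w := by
  induction m with
  | zero => exact ⟨0, zero_mem_cube ρ, by simp [uncovVisits, preVisits]⟩
  | succ m ih =>
    by_cases h : pos w m = 0 ∧ Uncov ρ w m
    · obtain ⟨-, y, hy, hv⟩ := h
      refine ⟨y, hy, Finset.sum_le_sum fun s hs => ind_mono fun h => ⟨h.1, fun h' => ?_⟩⟩
      rw [Finset.mem_range] at hs
      exact hv (h'.mono (by omega))
    · obtain ⟨y, hy, hle⟩ := ih
      refine ⟨y, hy, ?_⟩
      rw [uncovVisits, Finset.sum_range_succ, ind_of_false h, add_zero]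
      exact hle.trans (preVisits_mono y (by omega) w)

/-- An upper bound for the expected number of visits to the origin before covering the cube. -/
noncomputable def covBound (ρ : ℕ) (L : ℝ) : ℝ :=
  L + (2 * ρ + 1) ^ 2 * (6 * (2048 * lg (8 * (ρ + 1) ^ 2 + 1) ^ 2) ^ 3) / L ^ 2

theorem covBound_nonneg (ρ : ℕ) {L : ℝ} (hL : 0 < L) : 0 ≤ covBound ρ L := by
  unfold covBound
  have := lg_pos (8 * (ρ + 1) ^ 2 + 1)
  positivity

theorem preMoment_three_le {ρ : ℕ} {y : Fin 2 → ℤ} (hy : y ∈ cube ρ) (m : ℕ) :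
    preMoment y 3 m ≤ 6 * (2048 * lg (8 * (ρ + 1) ^ 2 + 1) ^ 2) ^ 3 := by
  have h1 := preMoment_one_le_lg (mem_cube.1 hy) m
  have h0 := preMoment_nonneg y 1 m
  have h2 := preMoment_succ_le y 1 m
  have h3 := preMoment_succ_le y 2 m
  have h4 := preMoment_nonneg y 2 m
  norm_num at h2 h3
  calc preMoment y 3 m ≤ 3 * (preMoment y 1 m * (2 * (preMoment y 1 m * preMoment y 1 m))) := by
        refine h3.trans ?_
        gcongr
    _ = 6 * preMoment y 1 m ^ 3 := by ring
    _ ≤ _ := by gcongr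

theorem ex_uncovVisits_le (ρ m : ℕ) {L : ℝ} (hL : 0 < L) :
    ex m (uncovVisits ρ m) ≤ covBound ρ L := by
  have hpt : ∀ w, uncovVisits ρ m w ≤
      L + (1 / L ^ 2) * ∑ y ∈ cube ρ, preVisits y m w ^ 3 := by
    intro w
    obtain ⟨y, hy, hle⟩ := exists_uncovVisits_le ρ m w
    have h0 : 0 ≤ uncovVisits ρ m w := Finset.sum_nonneg fun _ _ => ind_nonneg _
    have hs : preVisits y m w ^ 3 ≤ ∑ y ∈ cube ρ, preVisits y m w ^ 3 :=
      Finset.single_le_sum (f := fun y => preVisits y m w ^ 3)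
        (fun z _ => pow_nonneg (preVisits_nonneg z m w) 3) hy
    have hc : uncovVisits ρ m w ^ 3 ≤ ∑ y ∈ cube ρ, preVisits y m w ^ 3 :=
      (pow_le_pow_left₀ h0 hle 3).trans hs
    have hc0 := (pow_nonneg h0 3).trans hc
    rcases le_total (uncovVisits ρ m w) L with h | h
    · have : 0 ≤ (1 / L ^ 2) * ∑ y ∈ cube ρ, preVisits y m w ^ 3 := by positivity
      linarith
    · have h1 : uncovVisits ρ m w ≤ (1 / L ^ 2) * uncovVisits ρ m w ^ 3 := by
        rw [one_div, ← div_eq_inv_mul, le_div_iff₀ (by positivity)]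
        calc uncovVisits ρ m w * L ^ 2 ≤ uncovVisits ρ m w * uncovVisits ρ m w ^ 2 := by gcongr
          _ = _ := by ring
      have h2 : (1 / L ^ 2) * uncovVisits ρ m w ^ 3 ≤
          (1 / L ^ 2) * ∑ y ∈ cube ρ, preVisits y m w ^ 3 := by gcongr
      linarith
  refine (ex_mono hpt).trans ?_
  rw [ex_add, ex_const, ex_mul_left, ex_sum]
  have : ∑ y ∈ cube ρ, ex m (fun w => preVisits y m w ^ 3) ≤
      (2 * ρ + 1) ^ 2 * (6 * (2048 * lg (8 * (ρ + 1) ^ 2 + 1) ^ 2) ^ 3) := by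
    refine (Finset.sum_le_card_nsmul _ _ _ fun y hy => preMoment_three_le hy m).trans ?_
    rw [card_cube, nsmul_eq_mul]
    push_cast
    exact le_rfl
  unfold covBound
  rw [one_div, ← div_eq_inv_mul]
  gcongr

theorem unc_le_sum (ρ m : ℕ) :
    unc ρ m ≤ ∑ s ∈ Finset.range (m + 1),
      ex s (fun w => ind (pos w s = 0 ∧ Uncov ρ w s)) * esc (m - s) := by
  have : ∀ s ∈ Finset.range (m + 1),
      ex s (fun w => ind (pos w s = 0 ∧ Uncov ρ w s)) * esc (m - s) =
      ex m (fun w => ind (pos w s = 0 ∧ Uncov ρ w s) * ind (NoReturn (shift s w) (m - s))) := by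
    intro s hs
    rw [Finset.mem_range] at hs
    rw [ex_mul_shift' (t := m - s) (by omega) (fun w w' h => ind_congr (and_congr
      (by rw [pos_congr h le_rfl]) (uncov_congr h le_rfl))) (fun w => ind (NoReturn w (m - s)))]
    rfl
  rw [Finset.sum_congr rfl this, ← ex_sum]
  refine ex_mono fun w => ?_
  simp only [← ind_and]
  refine le_sum_ind _ _ fun h => ?_
  classical
  obtain ⟨s, hs, hmax⟩ := Finset.exists_max_image
    ((Finset.range (m + 1)).filter fun s => pos w s = 0) id
    ⟨0, by simp [pos_zero]⟩
  simp only [Finset.mem_filter, Finset.mem_range, id] at hs hmax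
  refine ⟨s, Finset.mem_range.2 hs.1, ⟨hs.2, h.anti (by omega)⟩, fun k hk1 hk2 h0 => ?_⟩
  have := hmax (s + k) ⟨by omega, by rw [pos_add, hs.2, h0, add_zero]⟩
  omega

theorem lg_le_two_mul_lg_sqrt (m : ℕ) : lg m ≤ 2 * lg (Nat.sqrt m) := by
  have h := Nat.lt_succ_sqrt m
  have : lg m ≤ Real.log (((Nat.sqrt m : ℝ) + 2) ^ 2) := by
    refine Real.log_le_log (by positivity) ?_
    have h' : m + 2 ≤ (Nat.sqrt m + 2) ^ 2 := by
      simp only [Nat.succ_eq_add_one] at h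
      nlinarith
    exact_mod_cast h'
  rw [Real.log_pow] at this
  push_cast at this
  exact this

theorem lg_le_add_one (m : ℕ) : lg m ≤ m + 1 := by
  have := Real.log_le_sub_one_of_pos (show (0 : ℝ) < m + 2 by positivity)
  unfold lg
  linarith

theorem esc_sqrt_le (m : ℕ) : esc (Nat.sqrt m) ≤ 8 / lg m := by
  refine (esc_le _).trans ?_
  rw [div_le_div_iff₀ (lg_pos _) (lg_pos _)]
  linarith [lg_le_two_mul_lg_sqrt m]

/-- The probability of not covering the cube of radius `ρ` in time `m`. -/
theorem unc_le (ρ m : ℕ) {L : ℝ} (hL : 0 < L) : unc ρ m ≤ 8 * (covBound ρ L + 1) / lg m := by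
  have hlg := lg_pos m
  set k := Nat.sqrt m with hk
  have hkm : k * k ≤ m := Nat.sqrt_le m
  set d : ℕ → ℝ := fun s => ex s (fun w => ind (pos w s = 0 ∧ Uncov ρ w s)) with hd
  have hd0 : ∀ s, 0 ≤ d s := fun s => ex_nonneg fun _ => ind_nonneg _
  have hdt : ∀ s, d s ≤ tp s 0 := fun s => ex_mono fun w => ind_mono fun h => h.1
  have hsum : ∑ s ∈ Finset.range (m + 1), d s ≤ covBound ρ L := by
    refine le_trans (le_of_eq ?_) (ex_uncovVisits_le ρ (m + 1) hL)
    unfold uncovVisits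
    rw [ex_sum]
    refine Finset.sum_congr rfl fun s hs => ?_
    rw [Finset.mem_range] at hs
    exact (ex_of_dependsOn (by omega) (fun w w' h => ind_congr (and_congr
      (by rw [pos_congr h le_rfl]) (uncov_congr h le_rfl)))).symm
  have hterm : ∀ s ∈ Finset.range (m + 1), d s * esc (m - s) ≤
      8 / lg m * d s + if m - k < s then tp s 0 else 0 := by
    intro s hs
    split_ifs with h
    · have h1 : d s * esc (m - s) ≤ d s * 1 := by
        gcongr
        · exact hd0 s
        · exact esc_le_one _
      have h2 : 0 ≤ 8 / lg m * d s := mul_nonneg (by positivity) (hd0 s)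
      linarith [hdt s]
    · rw [add_zero, mul_comm]
      gcongr
      · exact hd0 s
      · exact (esc_anti (by have := Nat.sqrt_le_self m; omega)).trans (esc_sqrt_le m)
  have htail : ∑ s ∈ Finset.range (m + 1), (if m - k < s then tp s 0 else 0) ≤ 8 / lg m := by
    rw [← Finset.sum_filter]
    have hf : (Finset.range (m + 1)).filter (fun s => m - k < s) = Finset.Ioc (m - k) m := by
      ext s
      simp only [Finset.mem_filter, Finset.mem_range, Finset.mem_Ioc]
      omega
    rw [hf]
    rcases Nat.eq_zero_or_pos k with h0 | h0
    · rw [h0]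
      simp
      positivity
    have hk1 : (1 : ℝ) ≤ k := by exact_mod_cast h0
    have hkk : k ≤ k * k := Nat.le_mul_self k
    have hb : ∀ s ∈ Finset.Ioc (m - k) m, tp s 0 ≤ 1 / ((k : ℝ) * k - k + 1) := by
      intro s hs
      rw [Finset.mem_Ioc] at hs
      refine (tp_le (by omega) 0).trans ?_
      have h3 : k * k + 1 ≤ s + k := by omega
      have h4 : (k : ℝ) * k + 1 ≤ s + k := by exact_mod_cast h3
      apply one_div_le_one_div_of_le
      · nlinarith
      · linarith
    refine (Finset.sum_le_card_nsmul _ _ _ hb).trans ?_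
    have hcard : (Finset.Ioc (m - k) m).card = k := by
      rw [Nat.card_Ioc]
      have := Nat.sqrt_le_self m
      omega
    rw [hcard, nsmul_eq_mul, mul_one_div, div_le_div_iff₀ (by nlinarith) hlg]
    have h5 : lg m ≤ 2 * (k + 1) := by
      linarith [lg_le_two_mul_lg_sqrt m, lg_le_add_one k]
    nlinarith
  refine (unc_le_sum ρ m).trans ((Finset.sum_le_sum hterm).trans ?_)
  rw [Finset.sum_add_distrib, ← Finset.mul_sum]
  have h6 : 8 / lg m * ∑ s ∈ Finset.range (m + 1), d s ≤ 8 / lg m * covBound ρ L := by gcongr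
  have h7 : 8 * (covBound ρ L + 1) / lg m = 8 / lg m * covBound ρ L + 8 / lg m := by ring
  rw [h7]
  linarith

/-- The range of the walk up to time `n`. -/
def rng (w : ℕ → Fin 2 × Bool) (n : ℕ) : Finset (Fin 2 → ℤ) :=
  (Finset.range (n + 1)).image (pos w)

theorem mem_rng {w : ℕ → Fin 2 × Bool} {n : ℕ} {y : Fin 2 → ℤ} : y ∈ rng w n ↔ Visits w n y := by
  simp [rng, Visits]

open Classical in
/-- The points of `A` at distance at most `ρ` from the complement of `A`. -/
noncomputable def badPoints (ρ : ℕ) (A : Finset (Fin 2 → ℤ)) : Finset (Fin 2 → ℤ) :=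
  A.filter fun x => ∃ y ∈ cube ρ, x + y ∉ A

theorem mem_badPoints {ρ : ℕ} {A : Finset (Fin 2 → ℤ)} {x : Fin 2 → ℤ} :
    x ∈ badPoints ρ A ↔ x ∈ A ∧ ∃ y ∈ cube ρ, x + y ∉ A := by
  simp [badPoints]

/-- Time `t` is a first visit. -/
def Fresh (w : ℕ → Fin 2 × Bool) (t : ℕ) : Prop := ∀ k < t, pos w k ≠ pos w t

theorem dependsOn_fresh (t : ℕ) : DependsOn (fun w => ind (Fresh w t)) (Set.Iio t) := by
  intro w w' h
  refine ind_congr (forall_congr' fun k => forall_congr' fun hk => ?_)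
  rw [pos_congr h hk.le, pos_congr h le_rfl]

theorem ex_fresh (t : ℕ) : ex t (fun w => ind (Fresh w t)) = esc t := by
  rw [esc, ← ex_rev t fun w => ind (NoReturn w t)]
  congr 1
  funext w
  refine ind_congr ⟨fun h k h1 h2 h0 => ?_, fun h k hk h0 => ?_⟩
  · rw [pos_rev h2, sub_eq_zero] at h0
    exact h (t - k) (by omega) h0
  · refine h (t - k) (by omega) (by omega) ?_
    rw [pos_rev (by omega), Nat.sub_sub_self hk.le, h0, sub_self]

theorem card_badPoints_le (ρ n : ℕ) (w : ℕ → Fin 2 × Bool) :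
    ((badPoints ρ (rng w n)).card : ℝ) ≤
      ∑ t ∈ Finset.range (n + 1), ind (Fresh w t) * ind (Uncov ρ (shift t w) (n - t)) := by
  classical
  have hsub : badPoints ρ (rng w n) ⊆ ((Finset.range (n + 1)).filter fun t =>
      Fresh w t ∧ Uncov ρ (shift t w) (n - t)).image (pos w) := by
    intro x hx
    rw [mem_badPoints, mem_rng] at hx
    obtain ⟨⟨k, hk, hkx⟩, y, hy, hxy⟩ := hx
    have hex : ∃ k, pos w k = x := ⟨k, hkx⟩
    have h1 := Nat.find_spec hex
    have h2 : ∀ j < Nat.find hex, pos w j ≠ x := fun j hj => Nat.find_min hex hj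
    have h3 : Nat.find hex ≤ k := Nat.find_min' hex hkx
    generalize Nat.find hex = t at *
    rw [Finset.mem_image]
    refine ⟨t, ?_, h1⟩
    rw [Finset.mem_filter, Finset.mem_range]
    refine ⟨by omega, fun j hj => by rw [h1]; exact h2 j hj, y, hy, fun ⟨j, hj, hjy⟩ => hxy ?_⟩
    rw [mem_rng]
    exact ⟨t + j, by omega, by rw [pos_add, h1, hjy]⟩
  have hcard := (Finset.card_le_card hsub).trans Finset.card_image_le
  refine (Nat.cast_le.2 hcard).trans (le_of_eq ?_)
  rw [Finset.card_filter]
  push_cast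
  refine Finset.sum_congr rfl fun t _ => ?_
  rw [← ind_and]
  by_cases h : Fresh w t ∧ Uncov ρ (shift t w) (n - t)
  · rw [if_pos h, ind_of_true h]
  · rw [if_neg h, ind_of_false h]

theorem ex_card_badPoints_le_sum (ρ n : ℕ) :
    ex n (fun w => ((badPoints ρ (rng w n)).card : ℝ)) ≤
      ∑ t ∈ Finset.range (n + 1), esc t * unc ρ (n - t) := by
  refine (ex_mono (card_badPoints_le ρ n)).trans (le_of_eq ?_)
  rw [ex_sum]
  refine Finset.sum_congr rfl fun t ht => ?_
  rw [Finset.mem_range] at ht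
  rw [ex_mul_shift' (t := n - t) (by omega) (dependsOn_fresh t)
    (fun w => ind (Uncov ρ w (n - t))), ex_fresh]
  rfl

/-- The expected number of points of the range at distance at most `ρ` from its complement. -/
theorem ex_card_badPoints_le (ρ n : ℕ) {L : ℝ} (hL : 0 < L) :
    ex n (fun w => ((badPoints ρ (rng w n)).card : ℝ)) ≤
      2 * Nat.sqrt n + 128 * (covBound ρ L + 1) * (n + 1) / lg n ^ 2 := by
  have hlg := lg_pos n
  have hcov := covBound_nonneg ρ hL
  set k := Nat.sqrt n with hk
  set A : ℝ := 128 * (covBound ρ L + 1) / lg n ^ 2 with hA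
  have hA0 : 0 ≤ A := by positivity
  have hterm : ∀ t ∈ Finset.range (n + 1), esc t * unc ρ (n - t) ≤
      A + ((if t < k then 1 else 0) + if n - t < k then 1 else 0) := by
    intro t ht
    have hle : esc t * unc ρ (n - t) ≤ 1 :=
      mul_le_one₀ (esc_le_one t) (unc_nonneg _ _) (unc_le_one _ _)
    split_ifs with h1 h2 h2
    · linarith
    · linarith
    · linarith
    · have h3 : esc t ≤ 8 / lg n := (esc_anti (by omega)).trans (esc_sqrt_le n)
      have h4 : unc ρ (n - t) ≤ 16 * (covBound ρ L + 1) / lg n := by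
        refine (unc_le ρ (n - t) hL).trans ?_
        rw [div_le_div_iff₀ (lg_pos _) hlg]
        have : lg n ≤ 2 * lg (n - t) := (lg_le_two_mul_lg_sqrt n).trans
          (mul_le_mul_of_nonneg_left (lg_mono (by omega)) (by norm_num))
        nlinarith
      have h5 : esc t * unc ρ (n - t) ≤ 8 / lg n * (16 * (covBound ρ L + 1) / lg n) :=
        mul_le_mul h3 h4 (unc_nonneg _ _) (by positivity)
      have h6 : 8 / lg n * (16 * (covBound ρ L + 1) / lg n) = A := by
        rw [hA]
        field_simp
        ring
      linarith
  refine (ex_card_badPoints_le_sum ρ n).trans ((Finset.sum_le_sum hterm).trans ?_)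
  rw [Finset.sum_add_distrib, Finset.sum_add_distrib, Finset.sum_const, Finset.card_range,
    nsmul_eq_mul]
  have hr : ∑ t ∈ Finset.range (n + 1), (if n - t < k then (1 : ℝ) else 0) =
      ∑ t ∈ Finset.range (n + 1), if t < k then (1 : ℝ) else 0 := by
    rw [← Finset.sum_range_reflect]
    refine Finset.sum_congr rfl fun t ht => ?_
    rw [Finset.mem_range] at ht
    have : n - (n + 1 - 1 - t) = t := by omega
    rw [this]
  have h1 : ∑ t ∈ Finset.range (n + 1), (if t < k then (1 : ℝ) else 0) ≤ k := by
    rw [← Finset.sum_filter, Finset.sum_const, nsmul_eq_mul, mul_one]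
    have : (Finset.range (n + 1)).filter (fun t => t < k) ⊆ Finset.range k := by
      intro t
      simp
    exact_mod_cast (Finset.card_le_card this).trans (by simp)
  rw [hr]
  have h2 : 128 * (covBound ρ L + 1) * (n + 1) / lg n ^ 2 = ((n + 1 : ℕ) : ℝ) * A := by
    rw [hA]
    push_cast
    ring
  rw [h2]
  linarith

/-- The index of the dyadic square of side `2 ^ j` containing `x`. -/
def blk (j : ℕ) (x : Fin 2 → ℤ) : Fin 2 → ℤ := fun i => x i / 2 ^ j

open Classical in
/-- The indices of the dyadic squares of side `2 ^ j` that meet both `A` and its complement. -/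
noncomputable def mixed (j : ℕ) (A : Finset (Fin 2 → ℤ)) : Finset (Fin 2 → ℤ) :=
  (A.image (blk j)).filter fun z => ∃ y, blk j y = z ∧ y ∉ A

theorem mem_mixed {j : ℕ} {A : Finset (Fin 2 → ℤ)} {z : Fin 2 → ℤ} :
    z ∈ mixed j A ↔ (∃ a ∈ A, blk j a = z) ∧ ∃ y, blk j y = z ∧ y ∉ A := by
  simp [mixed]

theorem abs_step_le (c : Fin 2 × Bool) (i : Fin 2) : |step c i| ≤ 1 := by
  unfold step
  split_ifs <;> simp

theorem eq_of_unit_steps {f : ℕ → ℤ} (hf : ∀ k, |f (k + 1) - f k| ≤ 1) {n : ℕ} {v : ℤ}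
    {p q : ℕ} (hp : p ≤ n) (hq : q ≤ n) (hpv : f p < v) (hqv : v ≤ f q) :
    ∃ k ≤ n, f k = v := by
  by_contra! hne
  have key : ∀ k ≤ n, (f k < v ↔ f 0 < v) := by
    intro k
    induction k with
    | zero => simp
    | succ k ih =>
      intro hk
      have h1 := abs_le.1 (hf k)
      have h2 := hne k (by omega)
      have h3 := hne (k + 1) hk
      rw [← ih (by omega)]
      omega
  have h1 := key p hp
  have h2 := key q hq
  omega

/-- The distance in the maximum norm. -/
def supDist (x a : Fin 2 → ℤ) : ℤ := max |x 0 - a 0| |x 1 - a 1|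

theorem supDist_le_iff {x a : Fin 2 → ℤ} {r : ℤ} :
    supDist x a ≤ r ↔ ∀ i, |x i - a i| ≤ r := by
  simp [supDist, Fin.forall_fin_two]

theorem abs_supDist_step (w : ℕ → Fin 2 × Bool) (a : Fin 2 → ℤ) (k : ℕ) :
    |supDist (pos w (k + 1)) a - supDist (pos w k) a| ≤ 1 := by
  have h0 := abs_step_le (w k) 0
  have h1 := abs_step_le (w k) 1
  simp only [supDist, pos_succ, Pi.add_apply]
  refine (abs_max_sub_max_le_max _ _ _ _).trans (max_le ?_ ?_)
  · refine (abs_abs_sub_abs_le _ _).trans ?_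
    rwa [add_sub_right_comm, add_sub_cancel_left]
  · refine (abs_abs_sub_abs_le _ _).trans ?_
    rwa [add_sub_right_comm, add_sub_cancel_left]

theorem abs_blk_sub_le {j : ℕ} {x a : Fin 2 → ℤ} (h : ∀ i, |x i - a i| ≤ 2 ^ j) :
    blk j x - blk j a ∈ cube 1 := by
  rw [mem_cube]
  intro i
  have hpos : (0 : ℤ) < 2 ^ j := by positivity
  have h1 := abs_le.1 (h i)
  have h2 := Int.ediv_mul_le (a i) hpos.ne'
  have h3 := Int.lt_ediv_add_one_mul_self (a i) hpos
  have h4 : x i / 2 ^ j < a i / 2 ^ j + 2 := by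
    refine Int.ediv_lt_of_lt_mul hpos ?_
    linarith
  have h5 : a i / 2 ^ j - 1 ≤ x i / 2 ^ j := by
    refine Int.le_ediv_of_mul_le hpos ?_
    linarith
  simp only [blk, Pi.sub_apply, abs_le, Nat.cast_one]
  omega

theorem abs_sub_lt_of_blk_eq {j : ℕ} {x a : Fin 2 → ℤ} (h : blk j x = blk j a) (i : Fin 2) :
    |x i - a i| < 2 ^ j := by
  have hpos : (0 : ℤ) < 2 ^ j := by positivity
  have h0 : x i / 2 ^ j = a i / 2 ^ j := congrFun h i
  have h2 := Int.ediv_mul_le (a i) hpos.ne'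
  have h3 := Int.lt_ediv_add_one_mul_self (a i) hpos
  have h4 := Int.ediv_mul_le (x i) hpos.ne'
  have h5 := Int.lt_ediv_add_one_mul_self (x i) hpos
  rw [h0] at h4 h5
  rw [abs_lt]
  constructor <;> linarith

theorem card_le_nine {s : Finset (Fin 2 → ℤ)} {c : Fin 2 → ℤ} (h : ∀ z ∈ s, z - c ∈ cube 1) :
    s.card ≤ 9 := by
  have : s.card ≤ (cube 1).card :=
    Finset.card_le_card_of_injOn (fun z => z - c) h fun x _ y _ hxy => by simpa using hxy
  simpa [card_cube] using this

theorem sub_mem_cube_comm {ρ : ℕ} {x y : Fin 2 → ℤ} : x - y ∈ cube ρ ↔ y - x ∈ cube ρ := by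
  simp only [mem_cube, Pi.sub_apply, abs_sub_comm]

theorem card_mixed_mul_le_of_spread {j n : ℕ} {w : ℕ → Fin 2 × Bool}
    (hspread : ∀ a ∈ rng w n, ∃ x ∈ rng w n, 2 ^ j < supDist x a) :
    (mixed j (rng w n)).card * 2 ^ j ≤ (badPoints (2 ^ (j + 1)) (rng w n)).card * 9 := by
  classical
  refine Finset.card_mul_le_card_mul (fun z p => blk j p - z ∈ cube 1) ?_ ?_
  · intro z hz
    obtain ⟨⟨a, ha, rfl⟩, y, hy, hyA⟩ := mem_mixed.1 hz
    obtain ⟨x, hx, hxa⟩ := hspread a ha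
    obtain ⟨p, hp, hpa⟩ := mem_rng.1 ha
    obtain ⟨q, hq, hqx⟩ := mem_rng.1 hx
    have hivt : ∀ v : ℕ, v ∈ Finset.Icc 1 (2 ^ j) → ∃ b ∈ rng w n, supDist b a = v := by
      intro v hv
      rw [Finset.mem_Icc] at hv
      have hv2 : (v : ℤ) ≤ 2 ^ j := by exact_mod_cast hv.2
      obtain ⟨k, hk, hkv⟩ := eq_of_unit_steps (f := fun k => supDist (pos w k) a) (v := v)
        (abs_supDist_step w a) hp hq (by simp [hpa, supDist]; omega) (by simp [hqx]; linarith)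
      exact ⟨pos w k, mem_rng.2 ⟨k, hk, rfl⟩, hkv⟩
    choose! b hb hbv using hivt
    have hcard : (Finset.Icc 1 (2 ^ j)).card = 2 ^ j := by simp
    rw [← hcard]
    refine Finset.card_le_card_of_injOn b (fun v hv => ?_) fun v hv v' hv' h => ?_
    · have hvle : supDist (b v) a ≤ 2 ^ j := by
        rw [hbv v hv]
        exact_mod_cast (Finset.mem_Icc.1 hv).2
      rw [supDist_le_iff] at hvle
      simp only [Finset.bipartiteAbove, Finset.coe_filter, Set.mem_ofPred_eq, mem_badPoints]
      refine ⟨⟨hb v hv, y - b v, mem_cube.2 fun i => ?_, by simpa using hyA⟩,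
        abs_blk_sub_le hvle⟩
      have h1 := abs_le.1 (hvle i)
      have h2 := abs_lt.1 (abs_sub_lt_of_blk_eq hy i)
      simp only [Pi.sub_apply, abs_le, pow_succ]
      push_cast
      constructor <;> linarith
    · have h1 := hbv v hv
      have h2 := hbv v' hv'
      rw [h, h2] at h1
      exact_mod_cast h1.symm
  · intro p _
    refine card_le_nine (c := blk j p) fun z hz => ?_
    exact sub_mem_cube_comm.1 (Finset.mem_filter.1 hz).2

/-- The number of dyadic squares met but not filled by the range is controlled by the number of
points of the range close to its complement. -/
theorem card_mixed_mul_le (j n : ℕ) (w : ℕ → Fin 2 × Bool) :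
    (mixed j (rng w n)).card * 2 ^ j ≤
      9 * 2 ^ j + 9 * (badPoints (2 ^ (j + 1)) (rng w n)).card := by
  by_cases h : ∀ a ∈ rng w n, ∃ x ∈ rng w n, 2 ^ j < supDist x a
  · have := card_mixed_mul_le_of_spread h
    omega
  · push Not at h
    obtain ⟨a, -, ha⟩ := h
    have : (mixed j (rng w n)).card ≤ 9 := by
      refine card_le_nine (c := blk j a) fun z hz => ?_
      obtain ⟨⟨x, hx, rfl⟩, -⟩ := mem_mixed.1 hz
      exact abs_blk_sub_le (supDist_le_iff.1 (ha x hx))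
    have h2 : (mixed j (rng w n)).card * 2 ^ j ≤ 9 * 2 ^ j := Nat.mul_le_mul_right _ this
    omega

section entropy

variable {α : Type*} [DecidableEq α] {n : ℕ}

/-- The number of paths on which `X` takes the value `a`. -/
def fib (X : (Fin n → Fin 2 × Bool) → α) (a : α) : ℕ :=
  (Finset.univ.filter fun ω => X ω = a).card

theorem fib_pos (X : (Fin n → Fin 2 × Bool) → α) (ω : Fin n → Fin 2 × Bool) :
    0 < fib X (X ω) :=
  Finset.card_pos.2 ⟨ω, by simp⟩

theorem prW_eq (X : (Fin n → Fin 2 × Bool) → α) (a : α) :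
    prW 2 n {ω | X ω = a} = fib X a / 4 ^ n := by
  have h : {ω | X ω = a} = ((Finset.univ.filter fun ω => X ω = a : Finset _) : Set _) := by
    ext
    simp
  rw [prW, h, Set.ncard_coe_finset, fib]
  norm_num

theorem entW_eq (X : (Fin n → Fin 2 × Bool) → α) :
    entW 2 n X = -(∑ ω, logb 2 (fib X (X ω) / 4 ^ n)) / 4 ^ n := by
  simp only [entW, prW_eq]
  rw [tsum_eq_sum (s := Finset.univ.image X)]
  · rw [Finset.sum_comp (fun a => logb 2 ((fib X a : ℝ) / 4 ^ n)) X, Finset.sum_neg_distrib,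
      neg_div, Finset.sum_div]
    congr 1
    refine Finset.sum_congr rfl fun a _ => ?_
    rw [nsmul_eq_mul, fib]
    ring
  · intro a ha
    have : fib X a = 0 := by
      rw [fib, Finset.card_eq_zero, Finset.filter_eq_empty_iff]
      exact fun ω _ h => ha (Finset.mem_image.2 ⟨ω, Finset.mem_univ _, h⟩)
    simp [this]

theorem sum_inv_fib (X : (Fin n → Fin 2 × Bool) → α) (W : α → ℝ) :
    ∑ ω, W (X ω) / fib X (X ω) = ∑ a ∈ Finset.univ.image X, W a := by
  rw [Finset.sum_comp (fun a => W a / (fib X a : ℝ)) X]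
  refine Finset.sum_congr rfl fun a ha => ?_
  obtain ⟨ω, -, rfl⟩ := Finset.mem_image.1 ha
  have := fib_pos X ω
  rw [nsmul_eq_mul, ← fib]
  field_simp

/-- Gibbs' inequality: the entropy is at most the expected length of a code. -/
theorem entW_le_of_sum_le_one (X : (Fin n → Fin 2 × Bool) → α) (W : α → ℝ) (hW : ∀ a, 0 < W a)
    (hsum : ∑ a ∈ Finset.univ.image X, W a ≤ 1) :
    entW 2 n X ≤ (∑ ω, -logb 2 (W (X ω))) / 4 ^ n := by
  rw [entW_eq, ← Finset.sum_neg_distrib]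
  gcongr ?_ / _
  rw [← sub_nonpos, ← Finset.sum_sub_distrib]
  have h4 : (0 : ℝ) < 4 ^ n := by positivity
  have hterm : ∀ ω, -logb 2 (fib X (X ω) / 4 ^ n) - -logb 2 (W (X ω)) ≤
      (4 ^ n * (W (X ω) / fib X (X ω)) - 1) / Real.log 2 := by
    intro ω
    have hf : (0 : ℝ) < fib X (X ω) := by exact_mod_cast fib_pos X ω
    have hW' := hW (X ω)
    rw [← Real.log_div_log, ← Real.log_div_log, neg_sub_neg, ← sub_div,
      ← Real.log_div hW'.ne' (by positivity)]
    have := Real.log_le_sub_one_of_pos (show 0 < W (X ω) / (fib X (X ω) / 4 ^ n) by positivity)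
    refine div_le_div_of_nonneg_right (this.trans (le_of_eq ?_)) (Real.log_nonneg (by norm_num))
    field_simp
  refine (Finset.sum_le_sum fun ω _ => hterm ω).trans ?_
  rw [← Finset.sum_div, Finset.sum_sub_distrib, ← Finset.mul_sum, sum_inv_fib]
  refine div_nonpos_of_nonpos_of_nonneg ?_ (Real.log_nonneg (by norm_num))
  simp only [Finset.sum_const, Finset.card_univ, card_paths, nsmul_eq_mul]
  push_cast
  nlinarith

end entropy

section code

theorem sum_prod_inter_le_one {ι X : Type*} [Fintype ι] [DecidableEq ι] [DecidableEq X]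
    (S : ι → Finset X) (f : ι → Finset X → ℝ) (hf0 : ∀ i A, 0 ≤ f i A)
    (hf : ∀ i A, f i (A ∩ S i) = f i A) (h : ∀ i, ∑ B ∈ (S i).powerset, f i B ≤ 1) :
    ∑ A ∈ (Finset.univ.biUnion S).powerset, ∏ i, f i A ≤ 1 := by
  have hprod : ∏ i, ∑ B ∈ (S i).powerset, f i B ≤ 1 :=
    Finset.prod_le_one (fun i _ => Finset.sum_nonneg fun B _ => hf0 i B) fun i _ => h i
  rw [Finset.prod_univ_sum] at hprod
  refine le_trans ?_ hprod
  set g : Finset X → ι → Finset X := fun A i => A ∩ S i with hg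
  have hinj : Set.InjOn g ((Finset.univ.biUnion S).powerset : Set (Finset X)) := by
    have aux : ∀ A ∈ (Finset.univ.biUnion S).powerset, A = Finset.univ.biUnion (g A) := by
      intro A hA
      rw [hg, ← Finset.inter_biUnion, Finset.inter_eq_left.2 (Finset.mem_powerset.1 hA)]
    intro A hA B hB hAB
    rw [aux A hA, aux B hB, hAB]
  calc ∑ A ∈ (Finset.univ.biUnion S).powerset, ∏ i, f i A
      = ∑ p ∈ (Finset.univ.biUnion S).powerset.image g, ∏ i, f i (p i) := by
        rw [Finset.sum_image hinj]
        refine Finset.sum_congr rfl fun A _ => Finset.prod_congr rfl fun i _ => (hf i A).symm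
    _ ≤ _ := by
        refine Finset.sum_le_sum_of_subset_of_nonneg (fun p hp => ?_)
          fun p _ _ => Finset.prod_nonneg fun i _ => hf0 i _
        obtain ⟨A, -, rfl⟩ := Finset.mem_image.1 hp
        exact Fintype.mem_piFinset.2 fun i => Finset.mem_powerset.2 Finset.inter_subset_right

/-- The four dyadic subsquares of a dyadic square. -/
def child (z : Fin 2 → ℤ) (ε : Fin 2 → Bool) : Fin 2 → ℤ :=
  fun i => 2 * z i + if ε i then 1 else 0

theorem child_injective (z : Fin 2 → ℤ) : Function.Injective (child z) := by
  intro ε ε' h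
  funext i
  have := congrFun h i
  simp only [child] at this
  cases h1 : ε i <;> cases h2 : ε' i <;> simp [h1, h2] at this ⊢

theorem blk_zero (x : Fin 2 → ℤ) : blk 0 x = x := by
  funext i
  simp [blk]

theorem blk_succ_eq_iff {j : ℕ} {x z : Fin 2 → ℤ} :
    blk (j + 1) x = z ↔ ∃ ε, blk j x = child z ε := by
  have hdiv : ∀ i, blk (j + 1) x i = blk j x i / 2 := fun i => by
    simp only [blk, pow_succ]
    rw [Int.ediv_ediv_of_nonneg (by positivity)]
  constructor
  · rintro rfl
    refine ⟨fun i => decide (blk j x i % 2 = 1), ?_⟩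
    funext i
    simp only [child, hdiv, decide_eq_true_eq]
    split_ifs <;> omega
  · rintro ⟨ε, h⟩
    funext i
    rw [hdiv, h]
    simp only [child]
    split_ifs <;> omega

/-- The dyadic square of side `2 ^ k` with index `z`. -/
def cell : ℕ → (Fin 2 → ℤ) → Finset (Fin 2 → ℤ)
  | 0, z => {z}
  | k + 1, z => Finset.univ.biUnion fun ε => cell k (child z ε)

theorem mem_cell {k : ℕ} {z x : Fin 2 → ℤ} : x ∈ cell k z ↔ blk k x = z := by
  induction k generalizing z with
  | zero => simp [cell, blk_zero]
  | succ k ih => simp [cell, ih, blk_succ_eq_iff]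

theorem child_cell_subset (k : ℕ) (z : Fin 2 → ℤ) (ε : Fin 2 → Bool) :
    cell k (child z ε) ⊆ cell (k + 1) z := fun x hx => by
  rw [mem_cell] at hx ⊢
  exact blk_succ_eq_iff.2 ⟨ε, hx⟩

/-- The square is disjoint from `A` or contained in `A`. -/
def PureCell (k : ℕ) (z : Fin 2 → ℤ) (A : Finset (Fin 2 → ℤ)) : Prop :=
  A ∩ cell k z = ∅ ∨ A ∩ cell k z = cell k z

open Classical in
/-- The weight of a quadtree description of `A` inside a dyadic square. -/
noncomputable def weight : ℕ → (Fin 2 → ℤ) → Finset (Fin 2 → ℤ) → ℝ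
  | 0, _, _ => 1 / 4
  | k + 1, z, A => if PureCell (k + 1) z A then 1 / 4 else 1 / 2 * ∏ ε, weight k (child z ε) A

open Classical in
/-- The number of inner nodes of a quadtree description of `A` inside a dyadic square. -/
noncomputable def nodes : ℕ → (Fin 2 → ℤ) → Finset (Fin 2 → ℤ) → ℕ
  | 0, _, _ => 0
  | k + 1, z, A => if PureCell (k + 1) z A then 0 else 1 + ∑ ε, nodes k (child z ε) A

theorem weight_pos (k : ℕ) (z : Fin 2 → ℤ) (A : Finset (Fin 2 → ℤ)) : 0 < weight k z A := by
  induction k generalizing z with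
  | zero => norm_num [weight]
  | succ k ih =>
    rw [weight]
    split_ifs
    · norm_num
    · exact mul_pos (by norm_num) (Finset.prod_pos fun ε _ => ih _)

theorem weight_congr {k : ℕ} {z : Fin 2 → ℤ} {A B : Finset (Fin 2 → ℤ)}
    (h : A ∩ cell k z = B ∩ cell k z) : weight k z A = weight k z B := by
  induction k generalizing z with
  | zero => rfl
  | succ k ih =>
    have h1 : PureCell (k + 1) z A ↔ PureCell (k + 1) z B := by rw [PureCell, PureCell, h]
    have h2 : ∀ ε, weight k (child z ε) A = weight k (child z ε) B := fun ε => by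
      refine ih ?_
      rw [← Finset.inter_eq_right.2 (child_cell_subset k z ε), ← Finset.inter_assoc, h,
        Finset.inter_assoc]
    by_cases hA : PureCell (k + 1) z A
    · rw [weight, weight, if_pos hA, if_pos (h1.1 hA)]
    · rw [weight, weight, if_neg hA, if_neg fun hB => hA (h1.2 hB)]
      simp only [h2]

theorem weight_inter (k : ℕ) (z : Fin 2 → ℤ) (A : Finset (Fin 2 → ℤ)) :
    weight k z (A ∩ cell k z) = weight k z A :=
  weight_congr (by rw [Finset.inter_assoc, Finset.inter_self])

/-- Kraft's inequality for the quadtree code. -/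
theorem sum_weight_le_one (k : ℕ) (z : Fin 2 → ℤ) :
    ∑ A ∈ (cell k z).powerset, weight k z A ≤ 1 := by
  classical
  induction k generalizing z with
  | zero =>
    simp only [weight, cell, Finset.sum_const, Finset.card_powerset, Finset.card_singleton]
    norm_num
  | succ k ih =>
    have h1 := sum_prod_inter_le_one (fun ε => cell k (child z ε))
      (fun ε => weight k (child z ε)) (fun ε A => (weight_pos _ _ _).le)
      (fun ε A => weight_inter _ _ _) fun ε => ih _
    change ∑ A ∈ (cell (k + 1) z).powerset, _ ≤ _ at h1
    have h2 : ∀ A ∈ (cell (k + 1) z).powerset, weight (k + 1) z A ≤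
        ((if A = ∅ then 1 / 4 else 0) + if A = cell (k + 1) z then 1 / 4 else 0) +
          1 / 2 * ∏ ε, weight k (child z ε) A := by
      intro A hA
      have h3 : A ∩ cell (k + 1) z = A := Finset.inter_eq_left.2 (Finset.mem_powerset.1 hA)
      have h4 : 0 ≤ 1 / 2 * ∏ ε, weight k (child z ε) A :=
        mul_nonneg (by norm_num) (Finset.prod_nonneg fun ε _ => (weight_pos _ _ _).le)
      rw [weight, PureCell, h3]
      split_ifs <;> first | linarith | tauto
    refine (Finset.sum_le_sum h2).trans ?_
    rw [Finset.sum_add_distrib, Finset.sum_add_distrib, ← Finset.mul_sum, Finset.sum_ite_eq',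
      Finset.sum_ite_eq']
    simp only [Finset.mem_powerset, Finset.empty_subset, Finset.Subset.refl, if_true]
    linarith

theorem neg_logb_weight_le (k : ℕ) (z : Fin 2 → ℤ) (A : Finset (Fin 2 → ℤ)) :
    -logb 2 (weight k z A) ≤ 2 + 9 * nodes k z A := by
  have h4 : -logb 2 (1 / 4) = 2 := by
    rw [show (1 / 4 : ℝ) = 2 ^ (-2 : ℝ) by rw [Real.rpow_neg (by norm_num)]; norm_num,
      Real.logb_rpow (by norm_num) (by norm_num)]
    norm_num
  induction k generalizing z with
  | zero =>
    rw [weight, nodes, h4]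
    norm_num
  | succ k ih =>
    rw [weight, nodes]
    split_ifs
    · rw [h4]
      norm_num
    · rw [Real.logb_mul (by norm_num)
        (Finset.prod_pos fun ε _ => weight_pos k (child z ε) A).ne',
        Real.logb_prod _ _ fun ε _ => (weight_pos k (child z ε) A).ne', neg_add,
        ← Finset.sum_neg_distrib]
      have h2 : -logb 2 (1 / 2) = 1 := by
        rw [one_div, Real.logb_inv, Real.logb_self_eq_one (by norm_num), neg_neg]
      have h5 : ∑ ε, -logb 2 (weight k (child z ε) A) ≤
          ∑ ε : Fin 2 → Bool, (2 + 9 * (nodes k (child z ε) A : ℝ)) :=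
        Finset.sum_le_sum fun ε _ => ih _
      rw [Finset.sum_add_distrib, ← Finset.mul_sum] at h5
      simp only [Finset.sum_const, Finset.card_univ, Fintype.card_fun, Fintype.card_bool,
        Fintype.card_fin, nsmul_eq_mul] at h5
      push_cast at h5 ⊢
      linarith

theorem sum_card_filter_le {ι X Y : Type*} [Fintype ι] [DecidableEq Y] (s : Finset X)
    (F : X → Y) {g : ι → Y} (hg : Function.Injective g) (P : X → Prop) [DecidablePred P]
    (h : ∀ i, ∀ c, F c = g i → P c) :
    ∑ i, (s.filter fun c => F c = g i).card ≤ (s.filter P).card := by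
  classical
  rw [← Finset.card_biUnion]
  · refine Finset.card_le_card fun c hc => ?_
    simp only [Finset.mem_biUnion, Finset.mem_filter, Finset.mem_univ, true_and] at hc ⊢
    obtain ⟨i, hc, hi⟩ := hc
    exact ⟨hc, h i c hi⟩
  · intro i _ j _ hij
    refine Finset.disjoint_left.2 ?_
    intro c hc hc'
    exact hij (hg ((Finset.mem_filter.1 hc).2.symm.trans (Finset.mem_filter.1 hc').2))

theorem mem_mixed_of_not_pure {k : ℕ} {z : Fin 2 → ℤ} {A : Finset (Fin 2 → ℤ)}
    (h : ¬ PureCell k z A) : z ∈ mixed k A := by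
  rw [PureCell, not_or, ← ne_eq, ← Finset.nonempty_iff_ne_empty, Finset.inter_eq_right] at h
  obtain ⟨⟨a, ha⟩, h2⟩ := h
  rw [Finset.mem_inter, mem_cell] at ha
  obtain ⟨y, hy, hyA⟩ := Finset.not_subset.1 h2
  exact mem_mixed.2 ⟨⟨a, ha⟩, y, mem_cell.1 hy, hyA⟩

theorem nodes_le (k : ℕ) (z : Fin 2 → ℤ) (A : Finset (Fin 2 → ℤ)) :
    nodes k z A ≤
      ∑ j ∈ Finset.range (k + 1), ((mixed j A).filter fun c => blk (k - j) c = z).card := by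
  induction k generalizing z with
  | zero => simp [nodes]
  | succ k ih =>
    rw [nodes]
    split_ifs with h
    · simp
    · rw [Finset.sum_range_succ, add_comm]
      refine add_le_add ?_ ?_
      · refine (Finset.sum_le_sum fun ε _ => ih _).trans ?_
        rw [Finset.sum_comm]
        refine Finset.sum_le_sum fun j hj => ?_
        rw [Finset.mem_range] at hj
        refine sum_card_filter_le _ _ (child_injective z) _ fun ε c hc => ?_
        rw [show k + 1 - j = k - j + 1 by omega]
        exact blk_succ_eq_iff.2 ⟨ε, hc⟩
      · rw [Nat.sub_self]
        refine Finset.card_pos.2 ⟨z, ?_⟩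
        rw [Finset.mem_filter]
        exact ⟨mem_mixed_of_not_pure h, blk_zero z⟩

/-- The indices of the four dyadic squares with corners at the origin. -/
def root (ε : Fin 2 → Bool) : Fin 2 → ℤ := fun i => if ε i then 0 else -1

theorem root_injective : Function.Injective root := by
  intro ε ε' h
  funext i
  have := congrFun h i
  simp only [root] at this
  cases h1 : ε i <;> cases h2 : ε' i <;> simp [h1, h2] at this ⊢

/-- The weight of a quadtree description of a set. -/
noncomputable def codeWeight (K : ℕ) (A : Finset (Fin 2 → ℤ)) : ℝ := ∏ ε, weight K (root ε) A

theorem codeWeight_pos (K : ℕ) (A : Finset (Fin 2 → ℤ)) : 0 < codeWeight K A :=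
  Finset.prod_pos fun _ _ => weight_pos _ _ _

theorem sum_codeWeight_le_one (K : ℕ) (F : Finset (Finset (Fin 2 → ℤ)))
    (hF : ∀ A ∈ F, ∀ x ∈ A, ∀ i, |x i| < 2 ^ K) : ∑ A ∈ F, codeWeight K A ≤ 1 := by
  refine le_trans (Finset.sum_le_sum_of_subset_of_nonneg (fun A hA => ?_)
    fun A _ _ => (codeWeight_pos K A).le) (sum_prod_inter_le_one (fun ε => cell K (root ε))
      (fun ε => weight K (root ε)) (fun ε A => (weight_pos _ _ _).le)
      (fun ε A => weight_inter _ _ _) fun ε => sum_weight_le_one _ _)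
  rw [Finset.mem_powerset]
  intro x hx
  rw [Finset.mem_biUnion]
  refine ⟨fun i => decide (0 ≤ x i), Finset.mem_univ _, ?_⟩
  rw [mem_cell]
  funext i
  have h1 := abs_lt.1 (hF A hA x hx i)
  simp only [blk, root, decide_eq_true_eq]
  split_ifs with h
  · exact Int.ediv_eq_zero_of_lt h h1.2
  · refine le_antisymm (Int.le_of_lt_add_one (Int.ediv_lt_of_lt_mul (by positivity) ?_))
      (Int.le_ediv_of_mul_le (by positivity) ?_)
    · simpa using h
    · linarith

theorem neg_logb_codeWeight_le (K : ℕ) (A : Finset (Fin 2 → ℤ)) :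
    -logb 2 (codeWeight K A) ≤ 8 + 9 * ∑ j ∈ Finset.range (K + 1), ((mixed j A).card : ℝ) := by
  have h1 : ∑ ε, nodes K (root ε) A ≤ ∑ j ∈ Finset.range (K + 1), (mixed j A).card := by
    refine (Finset.sum_le_sum fun ε _ => nodes_le K (root ε) A).trans ?_
    rw [Finset.sum_comm]
    refine Finset.sum_le_sum fun j _ => ?_
    have := sum_card_filter_le (mixed j A) (blk (K - j)) root_injective (fun _ => True)
      fun _ _ _ => trivial
    rwa [Finset.filter_true] at this
  rw [codeWeight, Real.logb_prod _ _ fun ε _ => (weight_pos K (root ε) A).ne',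
    ← Finset.sum_neg_distrib]
  refine (Finset.sum_le_sum fun ε _ => neg_logb_weight_le K (root ε) A).trans ?_
  rw [Finset.sum_add_distrib, ← Finset.mul_sum]
  have h2 : ∑ ε, (nodes K (root ε) A : ℝ) ≤
      ∑ j ∈ Finset.range (K + 1), ((mixed j A).card : ℝ) := by exact_mod_cast h1
  simp only [Finset.sum_const, Finset.card_univ, Fintype.card_fun, Fintype.card_bool,
    Fintype.card_fin, nsmul_eq_mul]
  push_cast
  linarith

end code

theorem walk_zero_eq {n k : ℕ} (ω : Fin n → Fin 2 × Bool) (hk : k ≤ n) :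
    walk 0 ω k = pos (ext ω) k := by
  have h1 := Fin.sum_univ_eq_sum_range (fun i => if i < k then step (ext ω i) else 0) n
  simp only [ext_apply] at h1
  rw [walk, zero_add, Finset.sum_filter, h1, ← Finset.sum_filter, pos]
  congr 1
  ext i
  simp only [Finset.mem_filter, Finset.mem_range]
  omega

theorem rangeW_eq {n : ℕ} (ω : Fin n → Fin 2 × Bool) : rangeW 0 ω = rng (ext ω) n := by
  unfold rangeW rng
  refine Finset.image_congr fun k hk => ?_
  simp only [Finset.coe_range, Set.mem_Iio] at hk
  exact walk_zero_eq ω (by omega)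

theorem abs_pos_le (w : ℕ → Fin 2 × Bool) (k : ℕ) (i : Fin 2) : |pos w k i| ≤ k := by
  induction k with
  | zero => simp [pos_zero]
  | succ k ih =>
    rw [pos_succ, Pi.add_apply]
    have := abs_step_le (w k) i
    push_cast
    linarith [abs_add_le (pos w k i) (step (w k) i)]

theorem entW_rangeW_le (n : ℕ) :
    entW 2 n (rangeW (0 : Fin 2 → ℤ)) ≤ 8 + 9 * ∑ j ∈ Finset.range (Nat.log 2 n + 2),
      ex n (fun w => ((mixed j (rng w n)).card : ℝ)) := by
  set K := Nat.log 2 n + 1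
  have hK : n < 2 ^ K := Nat.lt_pow_succ_log_self (by norm_num) n
  have h1 := entW_le_of_sum_le_one (n := n) (rangeW 0) (codeWeight K) (codeWeight_pos K)
    (sum_codeWeight_le_one K _ fun A hA x hx i => by
      obtain ⟨ω, -, rfl⟩ := Finset.mem_image.1 hA
      rw [rangeW_eq, mem_rng] at hx
      obtain ⟨k, hk, rfl⟩ := hx
      have h2 := abs_pos_le (ext ω) k i
      have h3 : (k : ℤ) < 2 ^ K := by exact_mod_cast hk.trans_lt hK
      exact h2.trans_lt h3)
  refine h1.trans ?_
  simp only [rangeW_eq]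
  change ex n (fun w => -logb 2 (codeWeight K (rng w n))) ≤ _
  refine (ex_mono fun w => neg_logb_codeWeight_le K (rng w n)).trans (le_of_eq ?_)
  rw [ex_add, ex_const, ex_mul_left, ex_sum]

theorem ex_card_mixed_le (j n : ℕ) {L : ℝ} (hL : 0 < L) :
    ex n (fun w => ((mixed j (rng w n)).card : ℝ)) ≤ 9 + 18 * Nat.sqrt n * (1 / 2) ^ j +
      1152 * (n + 1) / lg n ^ 2 * ((covBound (2 ^ (j + 1)) L + 1) / 2 ^ j) := by
  have h : ∀ w, ((mixed j (rng w n)).card : ℝ) ≤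
      9 + 9 / 2 ^ j * ((badPoints (2 ^ (j + 1)) (rng w n)).card : ℝ) := by
    intro w
    have h1 : ((mixed j (rng w n)).card : ℝ) * 2 ^ j ≤
        9 * 2 ^ j + 9 * (badPoints (2 ^ (j + 1)) (rng w n)).card := by
      exact_mod_cast card_mixed_mul_le j n w
    have h2 : (0 : ℝ) < 2 ^ j := by positivity
    calc ((mixed j (rng w n)).card : ℝ) ≤
        (9 * 2 ^ j + 9 * (badPoints (2 ^ (j + 1)) (rng w n)).card) / 2 ^ j := by
          rwa [le_div_iff₀ h2]
      _ = _ := by field_simp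
  refine (ex_mono h).trans ?_
  rw [ex_add, ex_const, ex_mul_left]
  have h3 := ex_card_badPoints_le (2 ^ (j + 1)) n hL
  calc 9 + 9 / 2 ^ j * ex n (fun w => ((badPoints (2 ^ (j + 1)) (rng w n)).card : ℝ))
      ≤ 9 + 9 / 2 ^ j * (2 * Nat.sqrt n +
          128 * (covBound (2 ^ (j + 1)) L + 1) * (n + 1) / lg n ^ 2) := by gcongr
    _ = _ := by
      rw [one_div, inv_pow]
      ring

theorem lg_scale_le (j : ℕ) : lg (8 * (2 ^ (j + 1) + 1) ^ 2 + 1) ≤ 8 * (j + 1) := by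
  have h1 : 8 * (2 ^ (j + 1) + 1) ^ 2 + 1 + 2 ≤ 2 ^ (2 * j + 8) := by
    have h : 1 ≤ 2 ^ j := Nat.one_le_two_pow
    have e1 : 2 ^ (j + 1) = 2 * 2 ^ j := by ring
    have e2 : 2 ^ (2 * j + 8) = 256 * (2 ^ j) ^ 2 := by ring
    rw [e1, e2]
    nlinarith
  have h2 : lg (8 * (2 ^ (j + 1) + 1) ^ 2 + 1) ≤ Real.log (2 ^ (2 * j + 8)) := by
    refine Real.log_le_log (by positivity) ?_
    exact_mod_cast h1
  rw [Real.log_pow] at h2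
  push_cast at h2
  have h3 := Real.log_two_lt_d9
  have h4 : (2 * (j : ℝ) + 8) * Real.log 2 ≤ (2 * j + 8) * 1 := by
    gcongr
    linarith
  have : (0 : ℝ) ≤ j := by positivity
  linarith

theorem covBound_scale_le (j : ℕ) :
    (covBound (2 ^ (j + 1)) ((7 / 4) ^ j) + 1) / 2 ^ j ≤
      (7 / 8) ^ j + 384 * 131072 ^ 3 * ((j + 1) ^ 6 * (32 / 49) ^ j) + (1 / 2) ^ j := by
  have h1 := lg_scale_le j
  have h0 := lg_pos (8 * (2 ^ (j + 1) + 1) ^ 2 + 1)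
  have h2 : ((2 : ℝ) * (2 ^ (j + 1) : ℕ) + 1) ^ 2 ≤ 64 * (2 ^ j) ^ 2 := by
    have : (1 : ℝ) ≤ 2 ^ j := one_le_pow₀ (by norm_num)
    push_cast
    rw [pow_succ (2 : ℝ) j]
    nlinarith
  have h3 : covBound (2 ^ (j + 1)) ((7 / 4) ^ j) ≤ (7 / 4) ^ j +
      64 * (2 ^ j) ^ 2 * (6 * (2048 * (8 * (j + 1)) ^ 2) ^ 3) / ((7 / 4) ^ j) ^ 2 := by
    unfold covBound
    gcongr
  have e : ∀ x : ℝ, x / 2 ^ j = x * (1 / 2) ^ j := fun x => by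
    rw [one_div, inv_pow, div_eq_mul_inv]
  have e1 : (7 / 8 : ℝ) ^ j = (7 / 4) ^ j * (1 / 2) ^ j := by
    rw [← mul_pow]
    norm_num
  have e2 : (32 / 49 : ℝ) ^ j = (2 ^ j) ^ 2 / ((7 / 4) ^ j) ^ 2 * (1 / 2) ^ j := by
    rw [← pow_mul, ← pow_mul, mul_comm j 2, pow_mul, pow_mul, ← div_pow, ← mul_pow]
    norm_num
  calc (covBound (2 ^ (j + 1)) ((7 / 4) ^ j) + 1) / 2 ^ j
      ≤ ((7 / 4) ^ j + 64 * (2 ^ j) ^ 2 * (6 * (2048 * (8 * (j + 1)) ^ 2) ^ 3) /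
          ((7 / 4) ^ j) ^ 2 + 1) / 2 ^ j := by gcongr
    _ = _ := by
        rw [e, e1, e2]
        ring

theorem exists_sum_scale_le : ∃ C : ℝ, 0 ≤ C ∧ ∀ K : ℕ,
    ∑ j ∈ Finset.range K, (covBound (2 ^ (j + 1)) ((7 / 4) ^ j) + 1) / 2 ^ j ≤ C := by
  have hs : Summable fun j : ℕ => (7 / 8 : ℝ) ^ j +
      384 * 131072 ^ 3 * (((j : ℝ) + 1) ^ 6 * (32 / 49) ^ j) + (1 / 2) ^ j := by
    refine ((summable_geometric_of_lt_one (by norm_num) (by norm_num)).add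
      (Summable.mul_left _ ?_)).add (summable_geometric_of_lt_one (by norm_num) (by norm_num))
    have h1 := summable_pow_mul_geometric_of_norm_lt_one (R := ℝ) 6
      (r := 32 / 49) (by norm_num)
    have h2 := ((summable_nat_add_iff 1).2 h1).mul_left (49 / 32)
    refine h2.congr fun j => ?_
    push_cast
    rw [pow_succ]
    ring
  exact ⟨_, tsum_nonneg fun j => by positivity, fun K =>
    (Finset.sum_le_sum fun j _ => covBound_scale_le j).trans
      (hs.sum_le_tsum _ fun j _ => by positivity)⟩

theorem exists_entW_le : ∃ C : ℝ, 0 < C ∧ ∀ n : ℕ, 2 ≤ n →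
    entW 2 n (rangeW (0 : Fin 2 → ℤ)) ≤ C * n / Real.log n ^ 2 := by
  obtain ⟨C, hC0, hC⟩ := exists_sum_scale_le
  refine ⟨818 * 16 + 20736 * C, by positivity, fun n hn => ?_⟩
  have hn' : (2 : ℝ) ≤ n := by exact_mod_cast hn
  have hlog : 0 < Real.log n := Real.log_pos (by linarith)
  have hloglg : Real.log n ≤ lg n := Real.log_le_log (by linarith) (by linarith)
  have hsq : (Nat.sqrt n : ℝ) ≤ √n := Real.nat_sqrt_le_real_sqrt
  have hs1 : (1 : ℝ) ≤ √n := Real.one_le_sqrt.2 (by linarith)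
  have hss : √(n : ℝ) * √n = n := Real.mul_self_sqrt (by positivity)
  have hK : ((Nat.log 2 n + 2 : ℕ) : ℝ) ≤ 6 * √n := by
    have h1 : ((2 : ℝ) ^ Nat.log 2 n) ≤ n := by
      exact_mod_cast Nat.pow_log_le_self 2 (by omega)
    have h2 := Real.log_le_log (by positivity) h1
    rw [Real.log_pow] at h2
    have h3 := Real.log_two_gt_d9
    have h4 : Real.log n ≤ 2 * √n := by
      have := Real.log_le_rpow_div (x := n) (by positivity) (ε := 1 / 2) (by norm_num)
      rw [← Real.sqrt_eq_rpow] at this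
      linarith
    push_cast
    have : (0 : ℝ) ≤ Nat.log 2 n := by positivity
    nlinarith
  have hlog2 : √n ≤ 16 * n / Real.log n ^ 2 := by
    have := Real.log_le_rpow_div (x := √n) (by positivity) (ε := 1 / 2) (by norm_num)
    rw [← Real.sqrt_eq_rpow, Real.log_sqrt (by positivity)] at this
    have h1 : Real.log n ≤ 4 * √(√n) := by linarith
    have h2 : √(√(n : ℝ)) * √(√n) = √n := Real.mul_self_sqrt (by positivity)
    rw [le_div_iff₀ (by positivity)]
    have h3 : Real.log n ^ 2 ≤ 16 * √n := by nlinarith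
    nlinarith
  have hsum : ∑ j ∈ Finset.range (Nat.log 2 n + 2),
      ex n (fun w => ((mixed j (rng w n)).card : ℝ)) ≤
      9 * (6 * √n) + 36 * √n + 1152 * (n + 1) / lg n ^ 2 * C := by
    refine (Finset.sum_le_sum fun j _ => ex_card_mixed_le j n
      (L := (7 / 4) ^ j) (by positivity)).trans ?_
    rw [Finset.sum_add_distrib, Finset.sum_add_distrib, ← Finset.mul_sum, ← Finset.mul_sum,
      Finset.sum_const, Finset.card_range, nsmul_eq_mul]
    have hgeo : ∑ j ∈ Finset.range (Nat.log 2 n + 2), (1 / 2 : ℝ) ^ j ≤ 2 := by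
      refine (Summable.sum_le_tsum _ (fun _ _ => by positivity) summable_geometric_two).trans ?_
      rw [tsum_geometric_two]
    have h1 : 18 * (Nat.sqrt n : ℝ) * ∑ j ∈ Finset.range (Nat.log 2 n + 2), (1 / 2 : ℝ) ^ j ≤
        18 * √n * 2 := by gcongr
    have h2 : 1152 * ((n : ℝ) + 1) / lg n ^ 2 * ∑ j ∈ Finset.range (Nat.log 2 n + 2),
        (covBound (2 ^ (j + 1)) ((7 / 4) ^ j) + 1) / 2 ^ j ≤
        1152 * (n + 1) / lg n ^ 2 * C := by
      gcongr
      exact hC _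
    linarith
  have hmain : 1152 * ((n : ℝ) + 1) / lg n ^ 2 * C ≤ 2304 * C * (n / Real.log n ^ 2) := by
    calc 1152 * ((n : ℝ) + 1) / lg n ^ 2 * C ≤ 1152 * (n + n) / Real.log n ^ 2 * C := by
          gcongr
          linarith
      _ = _ := by ring
  have e : (818 * 16 + 20736 * C) * n / Real.log n ^ 2 =
      818 * (16 * n / Real.log n ^ 2) + 9 * (2304 * C * (n / Real.log n ^ 2)) := by ring
  rw [e]
  have := entW_rangeW_le n
  linarith

/-- The first unit vector. -/
def e₁ : Fin 2 → ℤ := step (0, true)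

theorem e₁_ne_zero : e₁ ≠ 0 := fun h => by simpa [e₁, step] using congrFun h 0

/-- The walk avoids the origin and `v` at times `1, …, m`. -/
def Avoids (v : Fin 2 → ℤ) (w : ℕ → Fin 2 × Bool) (m : ℕ) : Prop :=
  ∀ k, 1 ≤ k → k ≤ m → pos w k ≠ 0 ∧ pos w k ≠ v

/-- The probability of avoiding the origin and `e₁` at times `1, …, m`. -/
noncomputable def avd (m : ℕ) : ℝ := ex m fun w => ind (Avoids e₁ w m)

theorem avd_nonneg (m : ℕ) : 0 ≤ avd m := ex_nonneg fun _ => ind_nonneg _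

theorem avoids_congr {v : Fin 2 → ℤ} {w w' : ℕ → Fin 2 × Bool} {m : ℕ}
    (h : ∀ i ∈ Set.Iio m, w i = w' i) : Avoids v w m ↔ Avoids v w' m :=
  forall_congr' fun k => imp_congr_right fun _ => forall_congr' fun hk => by
    rw [pos_congr h hk]

theorem avd_anti {s t : ℕ} (h : s ≤ t) : avd t ≤ avd s := by
  rw [avd, avd, ← ex_of_dependsOn h (fun w w' hw => ind_congr (avoids_congr hw))]
  exact ex_mono fun w => ind_mono fun hw k h1 h2 => hw k h1 (h2.trans h)

theorem ex_avoids_neg (m : ℕ) : ex m (fun w => ind (Avoids (-e₁) w m)) = avd m := by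
  rw [avd, ← ex_refl m fun w => ind (Avoids e₁ w m)]
  congr 1
  funext w
  refine ind_congr (forall_congr' fun k => imp_congr_right fun _ => forall_congr' fun hk => ?_)
  rw [pos_refl hk, ne_eq, ne_eq, ne_eq, ne_eq, neg_eq_zero, neg_eq_iff_eq_neg]

theorem one_le_sum_avd (n : ℕ) :
    1 ≤ ∑ s ∈ Finset.range (n + 1), (tp s 0 + tp s e₁) * avd (n - s) := by
  have : ∀ s ∈ Finset.range (n + 1), (tp s 0 + tp s e₁) * avd (n - s) =
      ex n (fun w => ind (pos w s = 0) * ind (Avoids e₁ (shift s w) (n - s))) +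
      ex n (fun w => ind (pos w s = e₁) * ind (Avoids (-e₁) (shift s w) (n - s))) := by
    intro s hs
    rw [Finset.mem_range] at hs
    rw [ex_mul_shift' (t := n - s) (by omega) (dependsOn_pos_eq le_rfl 0)
        (fun w => ind (Avoids e₁ w (n - s))),
      ex_mul_shift' (t := n - s) (by omega) (dependsOn_pos_eq le_rfl e₁)
        (fun w => ind (Avoids (-e₁) w (n - s))), ex_avoids_neg, add_mul]
    rfl
  rw [Finset.sum_congr rfl this]
  simp only [← ex_add]
  rw [← ex_sum]
  refine le_trans (le_of_eq (ex_const n 1).symm) (ex_mono fun w => ?_)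
  simp only [← ind_and]
  rw [← ind_of_true trivial]
  refine (le_sum_ind (Finset.range (n + 1)) (fun s => (pos w s = 0 ∧
      Avoids e₁ (shift s w) (n - s)) ∨ (pos w s = e₁ ∧ Avoids (-e₁) (shift s w) (n - s)))
      fun _ => ?_).trans (Finset.sum_le_sum fun s _ => ?_)
  · classical
    obtain ⟨s, hs, hmax⟩ := Finset.exists_max_image
      ((Finset.range (n + 1)).filter fun s => pos w s = 0 ∨ pos w s = e₁) id
      ⟨0, by simp [pos_zero]⟩
    simp only [Finset.mem_filter, Finset.mem_range, id] at hs hmax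
    have hk : ∀ k, 1 ≤ k → k ≤ n - s → pos w (s + k) ≠ 0 ∧ pos w (s + k) ≠ e₁ := by
      intro k hk1 hk2
      rw [← not_or]
      intro h
      have := hmax (s + k) ⟨by omega, h⟩
      omega
    refine ⟨s, Finset.mem_range.2 hs.1, ?_⟩
    rcases hs.2 with h | h
    · refine Or.inl ⟨h, fun k hk1 hk2 => ?_⟩
      have := hk k hk1 hk2
      rwa [pos_add, h, zero_add] at this
    · refine Or.inr ⟨h, fun k hk1 hk2 => ?_⟩
      have := hk k hk1 hk2
      rw [pos_add, h] at this
      refine ⟨fun h0 => this.2 (by rw [h0, add_zero]), fun h0 => this.1 (by rw [h0]; simp)⟩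
  · refine (ind_mono (Q := _ ∨ _) id).trans ?_
    by_cases h1 : pos w s = 0 ∧ Avoids e₁ (shift s w) (n - s)
    · rw [ind_of_true (Or.inl h1), ind_of_true h1]
      linarith [ind_nonneg (pos w s = e₁ ∧ Avoids (-e₁) (shift s w) (n - s))]
    · rw [ind_congr (or_iff_right h1)]
      linarith [ind_nonneg (pos w s = 0 ∧ Avoids e₁ (shift s w) (n - s))]

theorem le_avd (m : ℕ) : 1 / (48 * lg m) ≤ avd m := by
  rcases Nat.eq_zero_or_pos m with rfl | hm
  · have h1 : avd 0 = 1 := by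
      rw [avd, ← ex_const 0 1]
      congr 1
      funext w
      exact ind_of_true fun k h1 h2 => by omega
    rw [h1, div_le_one (by linarith [lg_pos 0])]
    linarith [half_lt_lg 0]
  have h := one_le_sum_avd (5 * m)
  have hm' : (1 : ℝ) ≤ m := by exact_mod_cast hm
  have hterm : ∀ s ∈ Finset.range (5 * m + 1), (tp s 0 + tp s e₁) * avd (5 * m - s) ≤
      (if s < 4 * m + 1 then (tp s 0 + tp s e₁) * avd m else 0) +
        if 4 * m < s then 1 / (2 * (m : ℝ)) else 0 := by
    intro s hs
    rw [Finset.mem_range] at hs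
    have h0 := tp_nonneg s 0
    have h1 := tp_nonneg s e₁
    by_cases hsm : s < 4 * m + 1
    · rw [if_pos hsm, if_neg (by omega), add_zero]
      exact mul_le_mul_of_nonneg_left (avd_anti (by omega)) (by linarith)
    · rw [if_neg hsm, if_pos (by omega), zero_add]
      have h2 := tp_le (s := s) (by omega) 0
      have h3 := tp_le (s := s) (by omega) e₁
      have h4 : (1 : ℝ) / s ≤ 1 / (4 * m) := by
        apply one_div_le_one_div_of_le (by positivity)
        have : 4 * m ≤ s := by omega
        exact_mod_cast this
      have h5 : avd (5 * m - s) ≤ 1 := ex_le_one fun _ => ind_le_one _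
      have h6 : (1 : ℝ) / (2 * m) = 1 / (4 * m) + 1 / (4 * m) := by
        field_simp
        norm_num
      calc (tp s 0 + tp s e₁) * avd (5 * m - s) ≤ (tp s 0 + tp s e₁) * 1 := by gcongr
        _ ≤ _ := by linarith
  have h7 := h.trans (Finset.sum_le_sum hterm)
  rw [Finset.sum_add_distrib, ← Finset.sum_filter, ← Finset.sum_filter, Finset.sum_const,
    nsmul_eq_mul] at h7
  have hf1 : (Finset.range (5 * m + 1)).filter (fun s => s < 4 * m + 1) =
      Finset.range (4 * m + 1) := by
    ext s
    simp only [Finset.mem_filter, Finset.mem_range]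
    omega
  have hf2 : (Finset.range (5 * m + 1)).filter (fun s => 4 * m < s) =
      Finset.Ioc (4 * m) (5 * m) := by
    ext s
    simp only [Finset.mem_filter, Finset.mem_range, Finset.mem_Ioc]
    omega
  rw [hf1, hf2, ← Finset.sum_mul, Finset.sum_add_distrib, Nat.card_Ioc] at h7
  change 1 ≤ (green (4 * m) 0 + green (4 * m) e₁) * avd m + _ at h7
  have hc : ((5 * m - 4 * m : ℕ) : ℝ) = m := by
    congr 1
    omega
  rw [hc] at h7
  have h8 : (m : ℝ) * (1 / (2 * m)) = 1 / 2 := by field_simp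
  rw [h8] at h7
  have h9 : lg (4 * m) ≤ 3 * lg m := by
    have : lg (4 * m) ≤ Real.log (((m : ℝ) + 2) ^ 3) := by
      refine Real.log_le_log (by positivity) ?_
      push_cast
      nlinarith [pow_pos (show (0 : ℝ) < m by linarith) 3]
    rwa [Real.log_pow] at this
  have h10 := green_le (4 * m) 0
  have h11 := green_le (4 * m) e₁
  have h12 := avd_nonneg m
  have h13 : (green (4 * m) 0 + green (4 * m) e₁) * avd m ≤ 24 * lg m * avd m := by
    gcongr
    linarith
  rw [div_le_iff₀ (by linarith [lg_pos m])]
  linarith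

/-- The steps of a block of length four from `x`: it visits `x - e₁`, `x`, then `x + e₁` or
`x - e₁` according to `b`, and returns to `x`. -/
def pat (b : Bool) (r : ℕ) : Fin 2 × Bool :=
  if r = 0 then (0, false) else if r = 1 then (0, true) else if r = 2 then (0, b) else (0, !b)

/-- The block number `i` of the walk follows the pattern `b`. -/
def HasPat (w : ℕ → Fin 2 × Bool) (i : ℕ) (b : Bool) : Prop := ∀ r < 4, w (4 * i + r) = pat b r

/-- The block number `i < m` follows one of the two patterns. -/
def Free (m : ℕ) (w : ℕ → Fin 2 × Bool) (i : ℕ) : Prop := i < m ∧ ∃ b, HasPat w i b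

open Classical in
/-- All free blocks are replaced by the pattern `false`. -/
noncomputable def canon (m : ℕ) (w : ℕ → Fin 2 × Bool) : ℕ → Fin 2 × Bool :=
  fun t => if Free m w (t / 4) then pat false (t % 4) else w t

/-- The blocks in `G` are replaced by the pattern `true` on `T` and by `false` off `T`. -/
def setPat (G T : Finset ℕ) (w : ℕ → Fin 2 × Bool) : ℕ → Fin 2 × Bool :=
  fun t => if t / 4 ∈ G then pat (decide (t / 4 ∈ T)) (t % 4) else w t

/-- The walk avoids `x` and `x + e₁` outside of the block `i` started from `x`. -/
def AvoidAt (n : ℕ) (w : ℕ → Fin 2 × Bool) (i : ℕ) : Prop :=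
  ∀ k ≤ n, (k < 4 * i ∨ 4 * i + 4 < k) →
    pos w k ≠ pos w (4 * i) ∧ pos w k ≠ pos w (4 * i) + e₁

/-- The block `i` has the pattern `false`, and the walk avoids its start `x` and `x + e₁`
outside of the block. -/
def GoodAt (n : ℕ) (w : ℕ → Fin 2 × Bool) (i : ℕ) : Prop := HasPat w i false ∧ AvoidAt n w i

theorem step_false : step ((0, false) : Fin 2 × Bool) = -e₁ := by
  funext j
  by_cases h : j = 0 <;> simp [step, e₁, h]

theorem step_true : step ((0, true) : Fin 2 × Bool) = e₁ := rfl

section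

variable {m n i j : ℕ} {w : ℕ → Fin 2 × Bool} {b : Bool}

theorem HasPat.pos_one (h : HasPat w i b) : pos w (4 * i + 1) = pos w (4 * i) - e₁ := by
  have := h 0 (by norm_num)
  rw [pos_succ, ← add_zero (4 * i), this]
  simp [pat, step_false, sub_eq_add_neg]

theorem HasPat.pos_two (h : HasPat w i b) : pos w (4 * i + 2) = pos w (4 * i) := by
  rw [show 4 * i + 2 = 4 * i + 1 + 1 by rfl, pos_succ, h.pos_one, h 1 (by norm_num)]
  simp [pat, step_true]

theorem HasPat.pos_three (h : HasPat w i b) :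
    pos w (4 * i + 3) = pos w (4 * i) + if b then e₁ else -e₁ := by
  rw [show 4 * i + 3 = 4 * i + 2 + 1 by rfl, pos_succ, h.pos_two, h 2 (by norm_num)]
  cases b <;> simp [pat, step_true, step_false]

theorem HasPat.pos_four (h : HasPat w i b) : pos w (4 * i + 4) = pos w (4 * i) := by
  rw [show 4 * i + 4 = 4 * i + 3 + 1 by rfl, pos_succ, h.pos_three, h 3 (by norm_num)]
  cases b <;> simp [pat, step_true, step_false]

theorem HasPat.unique {b' : Bool} (h : HasPat w i b) (h' : HasPat w i b') : b = b' := by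
  have := (h 2 (by norm_num)).symm.trans (h' 2 (by norm_num))
  simpa [pat] using this

theorem canon_free (h : Free m w i) : HasPat (canon m w) i false := by
  intro r hr
  have h1 : (4 * i + r) / 4 = i := by omega
  have h2 : (4 * i + r) % 4 = r := by omega
  unfold canon
  rw [h1, h2, if_pos h]

theorem canon_not_free (h : ¬ Free m w i) {r : ℕ} (hr : r < 4) :
    canon m w (4 * i + r) = w (4 * i + r) := by
  have h1 : (4 * i + r) / 4 = i := by omega
  unfold canon
  rw [h1, if_neg h]

theorem pos_canon_block (j : ℕ) : pos (canon m w) (4 * j) = pos w (4 * j) := by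
  induction j with
  | zero => simp [pos_zero]
  | succ j ih =>
    rw [mul_add, mul_one]
    by_cases h : Free m w j
    · obtain ⟨b, hb⟩ := h.2
      rw [(canon_free h).pos_four, hb.pos_four, ih]
    · have h0 : canon m w (4 * j) = w (4 * j) := canon_not_free h (r := 0) (by norm_num)
      simp only [show 4 * j + 4 = 4 * j + 1 + 1 + 1 + 1 by rfl, pos_succ, ih, h0]
      rw [show 4 * j + 1 + 1 + 1 = 4 * j + 3 by rfl, show 4 * j + 1 + 1 = 4 * j + 2 by rfl,
        canon_not_free h (r := 1) (by norm_num), canon_not_free h (r := 2) (by norm_num),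
        canon_not_free h (r := 3) (by norm_num)]

theorem pos_canon_cases (m : ℕ) (w : ℕ → Fin 2 × Bool) (k : ℕ) :
    pos w k = pos (canon m w) k ∨ ∃ j, k = 4 * j + 3 ∧ Free m w j ∧
      pos w k = pos (canon m w) (4 * j) + e₁ ∧ pos (canon m w) k = pos (canon m w) (4 * j) - e₁ ∧
      pos w (4 * j + 1) = pos (canon m w) (4 * j) - e₁ := by
  obtain ⟨j, r, hr, rfl⟩ : ∃ j r, r < 4 ∧ k = 4 * j + r := ⟨k / 4, k % 4, by omega, by omega⟩
  have h0 := pos_canon_block (m := m) (w := w) j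
  by_cases h : Free m w j
  · have hn := canon_free h
    obtain ⟨b, hb⟩ := h.2
    interval_cases r
    · exact Or.inl h0.symm
    · left; rw [hb.pos_one, hn.pos_one, h0]
    · left; rw [hb.pos_two, hn.pos_two, h0]
    · cases b
      · left; rw [hb.pos_three, hn.pos_three, h0]
      · right
        refine ⟨j, rfl, h, ?_, ?_, ?_⟩
        · rw [hb.pos_three, h0]; simp
        · rw [hn.pos_three]; simp [sub_eq_add_neg]
        · rw [hb.pos_one, h0]
  · left
    have : ∀ r ≤ 4, pos w (4 * j + r) = pos (canon m w) (4 * j + r) := by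
      intro r hr
      induction r with
      | zero => exact h0.symm
      | succ r ih => rw [← add_assoc, pos_succ, pos_succ, ih (by omega), canon_not_free h (by omega)]
    exact this r hr.le

theorem goodAt_canon (hf : Free m w i) (h : AvoidAt n w i) : GoodAt n (canon m w) i := by
  refine ⟨canon_free hf, fun k hk hki => ?_⟩
  rw [pos_canon_block i]
  rcases pos_canon_cases m w k with hw | ⟨j, hj, -, -, h1, h2⟩
  · rw [← hw]
    exact h k hk hki
  · rw [h1, ← h2]
    exact h _ (by omega) (by omega)

theorem visits_iff_hasPat (hn : 4 * m ≤ n) (hi : i < m) (h : GoodAt n (canon m w) i) :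
    Visits w n (pos (canon m w) (4 * i) + e₁) ↔ HasPat w i true := by
  have hfree : Free m w i := by
    by_contra hf
    refine hf ⟨hi, false, fun r hr => ?_⟩
    rw [← canon_not_free hf hr]
    exact h.1 r hr
  constructor
  · rintro ⟨k, hk, hku⟩
    by_cases hki : k < 4 * i ∨ 4 * i + 4 < k
    · exfalso
      rcases pos_canon_cases m w k with hw | ⟨j, hj, hjf, h1, -, -⟩
      · exact (h.2 k hk hki).2 (hw ▸ hku)
      · rw [h1, add_left_inj] at hku
        refine (h.2 (4 * j + 2) (by omega) (by omega)).1 ?_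
        rw [(canon_free hjf).pos_two, hku]
    · obtain ⟨b, hb⟩ := hfree.2
      cases b
      · exfalso
        have he := e₁_ne_zero
        have he2 : -e₁ ≠ e₁ := fun h => by simpa [e₁, step] using congrFun h 0
        rw [pos_canon_block i] at hku
        obtain hk0 | hk0 | hk0 | hk0 | hk0 : k = 4 * i ∨ k = 4 * i + 1 ∨ k = 4 * i + 2 ∨
            k = 4 * i + 3 ∨ k = 4 * i + 4 := by omega
        all_goals subst hk0
        · simp [he] at hku
        · rw [hb.pos_one, sub_eq_add_neg, add_right_inj] at hku
          exact he2 hku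
        · rw [hb.pos_two] at hku
          simp [he] at hku
        · rw [hb.pos_three, add_right_inj] at hku
          exact he2 (by simpa using hku)
        · rw [hb.pos_four] at hku
          simp [he] at hku
      · exact hb
  · intro hb
    refine ⟨4 * i + 3, by omega, ?_⟩
    rw [hb.pos_three, pos_canon_block i]
    simp

open Classical in
/-- The good blocks among the first `m`. -/
noncomputable def good (n : ℕ) (m : ℕ) (w : ℕ → Fin 2 × Bool) : Finset ℕ :=
  (Finset.range m).filter (GoodAt n w)

theorem mem_good : i ∈ good n m w ↔ i < m ∧ GoodAt n w i := by simp [good]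

theorem hasPat_setPat {G T : Finset ℕ} (hi : i ∈ G) :
    HasPat (setPat G T w) i (decide (i ∈ T)) := by
  intro r hr
  have h1 : (4 * i + r) / 4 = i := by omega
  have h2 : (4 * i + r) % 4 = r := by omega
  simp only [setPat, h1, h2, if_pos hi]

theorem setPat_apply_of_notMem {G T : Finset ℕ} (hi : i ∉ G) {r : ℕ} (hr : r < 4) :
    setPat G T w (4 * i + r) = w (4 * i + r) := by
  have h1 : (4 * i + r) / 4 = i := by omega
  simp only [setPat, h1, if_neg hi]

theorem canon_setPat {G T : Finset ℕ} (hG : ∀ i ∈ G, i < m ∧ HasPat (canon m w) i false) :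
    canon m (setPat G T w) = canon m w := by
  funext t
  obtain ⟨j, r, hr, rfl⟩ : ∃ j r, r < 4 ∧ t = 4 * j + r := ⟨t / 4, t % 4, by omega, by omega⟩
  by_cases hj : j ∈ G
  · rw [canon_free ⟨(hG j hj).1, _, hasPat_setPat hj⟩ r hr, (hG j hj).2 r hr]
  · have hiff : Free m (setPat G T w) j ↔ Free m w j :=
      and_congr_right fun _ => exists_congr fun b => forall_congr' fun r =>
        imp_congr_right fun hr => by rw [setPat_apply_of_notMem hj hr]
    by_cases hf : Free m w j
    · rw [canon_free hf r hr, canon_free (hiff.2 hf) r hr]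
    · rw [canon_not_free hf hr, canon_not_free (fun h => hf (hiff.1 h)) hr,
        setPat_apply_of_notMem hj hr]

/-- A walk with given range and normal form is recovered from its resampled version. -/
theorem setPat_injective {w' : ℕ → Fin 2 × Bool} {T T' : Finset ℕ} (hn : 4 * m ≤ n)
    (hw : canon m w = canon m w') (hr : rng w n = rng w' n) (hT : T ⊆ good n m (canon m w))
    (hT' : T' ⊆ good n m (canon m w))
    (h : setPat (good n m (canon m w)) T w = setPat (good n m (canon m w)) T' w') :
    w = w' ∧ T = T' := by
  constructor
  · funext t
    obtain ⟨j, r, hr', rfl⟩ : ∃ j r, r < 4 ∧ t = 4 * j + r := ⟨t / 4, t % 4, by omega, by omega⟩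
    by_cases hj : j ∈ good n m (canon m w)
    · obtain ⟨hjm, hg⟩ := mem_good.1 hj
      have h1 := visits_iff_hasPat hn hjm hg
      have h2 := visits_iff_hasPat (w := w') hn hjm (hw ▸ hg)
      rw [← hw, ← mem_rng, ← hr, mem_rng, h1] at h2
      have hpat : ∀ v, canon m v = canon m w → ∃ b, HasPat v j b := by
        intro v hv
        by_cases hf : Free m v j
        · exact hf.2
        · refine ⟨false, fun r hr => ?_⟩
          rw [← canon_not_free hf hr, hv]
          exact hg.1 r hr
      obtain ⟨b, hb⟩ := hpat w rfl
      obtain ⟨b', hb'⟩ := hpat w' hw.symm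
      have : b = b' := by
        cases b <;> cases b'
        · rfl
        · exact absurd (hb.unique (h2.2 hb')) (by simp)
        · exact absurd (hb'.unique (h2.1 hb)) (by simp)
        · rfl
      rw [hb r hr', hb' r hr', this]
    · rw [← setPat_apply_of_notMem (w := w) (T := T) hj hr', h,
        setPat_apply_of_notMem hj hr']
  · ext i
    by_cases hi : i ∈ good n m (canon m w)
    · have h1 := hasPat_setPat (T := T) (w := w) hi
      have h2 := hasPat_setPat (T := T') (w := w') hi
      rw [← h] at h2
      simpa using h1.unique h2
    · exact ⟨fun h => absurd (hT h) hi, fun h => absurd (hT' h) hi⟩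

end

section conditional

variable {α β : Type*} [DecidableEq α] [DecidableEq β] {n : ℕ}

theorem sum_fib (X : (Fin n → Fin 2 × Bool) → α) :
    ∑ a ∈ Finset.univ.image X, (fib X a : ℝ) = 4 ^ n := by
  rw [← sum_inv_fib X fun a => (fib X a : ℝ)]
  rw [Finset.sum_congr rfl fun ω _ =>
    div_self (Nat.cast_ne_zero.2 (fib_pos X ω).ne' : (fib X (X ω) : ℝ) ≠ 0)]
  simp only [Finset.sum_const, Finset.card_univ, card_paths, nsmul_eq_mul]
  push_cast
  ring

/-- The entropy is at least the conditional entropy. -/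
theorem le_entW_of_pair (X : (Fin n → Fin 2 × Bool) → α) (Y : (Fin n → Fin 2 × Bool) → β) :
    (∑ ω, logb 2 (fib Y (Y ω) / fib (fun ω => (X ω, Y ω)) (X ω, Y ω))) / 4 ^ n ≤ entW 2 n X := by
  set Z : (Fin n → Fin 2 × Bool) → α × β := fun ω => (X ω, Y ω) with hZ
  have h4 : (0 : ℝ) < 4 ^ n := by positivity
  rw [entW_eq, ← Finset.sum_neg_distrib]
  gcongr ?_ / _
  rw [← sub_nonpos, ← Finset.sum_sub_distrib]
  have hterm : ∀ ω, logb 2 (fib Y (Y ω) / fib Z (X ω, Y ω)) - -logb 2 (fib X (X ω) / 4 ^ n) ≤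
      ((fib X (X ω) * fib Y (Y ω) : ℝ) / fib Z (Z ω) / 4 ^ n - 1) / Real.log 2 := by
    intro ω
    have hX : (0 : ℝ) < fib X (X ω) := by exact_mod_cast fib_pos X ω
    have hY : (0 : ℝ) < fib Y (Y ω) := by exact_mod_cast fib_pos Y ω
    have hXY : (0 : ℝ) < fib Z (Z ω) := by exact_mod_cast fib_pos Z ω
    change logb 2 (fib Y (Y ω) / fib Z (Z ω)) - -logb 2 (fib X (X ω) / 4 ^ n) ≤ _
    rw [← Real.log_div_log, ← Real.log_div_log, sub_neg_eq_add, ← add_div,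
      ← Real.log_mul (by positivity) (by positivity)]
    have := Real.log_le_sub_one_of_pos
      (show 0 < (fib Y (Y ω) / fib Z (Z ω) : ℝ) * (fib X (X ω) / 4 ^ n) by positivity)
    refine div_le_div_of_nonneg_right (this.trans (le_of_eq ?_)) (Real.log_nonneg (by norm_num))
    ring
  refine (Finset.sum_le_sum fun ω _ => hterm ω).trans ?_
  rw [← Finset.sum_div, Finset.sum_sub_distrib, ← Finset.sum_div]
  refine div_nonpos_of_nonpos_of_nonneg ?_ (Real.log_nonneg (by norm_num))
  have h1 := sum_inv_fib Z fun p => (fib X p.1 * fib Y p.2 : ℝ)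
  have h2 : ∑ p ∈ Finset.univ.image Z, (fib X p.1 * fib Y p.2 : ℝ) ≤ 4 ^ n * 4 ^ n := by
    nth_rewrite 1 [← sum_fib X]
    rw [← sum_fib Y, Finset.sum_mul_sum, ← Finset.sum_product']
    refine Finset.sum_le_sum_of_subset_of_nonneg (fun p hp => ?_) fun p _ _ => by positivity
    obtain ⟨ω, -, rfl⟩ := Finset.mem_image.1 hp
    exact Finset.mem_product.2 ⟨Finset.mem_image_of_mem X (Finset.mem_univ ω),
      Finset.mem_image_of_mem Y (Finset.mem_univ ω)⟩
  rw [h1]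
  simp only [Finset.sum_const, Finset.card_univ, card_paths, nsmul_eq_mul]
  push_cast
  rw [mul_one, sub_nonpos, div_le_iff₀ h4]
  exact h2

end conditional

section resample

variable {n : ℕ}

/-- The normal form of a finite path. -/
noncomputable def canonPath (n : ℕ) (ω : Fin n → Fin 2 × Bool) : Fin n → Fin 2 × Bool :=
  fun t => canon (n / 4) (ext ω) t

theorem ext_canonPath (ω : Fin n → Fin 2 × Bool) : ext (canonPath n ω) = canon (n / 4) (ext ω) := by
  funext t
  by_cases ht : t < n
  · simp [ext, canonPath, ht]
  · have : ¬ Free (n / 4) (ext ω) (t / 4) := fun h => by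
      have := h.1
      omega
    simp [canon, ext, ht, this]

theorem ext_setPat {G T : Finset ℕ} (hG : ∀ i ∈ G, i < n / 4) (ω : Fin n → Fin 2 × Bool) :
    ext (fun t : Fin n => setPat G T (ext ω) t) = setPat G T (ext ω) := by
  funext t
  by_cases ht : t < n
  · simp [ext, ht]
  · have : t / 4 ∉ G := fun h => by
      have := hG _ h
      omega
    simp [setPat, ext, ht, this]

theorem ext_injective : Function.Injective (ext : (Fin n → Fin 2 × Bool) → _) := by
  intro ω ω' h
  funext t
  rw [← ext_apply ω, h, ext_apply]

/-- Resampling the good blocks multiplies the number of paths. -/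
theorem fib_pair_mul_le (ω₀ : Fin n → Fin 2 × Bool) :
    fib (fun ω => (rangeW (0 : Fin 2 → ℤ) ω, canonPath n ω)) (rangeW 0 ω₀, canonPath n ω₀) *
      2 ^ (good n (n / 4) (canon (n / 4) (ext ω₀))).card ≤ fib (canonPath n) (canonPath n ω₀) := by
  set m := n / 4 with hm
  set G := good n m (canon m (ext ω₀)) with hG
  have key : ∀ ω : Fin n → Fin 2 × Bool, (rangeW (0 : Fin 2 → ℤ) ω, canonPath n ω) =
      (rangeW 0 ω₀, canonPath n ω₀) →
      rng (ext ω) n = rng (ext ω₀) n ∧ canon m (ext ω) = canon m (ext ω₀) := by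
    intro ω h
    rw [Prod.mk.injEq, rangeW_eq, rangeW_eq] at h
    refine ⟨h.1, ?_⟩
    rw [← ext_canonPath, h.2, ext_canonPath]
  rw [fib, fib, ← Finset.card_powerset, ← Finset.card_product]
  refine Finset.card_le_card_of_injOn
    (fun p => fun t : Fin n => setPat G p.2 (ext p.1) t) ?_ ?_
  · rintro ⟨ω, T⟩ hp
    simp only [Finset.coe_product, Set.mem_prod, Finset.mem_coe, Finset.mem_filter,
      Finset.mem_univ, true_and, Finset.mem_powerset] at hp
    obtain ⟨h1, h2⟩ := key ω hp.1
    simp only [Finset.mem_coe, Finset.mem_filter, Finset.mem_univ, true_and]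
    apply ext_injective
    rw [ext_canonPath, ext_setPat fun i hi => (mem_good.1 hi).1, ext_canonPath,
      canon_setPat fun i hi => ?_, h2]
    rw [h2]
    exact ⟨(mem_good.1 hi).1, (mem_good.1 hi).2.1⟩
  · rintro ⟨ω, T⟩ hp ⟨ω', T'⟩ hp' h
    simp only [Finset.coe_product, Set.mem_prod, Finset.mem_coe, Finset.mem_filter,
      Finset.mem_univ, true_and, Finset.mem_powerset] at hp hp' h
    obtain ⟨h1, h2⟩ := key ω hp.1
    obtain ⟨h1', h2'⟩ := key ω' hp'.1
    have h3 := congrArg ext h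
    rw [ext_setPat fun i hi => (mem_good.1 hi).1, ext_setPat fun i hi => (mem_good.1 hi).1] at h3
    obtain ⟨h4, h5⟩ := setPat_injective (m := m) (n := n) (T := T) (T' := T') (by omega)
      (h2.trans h2'.symm)
      (h1.trans h1'.symm) (by rw [h2]; exact hp.2) (by rw [h2]; exact hp'.2)
      (by rw [h2]; exact h3)
    rw [ext_injective h4, h5]

theorem ex_card_good_le_entW (n : ℕ) :
    ex n (fun w => ((good n (n / 4) (canon (n / 4) w)).card : ℝ)) ≤
      entW 2 n (rangeW (0 : Fin 2 → ℤ)) := by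
  refine le_trans ?_ (le_entW_of_pair (rangeW (0 : Fin 2 → ℤ)) (canonPath n))
  unfold ex
  gcongr ?_ / _
  refine Finset.sum_le_sum fun ω _ => ?_
  have h := fib_pair_mul_le ω
  have hp := fib_pos (fun ω => (rangeW (0 : Fin 2 → ℤ) ω, canonPath n ω)) ω
  have hp' : (0 : ℝ) < fib (fun ω => (rangeW (0 : Fin 2 → ℤ) ω, canonPath n ω))
    (rangeW 0 ω, canonPath n ω) := by exact_mod_cast hp
  rw [Real.le_logb_iff_rpow_le (by norm_num) (by
    have := fib_pos (canonPath n) ω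
    positivity), le_div_iff₀ hp', Real.rpow_natCast, mul_comm]
  exact_mod_cast h

theorem ex_pat (a : ℕ → Fin 2 × Bool) (s : ℕ) :
    ex s (fun w => ind (∀ r < s, w r = a r)) = 1 / 4 ^ s := by
  unfold ex
  congr 1
  rw [Finset.sum_eq_single fun t : Fin s => a t]
  · exact ind_of_true fun r hr => by simp [ext, hr]
  · intro ω _ hω
    refine ind_of_false fun h => hω ?_
    funext t
    rw [← h t t.2, ext_apply]
  · simp

theorem avoidAt_of_avoids {i : ℕ} {w : ℕ → Fin 2 × Bool} {b : Bool} (hp : HasPat w i b)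
    (h1 : Avoids e₁ (rev (4 * i) w) (4 * i))
    (h2 : Avoids e₁ (shift 4 (shift (4 * i) w)) (n - 4 * i - 4)) : AvoidAt n w i := by
  intro k hk hki
  rcases hki with h | h
  · have := h1 (4 * i - k) (by omega) (by omega)
    rw [pos_rev (by omega), show 4 * i - (4 * i - k) = k by omega] at this
    rwa [sub_ne_zero, ne_eq _ e₁, sub_eq_iff_eq_add'] at this
  · have := h2 (k - 4 * i - 4) (by omega) (by omega)
    have hs : shift 4 (shift (4 * i) w) = shift (4 * i + 4) w := by
      funext t
      simp [shift, add_assoc]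
    have hk' : pos w k = pos w (4 * i) + pos (shift (4 * i + 4) w) (k - 4 * i - 4) := by
      rw [← hp.pos_four, ← pos_add]
      congr 1
      omega
    rw [hs] at this
    rw [hk', ne_eq, ne_eq, add_eq_left, add_right_inj]
    exact this

theorem le_ex_goodAt {i : ℕ} (hi : i < n / 4) :
    1 / 256 * avd n ^ 2 ≤ ex n fun w => ind (GoodAt n (canon (n / 4) w) i) := by
  have hdep1 : DependsOn (fun w : ℕ → Fin 2 × Bool => ind (Avoids e₁ (rev (4 * i) w) (4 * i)))
      (Set.Iio (4 * i)) := by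
    intro w w' h
    refine ind_congr (avoids_congr fun t ht => ?_)
    rw [Set.mem_Iio] at ht
    simp only [rev, if_pos ht]
    rw [h _ (by rw [Set.mem_Iio]; omega)]
  have hdep2 : DependsOn (fun w : ℕ → Fin 2 × Bool => ind (∀ r < 4, w r = pat false r))
      (Set.Iio 4) := by
    intro w w' h
    refine ind_congr (forall_congr' fun r => forall_congr' fun hr => ?_)
    rw [h r hr]
  have h1 : ex n (fun w => (fun w => ind (Avoids e₁ (rev (4 * i) w) (4 * i))) w *
      (fun v => ind (∀ r < 4, v r = pat false r) *
        (fun u => ind (Avoids e₁ u (n - 4 * i - 4))) (shift 4 v)) (shift (4 * i) w)) =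
      avd (4 * i) * (1 / 4 ^ 4 * avd (n - 4 * i - 4)) := by
    rw [ex_mul_shift' (s := 4 * i) (t := n - 4 * i) (by omega) hdep1
        (fun v => ind (∀ r < 4, v r = pat false r) *
          (fun u => ind (Avoids e₁ u (n - 4 * i - 4))) (shift 4 v)),
      ex_mul_shift' (n := n - 4 * i) (s := 4) (t := n - 4 * i - 4) (by omega) hdep2
        (fun u => ind (Avoids e₁ u (n - 4 * i - 4))), ex_pat,
      ex_rev (4 * i) fun w => ind (Avoids e₁ w (4 * i))]
    rfl
  have h2 : 1 / 256 * avd n ^ 2 ≤ avd (4 * i) * (1 / 4 ^ 4 * avd (n - 4 * i - 4)) := by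
    have h3 := avd_anti (show 4 * i ≤ n by omega)
    have h4 := avd_anti (show n - 4 * i - 4 ≤ n by omega)
    have h5 := mul_le_mul h3 h4 (avd_nonneg _) (avd_nonneg _)
    nlinarith
  refine h2.trans (h1 ▸ ex_mono fun w => ?_)
  simp only [← ind_and]
  refine ind_mono fun ⟨ha, hp, hs⟩ => ?_
  exact goodAt_canon ⟨hi, false, hp⟩ (avoidAt_of_avoids (b := false) hp ha hs)

theorem le_entW (n : ℕ) :
    (n / 4 : ℕ) * (1 / 256 * (1 / (48 * lg n)) ^ 2) ≤ entW 2 n (rangeW (0 : Fin 2 → ℤ)) := by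
  refine le_trans ?_ (ex_card_good_le_entW n)
  have h : ∀ w, ((good n (n / 4) (canon (n / 4) w)).card : ℝ) =
      ∑ i ∈ Finset.range (n / 4), ind (GoodAt n (canon (n / 4) w) i) := fun w => by
    rw [good, Finset.card_filter]
    push_cast
    rfl
  simp only [h]
  rw [ex_sum]
  refine le_trans ?_ (Finset.sum_le_sum fun i hi => le_ex_goodAt (Finset.mem_range.1 hi))
  rw [Finset.sum_const, Finset.card_range, nsmul_eq_mul]
  have := lg_pos n
  gcongr
  exact le_avd n

end resample

section small

variable {n : ℕ}

theorem entW_rangeW_pos (hn : 1 ≤ n) : 0 < entW 2 n (rangeW (0 : Fin 2 → ℤ)) := by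
  have h4 : (0 : ℝ) < 4 ^ n := by positivity
  rw [entW_eq, ← Finset.sum_neg_distrib]
  refine div_pos ?_ h4
  set X : (Fin n → Fin 2 × Bool) → Finset (Fin 2 → ℤ) := rangeW 0 with hX
  have hfib : ∀ ω, (0 : ℝ) < fib X (X ω) / 4 ^ n := fun ω =>
    div_pos (by exact_mod_cast fib_pos X ω) h4
  refine Finset.sum_pos' (fun ω _ => ?_) ⟨fun _ => (0, true), Finset.mem_univ _, ?_⟩
  · rw [neg_nonneg]
    refine Real.logb_nonpos (by norm_num) (hfib ω).le ?_
    rw [div_le_one h4]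
    have : fib X (X ω) ≤ 4 ^ n := by
      rw [← card_paths n]
      exact Finset.card_le_univ _
    exact_mod_cast this
  · rw [neg_pos]
    refine Real.logb_neg (by norm_num) (hfib _) ?_
    rw [div_lt_one h4]
    have : fib X (X fun _ => (0, true)) < 4 ^ n := by
      rw [← card_paths n]
      refine Finset.card_lt_univ_of_notMem (x := fun _ => (1, true)) ?_
      simp only [Finset.mem_filter, Finset.mem_univ, true_and, hX, rangeW_eq]
      intro h
      have h1 : e₁ ∈ rng (ext fun _ : Fin n => ((0, true) : Fin 2 × Bool)) n :=
        mem_rng.2 ⟨1, hn, by simp [pos, ext, e₁]⟩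
      rw [← h, mem_rng] at h1
      obtain ⟨k, hk, hk1⟩ := h1
      have h2 := congrFun hk1 0
      rw [pos, Finset.sum_apply, Finset.sum_eq_zero] at h2
      · simp [e₁, step] at h2
      · intro t ht
        rw [Finset.mem_range] at ht
        simp [ext, step, show t < n by omega]
    exact_mod_cast this

theorem exists_le_entW : ∃ c : ℝ, 0 < c ∧ ∀ n : ℕ, 2 ≤ n →
    c * n / Real.log n ^ 2 ≤ entW 2 n (rangeW (0 : Fin 2 → ℤ)) := by
  set c₁ : ℝ := 1 / (8 * 256 * 2304 * 4) with hc₁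
  have hlog2 : 0 < Real.log 2 := Real.log_pos (by norm_num)
  have hlog3 : 0 < Real.log 3 := Real.log_pos (by norm_num)
  have h2 := entW_rangeW_pos (n := 2) (by norm_num)
  have h3 := entW_rangeW_pos (n := 3) (by norm_num)
  refine ⟨min c₁ (min (entW 2 2 (rangeW (0 : Fin 2 → ℤ)) * Real.log 2 ^ 2 / 2)
    (entW 2 3 (rangeW (0 : Fin 2 → ℤ)) * Real.log 3 ^ 2 / 3)), by positivity, fun n hn => ?_⟩
  have hlog : 0 < Real.log n := Real.log_pos (by exact_mod_cast hn)
  rw [div_le_iff₀ (by positivity)]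
  obtain rfl | rfl | hn4 : n = 2 ∨ n = 3 ∨ 4 ≤ n := by omega
  · have := (min_le_right c₁ _).trans (min_le_left (entW 2 2 (rangeW (0 : Fin 2 → ℤ)) *
      Real.log 2 ^ 2 / 2) (entW 2 3 (rangeW (0 : Fin 2 → ℤ)) * Real.log 3 ^ 2 / 3))
    push_cast
    linarith
  · have := (min_le_right c₁ _).trans (min_le_right (entW 2 2 (rangeW (0 : Fin 2 → ℤ)) *
      Real.log 2 ^ 2 / 2) (entW 2 3 (rangeW (0 : Fin 2 → ℤ)) * Real.log 3 ^ 2 / 3))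
    push_cast
    linarith
  · refine (mul_le_mul_of_nonneg_right (min_le_left c₁ _) (Nat.cast_nonneg n)).trans ?_
    rw [← div_le_iff₀ (by positivity)]
    refine le_trans ?_ (le_entW n)
    have hlg : lg n ≤ 2 * Real.log n := by
      rw [lg, ← Real.log_rpow (by positivity)]
      refine Real.log_le_log (by positivity) ?_
      have : (4 : ℝ) ≤ n := by exact_mod_cast hn4
      norm_num
      nlinarith
    have hm : (n : ℝ) / 8 ≤ (n / 4 : ℕ) := by
      have : n ≤ 8 * (n / 4) := by omega
      have : (n : ℝ) ≤ 8 * (n / 4 : ℕ) := by exact_mod_cast this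
      linarith
    have hpos := lg_pos n
    calc c₁ * n / Real.log n ^ 2 = n / 8 * (1 / 256 * (1 / (48 * (2 * Real.log n))) ^ 2) := by
          rw [hc₁]
          field_simp
          norm_num
      _ ≤ _ := by gcongr

end small

end PlanarWalk

/-- Entropy of the range of `n`-step SRW on `ℤ²` is of order `n / log² n`. -/
theorem entropy_range_two_dim :
    ∃ c C : ℝ, 0 < c ∧ 0 < C ∧ ∀ n : ℕ, 2 ≤ n →
      c * n / (Real.log n) ^ 2 ≤ entW 2 n (rangeW (0 : Fin 2 → ℤ)) ∧
      entW 2 n (rangeW (0 : Fin 2 → ℤ)) ≤ C * n / (Real.log n) ^ 2 := by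
  obtain ⟨c, hc, h⟩ := PlanarWalk.exists_le_entW
  obtain ⟨C, hC, H⟩ := PlanarWalk.exists_entW_le
  exact ⟨c, C, hc, hC, fun n hn => ⟨h n hn, H n hn⟩⟩
end

section
/- For each dimension d ≥ 3, for simple random walk on ℤ^d, there exist constants c_d > 0 and C_d > 0 such that for all n ∈ ℕ, the Shannon entropy of the range satisfies c_d · n ≤ H(R(n)) ≤ C_d · n. -/
open Real

lemma card_steps (d n : ℕ) : ((2 * d : ℝ)) ^ n = Fintype.card (Fin n → Fin d × Bool) := by
  simp [mul_comm]

lemma entW_eq_sum {α : Type*} [DecidableEq α] (d n : ℕ) (X : (Fin n → Fin d × Bool) → α) :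
    entW d n X = (∑ ω, -logb 2 (prW d n {ω' | X ω' = X ω})) / (2 * d) ^ n := by
  have hsupp : ∀ a ∉ Finset.univ.image X,
      -(prW d n {ω | X ω = a} * logb 2 (prW d n {ω | X ω = a})) = 0 := by
    intro a ha
    have : {ω | X ω = a} = ∅ := by
      ext ω
      simp only [Set.mem_ofPred_eq, Set.mem_empty_iff_false, iff_false]
      rintro rfl
      exact ha (Finset.mem_image_of_mem _ (Finset.mem_univ _))
    simp [this, prW]
  rw [entW, tsum_eq_sum hsupp,
    Finset.sum_comp (fun a => -logb 2 (prW d n {ω' | X ω' = a})) X, Finset.sum_div]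
  refine Finset.sum_congr rfl fun a _ => ?_
  have : ({ω | X ω = a} : Set (Fin n → Fin d × Bool)).ncard =
      (Finset.univ.filter (X · = a)).card := by
    rw [← Set.ncard_coe_finset]
    simp
  rw [nsmul_eq_mul, ← this]
  generalize logb 2 (prW d n {ω | X ω = a}) = L
  rw [prW]
  ring

lemma prW_fiber_mem_Ioc {α : Type*} {d n : ℕ} (X : (Fin n → Fin d × Bool) → α)
    (ω : Fin n → Fin d × Bool) :
    1 / (2 * d : ℝ) ^ n ≤ prW d n {ω' | X ω' = X ω} ∧ 0 < prW d n {ω' | X ω' = X ω} ∧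
      prW d n {ω' | X ω' = X ω} ≤ 1 := by
  have hpos : (0 : ℝ) < (2 * d) ^ n := by
    rw [card_steps]
    exact_mod_cast Fintype.card_pos_iff.2 ⟨ω⟩
  have hone : (1 : ℝ) ≤ ({ω' | X ω' = X ω} : Set (Fin n → Fin d × Bool)).ncard := by
    have : 0 < ({ω' | X ω' = X ω} : Set (Fin n → Fin d × Bool)).ncard :=
      (Set.ncard_pos (Set.toFinite _)).2 ⟨ω, rfl⟩
    exact_mod_cast this
  have hle : (({ω' | X ω' = X ω} : Set (Fin n → Fin d × Bool)).ncard : ℝ) ≤ (2 * d) ^ n := by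
    rw [card_steps, ← Nat.card_eq_fintype_card]
    exact_mod_cast Set.ncard_le_card _
  refine ⟨?_, ?_, ?_⟩ <;> unfold prW
  · gcongr
  · positivity
  · exact (div_le_one hpos).2 hle

lemma entW_nonneg {α : Type*} (d n : ℕ) (X : (Fin n → Fin d × Bool) → α) : 0 ≤ entW d n X := by
  classical
  rw [entW_eq_sum]
  refine div_nonneg (Finset.sum_nonneg fun ω _ => ?_) (by positivity)
  obtain ⟨-, h0, h1⟩ := prW_fiber_mem_Ioc X ω
  exact neg_nonneg.2 (logb_nonpos one_lt_two h0.le h1)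

lemma entW_le {α : Type*} {d : ℕ} (hd : 0 < d) (n : ℕ) (X : (Fin n → Fin d × Bool) → α) :
    entW d n X ≤ logb 2 (2 * d) * n := by
  classical
  have hpos : (0 : ℝ) < (2 * d) ^ n := by positivity
  rw [entW_eq_sum, div_le_iff₀ hpos]
  calc ∑ ω, -logb 2 (prW d n {ω' | X ω' = X ω})
      ≤ ∑ _ω : Fin n → Fin d × Bool, logb 2 (2 * d) * n := by
        refine Finset.sum_le_sum fun ω _ => ?_
        obtain ⟨h, -, -⟩ := prW_fiber_mem_Ioc X ω
        have := logb_le_logb_of_le one_lt_two (by positivity) h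
        rw [one_div, logb_inv, logb_pow] at this
        linarith
    _ = logb 2 (2 * d) * n * (2 * d) ^ n := by
        rw [Finset.sum_const, nsmul_eq_mul, card_steps, Finset.card_univ, mul_comm]

/-- Gibbs' inequality in the form used for entropy lower bounds: a positive weight whose total
mass on each fiber of `X` is at most the number of samples bounds the entropy from below. -/
lemma le_entW_of_weight {α : Type*} [DecidableEq α] {d : ℕ} (hd : 0 < d) {n : ℕ}
    (X : (Fin n → Fin d × Bool) → α) (W : (Fin n → Fin d × Bool) → ℝ) (hW : ∀ ω, 0 < W ω)
    (h : ∀ a, ∑ ω with X ω = a, W ω ≤ (2 * d) ^ n) :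
    (∑ ω, logb 2 (W ω)) / (2 * d) ^ n ≤ entW d n X := by
  have hpos : (0 : ℝ) < (2 * d) ^ n := by positivity
  rw [entW_eq_sum]
  gcongr ?_ / _
  have hcard : ∀ a, prW d n {ω | X ω = a} * (2 * d) ^ n = (Finset.univ.filter (X · = a)).card := by
    intro a
    rw [prW, div_mul_cancel₀ _ hpos.ne', ← Set.ncard_coe_finset]
    simp
  have hmass : ∑ ω, prW d n {ω' | X ω' = X ω} * W ω ≤ (2 * d) ^ n := by
    calc ∑ ω, prW d n {ω' | X ω' = X ω} * W ω
        = ∑ a ∈ Finset.univ.image X, ∑ ω with X ω = a, prW d n {ω' | X ω' = X ω} * W ω :=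
          (Finset.sum_fiberwise_of_maps_to
            (fun ω _ => Finset.mem_image_of_mem X (Finset.mem_univ ω)) _).symm
      _ = ∑ a ∈ Finset.univ.image X, prW d n {ω' | X ω' = a} * ∑ ω with X ω = a, W ω := by
          refine Finset.sum_congr rfl fun a _ => ?_
          rw [Finset.mul_sum]
          refine Finset.sum_congr rfl fun ω hω => ?_
          rw [(Finset.mem_filter.1 hω).2]
      _ ≤ ∑ a ∈ Finset.univ.image X, prW d n {ω' | X ω' = a} * (2 * d) ^ n := by
          refine Finset.sum_le_sum fun a _ => mul_le_mul_of_nonneg_left (h a) ?_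
          unfold prW
          positivity
      _ = (2 * d) ^ n := by
          simp_rw [hcard]
          rw [card_steps, ← Nat.cast_sum, ← Finset.card_eq_sum_card_image, Finset.card_univ]
  have hlog : ∑ ω, (Real.log (prW d n {ω' | X ω' = X ω}) + Real.log (W ω)) ≤ 0 := by
    calc ∑ ω, (Real.log (prW d n {ω' | X ω' = X ω}) + Real.log (W ω))
        ≤ ∑ ω, (prW d n {ω' | X ω' = X ω} * W ω - 1) := by
          refine Finset.sum_le_sum fun ω _ => ?_
          have h0 := (prW_fiber_mem_Ioc X ω).2.1
          rw [← Real.log_mul h0.ne' (hW ω).ne']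
          exact Real.log_le_sub_one_of_pos (mul_pos h0 (hW ω))
      _ ≤ 0 := by
          rw [Finset.sum_sub_distrib]
          simp only [Finset.sum_const, Finset.card_univ, nsmul_eq_mul, mul_one]
          rw [← card_steps]
          linarith
  rw [← sub_nonneg, ← Finset.sum_sub_distrib]
  have hrw : ∀ ω, -logb 2 (prW d n {ω' | X ω' = X ω}) - logb 2 (W ω) =
      -(Real.log (prW d n {ω' | X ω' = X ω}) + Real.log (W ω)) / Real.log 2 := by
    intro ω
    simp only [logb]
    ring
  simp_rw [hrw]
  rw [← Finset.sum_div, Finset.sum_neg_distrib]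
  exact div_nonneg (neg_nonneg.2 hlog) (Real.log_nonneg one_le_two)

/-- The coordinate `j` of `v` can be recovered from the value of `X` at `act v ω`. -/
def Decodable {m : ℕ} {Ω α : Type*} (act : (Fin m → ZMod 2) → Ω → Ω) (X : Ω → α) (ω : Ω)
    (j : Fin m) : Prop :=
  ∀ v w : Fin m → ZMod 2, X (act v ω) = X (act w ω) → v j = w j

lemma decodable_act {m : ℕ} {Ω α : Type*} {act : (Fin m → ZMod 2) → Ω → Ω} {X : Ω → α}
    (hadd : ∀ v w ω, act v (act w ω) = act (v + w) ω) (u : Fin m → ZMod 2) (ω : Ω) (j : Fin m) :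
    Decodable act X (act u ω) j ↔ Decodable act X ω j := by
  constructor
  · intro h v w hvw
    have := h (v - u) (w - u) (by simpa [hadd] using hvw)
    simpa using this
  · intro h v w hvw
    rw [hadd, hadd] at hvw
    simpa using h _ _ hvw

open Classical in
lemma card_fiber_mul_two_pow_le {m : ℕ} {Ω α : Type*} (act : (Fin m → ZMod 2) → Ω → Ω) (X : Ω → α)
    (ω : Ω) (a : α) :
    (Finset.univ.filter fun v => X (act v ω) = a).card *
      2 ^ (Finset.univ.filter fun j => Decodable act X ω j).card ≤ 2 ^ m := by
  have hinj : Function.Injective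
      (fun p : {v // X (act v ω) = a} × ({j // Decodable act X ω j} → ZMod 2) =>
        fun j => if h : Decodable act X ω j then p.2 ⟨j, h⟩ else p.1.1 j) := by
    rintro ⟨⟨v, hv⟩, f⟩ ⟨⟨w, hw⟩, g⟩ h
    have h' := fun j => congrFun h j
    simp only at h'
    congr 1
    · congr 1
      funext j
      by_cases hj : Decodable act X ω j
      · exact hj v w (hv.trans hw.symm)
      · simpa [hj] using h' j
    · funext ⟨j, hj⟩
      simpa [hj] using h' j
  have := Fintype.card_le_of_injective _ hinj
  simpa [Fintype.card_subtype, ZMod.card] using this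

open Classical in
lemma sum_fiber_two_pow_le {m : ℕ} {Ω α : Type*} [Fintype Ω] {act : (Fin m → ZMod 2) → Ω → Ω}
    (hzero : ∀ ω, act 0 ω = ω) (hadd : ∀ v w ω, act v (act w ω) = act (v + w) ω) (X : Ω → α)
    (a : α) :
    ∑ ω with X ω = a, 2 ^ (Finset.univ.filter fun j => Decodable act X ω j).card ≤
      Fintype.card Ω := by
  set G : Ω → ℕ := fun ω => (Finset.univ.filter fun j => Decodable act X ω j).card with hG
  have hinv : ∀ v ω, G (act v ω) = G ω := fun v ω => by simp only [hG, decodable_act hadd]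
  have hshift : ∀ v : Fin m → ZMod 2, ∑ ω with X ω = a, 2 ^ G ω =
      ∑ ω, if X (act v ω) = a then 2 ^ G ω else 0 := by
    intro v
    have hleft : ∀ ω, act (-v) (act v ω) = ω := fun ω => by rw [hadd, neg_add_cancel, hzero]
    have hright : ∀ ω, act v (act (-v) ω) = ω := fun ω => by rw [hadd, add_neg_cancel, hzero]
    rw [Finset.sum_filter]
    refine (Fintype.sum_equiv ⟨act v, act (-v), hleft, hright⟩ _ _ fun ω => ?_).symm
    simp [hinv]
  have key : 2 ^ m * ∑ ω with X ω = a, 2 ^ G ω ≤ 2 ^ m * Fintype.card Ω := by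
    calc 2 ^ m * ∑ ω with X ω = a, 2 ^ G ω
        = ∑ _v : Fin m → ZMod 2, ∑ ω with X ω = a, 2 ^ G ω := by simp [ZMod.card]
      _ = ∑ v : Fin m → ZMod 2, ∑ ω, if X (act v ω) = a then 2 ^ G ω else 0 :=
          Finset.sum_congr rfl fun v _ => hshift v
      _ = ∑ ω, (Finset.univ.filter fun v => X (act v ω) = a).card * 2 ^ G ω := by
          rw [Finset.sum_comm]
          refine Finset.sum_congr rfl fun ω _ => ?_
          rw [← Finset.sum_filter, Finset.sum_const, smul_eq_mul]
      _ ≤ ∑ _ω : Ω, 2 ^ m := Finset.sum_le_sum fun ω _ => card_fiber_mul_two_pow_le act X ω a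
      _ = 2 ^ m * Fintype.card Ω := by simp [mul_comm]
  exact Nat.le_of_mul_le_mul_left key (by positivity)

open Classical in
/-- If `j` is decodable with probability at least `p` for each of the `m` coordinates, then the
entropy of `X` is at least `m * p` bits. -/
lemma le_entW_of_decodable {m d n : ℕ} {α : Type*} (hd : 0 < d)
    {act : (Fin m → ZMod 2) → (Fin n → Fin d × Bool) → (Fin n → Fin d × Bool)}
    (hzero : ∀ ω, act 0 ω = ω) (hadd : ∀ v w ω, act v (act w ω) = act (v + w) ω)
    (X : (Fin n → Fin d × Bool) → α) {p : ℝ}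
    (hp : ∀ j, p * (2 * d) ^ n ≤ (Finset.univ.filter fun ω => Decodable act X ω j).card) :
    m * p ≤ entW d n X := by
  have hpos : (0 : ℝ) < (2 * d) ^ n := by positivity
  refine le_trans ?_ (le_entW_of_weight hd X
    (fun ω => 2 ^ (Finset.univ.filter fun j => Decodable act X ω j).card)
    (fun ω => by positivity) fun a => ?_)
  · rw [le_div_iff₀ hpos]
    have hlog : ∀ k : ℕ, logb 2 (2 ^ k) = (k : ℝ) := fun k => by
      rw [logb_pow, logb_self_eq_one one_lt_two, mul_one]
    simp_rw [hlog]
    rw [← Nat.cast_sum]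
    have hswap : ∑ ω, (Finset.univ.filter fun j => Decodable act X ω j).card =
        ∑ j, (Finset.univ.filter fun ω => Decodable act X ω j).card := by
      simp only [Finset.card_filter]
      exact Finset.sum_comm
    rw [hswap, Nat.cast_sum]
    calc m * p * (2 * d) ^ n = ∑ _j : Fin m, p * (2 * d) ^ n := by simp [mul_assoc]
      _ ≤ _ := Finset.sum_le_sum fun j _ => hp j
  · rw [card_steps]
    exact_mod_cast sum_fiber_two_pow_le hzero hadd X a

/-- Extend a finite sequence to `ℕ` by the constant value `a₀`. -/
def extend {A : Type*} {n : ℕ} (a₀ : A) (ω : Fin n → A) (i : ℕ) : A :=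
  if h : i < n then ω ⟨i, h⟩ else a₀

/-- Partial sums of the steps of an infinite sequence. -/
def seqWalk {d : ℕ} (u : ℕ → Fin d × Bool) (k : ℕ) : Fin d → ℤ :=
  ∑ i ∈ Finset.range k, step (u i)

lemma seqWalk_succ {d : ℕ} (u : ℕ → Fin d × Bool) (k : ℕ) :
    seqWalk u (k + 1) = seqWalk u k + step (u k) :=
  Finset.sum_range_succ _ _

lemma seqWalk_add {d : ℕ} (u : ℕ → Fin d × Bool) (k l : ℕ) :
    seqWalk u (k + l) = seqWalk u k + seqWalk (fun i => u (k + i)) l :=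
  Finset.sum_range_add _ _ _

lemma seqWalk_congr {d : ℕ} {u v : ℕ → Fin d × Bool} {k : ℕ} (h : ∀ i < k, u i = v i) :
    seqWalk u k = seqWalk v k :=
  Finset.sum_congr rfl fun i hi => by rw [h i (Finset.mem_range.1 hi)]

lemma walk_eq_seqWalk {d n : ℕ} (a₀ : Fin d × Bool) (z : Fin d → ℤ) (ω : Fin n → Fin d × Bool)
    {k : ℕ} (hk : k ≤ n) : walk z ω k = z + seqWalk (extend a₀ ω) k := by
  rw [walk, seqWalk]
  congr 1
  refine Finset.sum_bij (fun i _ => (i : ℕ)) ?_ ?_ ?_ ?_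
  · intro i hi
    simpa using hi
  · intro i _ j _ h
    exact Fin.ext h
  · intro i hi
    have hi' := Finset.mem_range.1 hi
    exact ⟨⟨i, hi'.trans_le hk⟩, by simpa using hi', rfl⟩
  · intro i _
    simp [extend]

/-- The other index of the pair `{2i, 2i+1}` containing a given index. -/
def partner (i : ℕ) : ℕ := if i % 2 = 0 then i + 1 else i - 1

lemma partner_div_two (i : ℕ) : partner i / 2 = i / 2 := by unfold partner; split_ifs <;> omega

lemma partner_partner (i : ℕ) : partner (partner i) = i := by
  unfold partner; split_ifs <;> omega

/-- Swap the entries `2i` and `2i+1` of the sequence `u` whenever `T i ≠ 0`. -/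
def swapSeq {A : Type*} (T : ℕ → ZMod 2) (u : ℕ → A) (i : ℕ) : A :=
  if T (i / 2) = 0 then u i else u (partner i)

lemma swapSeq_swapSeq {A : Type*} (T T' : ℕ → ZMod 2) (u : ℕ → A) :
    swapSeq T (swapSeq T' u) = swapSeq (T + T') u := by
  funext i
  simp only [swapSeq, Pi.add_apply, partner_div_two, partner_partner]
  have key : ∀ a b : ZMod 2, a + b = 0 ↔ (a = 0 ↔ b = 0) := by decide
  by_cases h : T (i / 2) = 0 <;> by_cases h' : T' (i / 2) = 0 <;> simp [key, h, h']

lemma seqWalk_swapSeq_even {d : ℕ} (T : ℕ → ZMod 2) (u : ℕ → Fin d × Bool) (i : ℕ) :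
    seqWalk (swapSeq T u) (2 * i) = seqWalk u (2 * i) := by
  induction i with
  | zero => rfl
  | succ i ih =>
    rw [show 2 * (i + 1) = 2 * i + 1 + 1 by ring, seqWalk_succ, seqWalk_succ, seqWalk_succ,
      seqWalk_succ, ih]
    have h0 : 2 * i / 2 = i := by omega
    have h1 : (2 * i + 1) / 2 = i := by omega
    have h2 : partner (2 * i) = 2 * i + 1 := by unfold partner; split_ifs <;> omega
    have h3 : partner (2 * i + 1) = 2 * i := by unfold partner; split_ifs <;> omega
    simp only [swapSeq, h0, h1, h2, h3]
    split_ifs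
    · rfl
    · abel

lemma seqWalk_swapSeq_odd {d : ℕ} (T : ℕ → ZMod 2) (u : ℕ → Fin d × Bool) (i : ℕ) :
    seqWalk (swapSeq T u) (2 * i + 1) =
      seqWalk u (2 * i) + step (if T i = 0 then u (2 * i) else u (2 * i + 1)) := by
  have h0 : 2 * i / 2 = i := by omega
  have h2 : partner (2 * i) = 2 * i + 1 := by unfold partner; split_ifs <;> omega
  rw [seqWalk_succ, seqWalk_swapSeq_even, swapSeq, h0, h2]

/-- Swap the paired entries `2i`, `2i+1` of a finite sequence whenever `v i ≠ 0`. -/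
def swapPairs {A : Type*} {n : ℕ} (a₀ : A) (v : Fin (n / 2) → ZMod 2) (ω : Fin n → A) :
    Fin n → A :=
  fun i => swapSeq (extend 0 v) (extend a₀ ω) i

lemma extend_swapPairs {A : Type*} {n : ℕ} (a₀ : A) (v : Fin (n / 2) → ZMod 2) (ω : Fin n → A) :
    extend a₀ (swapPairs a₀ v ω) = swapSeq (extend 0 v) (extend a₀ ω) := by
  funext i
  by_cases hi : i < n
  · simp [extend, swapPairs, hi]
  · have : ¬ i / 2 < n / 2 := by omega
    simp [extend, swapSeq, hi, this]

lemma swapPairs_add {A : Type*} {n : ℕ} (a₀ : A) (v w : Fin (n / 2) → ZMod 2) (ω : Fin n → A) :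
    swapPairs a₀ v (swapPairs a₀ w ω) = swapPairs a₀ (v + w) ω := by
  have hadd : extend 0 v + extend 0 w = extend 0 (v + w) := by
    funext i
    by_cases hi : i < n / 2 <;> simp [extend, hi]
  funext i
  rw [swapPairs, extend_swapPairs, swapSeq_swapSeq, hadd, swapPairs]

lemma swapPairs_zero {A : Type*} {n : ℕ} (a₀ : A) (ω : Fin n → A) : swapPairs a₀ 0 ω = ω := by
  funext i
  simp [swapPairs, swapSeq, extend]

/-- The squared Euclidean norm on `ℤ^d`. -/
def normSq {d : ℕ} (x : Fin d → ℤ) : ℤ := ∑ i, x i ^ 2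

lemma normSq_neg {d : ℕ} (x : Fin d → ℤ) : normSq (-x) = normSq x := by simp [normSq]

lemma normSq_add_le {d : ℕ} (x y : Fin d → ℤ) :
    normSq (x + y) ≤ 2 * normSq x + 2 * normSq y := by
  simp only [normSq, Finset.mul_sum, ← Finset.sum_add_distrib, Pi.add_apply]
  exact Finset.sum_le_sum fun i _ => by nlinarith [sq_nonneg (x i - y i)]

lemma normSq_step {d : ℕ} (a : Fin d × Bool) : normSq (step a) = 1 := by
  rw [normSq, Finset.sum_eq_single a.1]
  · simp only [step]; split_ifs <;> simp_all
  · intro j _ hj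
    simp [step, hj]
  · simp

lemma abs_step_apply_le {d : ℕ} (a : Fin d × Bool) (i : Fin d) : |step a i| ≤ 1 := by
  unfold step; split_ifs <;> simp

lemma step_injective {d : ℕ} : Function.Injective (step : Fin d × Bool → Fin d → ℤ) := by
  rintro ⟨i, b⟩ ⟨j, c⟩ h
  have hi := congrFun h i
  have hij : i = j := by
    by_contra hij
    cases b <;> simp [step, hij] at hi
  subst hij
  cases b <;> cases c <;> simp [step] at hi ⊢

/-- The walk driven by `u` goes straight in direction `e` for `L` steps, and after that stays
outside of the ball of squared radius `ρ` until time `n`. -/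
def Escapes {d : ℕ} (ρ : ℤ) (L n : ℕ) (e : Fin d × Bool) (u : ℕ → Fin d × Bool) : Prop :=
  ∀ k ≤ n, (k ≤ L → seqWalk u k = (k : ℤ) • step e) ∧ (L ≤ k → ρ < normSq (seqWalk u k))

lemma seqWalk_sub_add_reverse {d : ℕ} (u : ℕ → Fin d × Bool) {t k : ℕ} (hk : k ≤ t) :
    seqWalk u (t - k) + seqWalk (fun i => u (t - 1 - i)) k = seqWalk u t := by
  induction k with
  | zero => simp [seqWalk]
  | succ k ih =>
    rw [← ih (by omega), seqWalk_succ, show t - k = t - (k + 1) + 1 by omega, seqWalk_succ,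
      show t - 1 - k = t - (k + 1) by omega]
    abel

lemma swapped_walk_ne {d : ℕ} {ρ : ℤ} {L n j : ℕ} (hρ : 4 ≤ ρ) (hL : 2 ≤ L) {i₀ i₁ : Fin d}
    (hi : i₀ ≠ i₁) {u : ℕ → Fin d × Bool} (hu₀ : u (2 * j) = (i₀, true))
    (hu₁ : u (2 * j + 1) = (i₁, true))
    (hfwd : Escapes ρ L (n - (2 * j + 2)) (i₀, true) (fun i => u (2 * j + 2 + i)))
    (hbwd : Escapes ρ L (2 * j) (i₀, true) (fun i => u (2 * j - 1 - i)))
    {T : ℕ → ZMod 2} (hTj : T j ≠ 0) (hT : ∀ i, T i ≠ 0 → 2 * i + 2 ≤ n) {k : ℕ} (hk : k ≤ n) :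
    seqWalk (swapSeq T u) k ≠ seqWalk u (2 * j) + step (i₀, true) := by
  have e00 : step (i₀, true) i₀ = 1 := by simp [step]
  have e01 : step (i₀, true) i₁ = 0 := by simp [step, hi.symm]
  have e10 : step (i₁, true) i₀ = 0 := by simp [step, hi]
  have e11 : step (i₁, true) i₁ = 1 := by simp [step]
  have hpast : ∀ l ≤ 2 * j, seqWalk u (2 * j - l) =
      seqWalk u (2 * j) - seqWalk (fun i => u (2 * j - 1 - i)) l := fun l hl =>
    eq_sub_of_add_eq (seqWalk_sub_add_reverse u hl)
  have hmid : seqWalk u (2 * j + 2) =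
      seqWalk u (2 * j) + step (i₀, true) + step (i₁, true) := by
    rw [seqWalk_succ, seqWalk_succ, hu₀, hu₁]
  have hfut : ∀ l, seqWalk u (2 * j + 2 + l) = seqWalk u (2 * j) + step (i₀, true) +
      step (i₁, true) + seqWalk (fun i => u (2 * j + 2 + i)) l := fun l => by
    rw [seqWalk_add, hmid]
  have hnear : ∀ y : Fin d → ℤ, ∀ a b, y = step a - step b → ¬ ρ < normSq y := by
    rintro y a b rfl
    have := normSq_add_le (step a) (-step b)
    rw [normSq_neg, normSq_step, normSq_step, ← sub_eq_add_neg] at this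
    omega
  have hnear' : ∀ y : Fin d → ℤ, ∀ a, y = -step a → ¬ ρ < normSq y := by
    rintro y a rfl
    rw [normSq_neg, normSq_step]
    omega
  have hplain : ∀ k ≤ n, k ≠ 2 * j + 1 → seqWalk u k ≠ seqWalk u (2 * j) + step (i₀, true) := by
    intro k hk hkj h
    rcases le_or_gt k (2 * j) with hkj' | hkj'
    · obtain ⟨l, hl, rfl⟩ : ∃ l ≤ 2 * j, k = 2 * j - l := ⟨2 * j - k, by omega, by omega⟩
      rw [hpast l hl] at h
      have hB : seqWalk (fun i => u (2 * j - 1 - i)) l = -step (i₀, true) := by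
        linear_combination -h
      rcases le_total l L with hlL | hlL
      · rw [(hbwd l hl).1 hlL] at hB
        have := congrFun hB i₀
        simp only [Pi.smul_apply, Pi.neg_apply, e00, smul_eq_mul] at this
        omega
      · exact hnear' _ _ hB ((hbwd l hl).2 hlL)
    · obtain ⟨l, rfl⟩ : ∃ l, k = 2 * j + 2 + l := ⟨k - (2 * j + 2), by omega⟩
      rw [hfut] at h
      have hF : seqWalk (fun i => u (2 * j + 2 + i)) l = -step (i₁, true) := by
        linear_combination h
      rcases le_total l L with hlL | hlL
      · rw [(hfwd l (by omega)).1 hlL] at hF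
        have := congrFun hF i₁
        simp [e11, e01] at this
      · exact hnear' _ _ hF ((hfwd l (by omega)).2 hlL)
  obtain ⟨i, rfl | rfl⟩ : ∃ i, k = 2 * i ∨ k = 2 * i + 1 := ⟨k / 2, by omega⟩
  · rw [seqWalk_swapSeq_even]
    exact hplain _ hk (by omega)
  rw [seqWalk_swapSeq_odd]
  by_cases hTi : T i = 0
  · rw [if_pos hTi, ← seqWalk_succ]
    refine hplain _ hk fun h => hTj ?_
    rwa [show j = i by omega]
  rw [if_neg hTi]
  have hin := hT i hTi
  have hb := abs_le.1 (abs_step_apply_le (u (2 * i + 1)) i₀)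
  rcases lt_trichotomy i j with hij | rfl | hij
  · intro h
    obtain ⟨l, hlj, hl⟩ : ∃ l ≤ 2 * j, 2 * i = 2 * j - l := ⟨2 * j - 2 * i, by omega, by omega⟩
    rw [hl, hpast l hlj, ← hl] at h
    have hB : seqWalk (fun i => u (2 * j - 1 - i)) l = step (u (2 * i + 1)) - step (i₀, true) := by
      linear_combination -h
    rcases le_total l L with hlL | hlL
    · rw [(hbwd l hlj).1 hlL] at hB
      have := congrFun hB i₀
      simp only [Pi.smul_apply, Pi.sub_apply, e00, smul_eq_mul] at this
      omega
    · exact hnear _ _ _ hB ((hbwd l hlj).2 hlL)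
  · rw [hu₁]
    intro h
    have := congrFun h i₀
    simp [e00, e10] at this
  · intro h
    obtain ⟨l, hl⟩ : ∃ l, 2 * i = 2 * j + 2 + l := ⟨2 * i - (2 * j + 2), by omega⟩
    rw [hl, hfut, ← hl] at h
    have hF : seqWalk (fun i => u (2 * j + 2 + i)) l =
        -step (u (2 * i + 1)) - step (i₁, true) := by
      linear_combination h
    rcases le_total L l with hlL | hlL
    · refine hnear (-seqWalk (fun i => u (2 * j + 2 + i)) l) (u (2 * i + 1)) (i₁, false) ?_ ?_
      · have : step (i₁, false) = -step (i₁, true) := by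
          funext x
          simp only [step, Pi.neg_apply]
          split_ifs <;> simp_all
        rw [hF, this]
        abel
      · rw [normSq_neg]
        exact (hfwd l (by omega)).2 hlL
    · rw [(hfwd l (by omega)).1 hlL] at hF
      have h0 := congrFun hF i₀
      simp only [Pi.smul_apply, Pi.sub_apply, Pi.neg_apply, e00, e10, smul_eq_mul] at h0
      have hl0 : l = 0 := by omega
      have h1 := (hfwd 1 (by omega)).1 (by omega)
      have h2 := (hfwd 2 (by omega)).1 hL
      rw [seqWalk_succ, h1, show 2 * j + 2 + 1 = 2 * i + 1 by omega] at h2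
      have := congrFun h2 i₀
      simp only [Pi.smul_apply, Pi.add_apply, e00, smul_eq_mul] at this
      omega

lemma decodable_of_escapes {d : ℕ} {ρ : ℤ} {L n : ℕ} (j : Fin (n / 2)) (hρ : 4 ≤ ρ) (hL : 2 ≤ L)
    {i₀ i₁ : Fin d} (hi : i₀ ≠ i₁) (a₀ : Fin d × Bool) {ω : Fin n → Fin d × Bool}
    (hu₀ : extend a₀ ω (2 * j) = (i₀, true)) (hu₁ : extend a₀ ω (2 * j + 1) = (i₁, true))
    (hfwd : Escapes ρ L (n - (2 * j + 2)) (i₀, true) (fun i => extend a₀ ω (2 * j + 2 + i)))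
    (hbwd : Escapes ρ L (2 * j) (i₀, true) (fun i => extend a₀ ω (2 * j - 1 - i))) :
    Decodable (swapPairs a₀) (rangeW 0) ω j := by
  set x := seqWalk (extend a₀ ω) (2 * j) + step (i₀, true) with hx
  have hj := j.2
  have hmem : ∀ v : Fin (n / 2) → ZMod 2, x ∈ rangeW 0 (swapPairs a₀ v ω) ↔ v j = 0 := by
    intro v
    have hext : extend 0 v j = v j := by simp [extend]
    have hwalk : ∀ k ≤ n, walk 0 (swapPairs a₀ v ω) k =
        seqWalk (swapSeq (extend 0 v) (extend a₀ ω)) k := fun k hk => by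
      rw [walk_eq_seqWalk a₀ _ _ hk, extend_swapPairs, zero_add]
    rw [rangeW, Finset.mem_image]
    constructor
    · rintro ⟨k, hk, hkx⟩
      by_contra hv
      have hkn : k ≤ n := by simpa [Nat.lt_succ_iff] using hk
      rw [hwalk k hkn] at hkx
      refine swapped_walk_ne hρ hL hi hu₀ hu₁ hfwd hbwd (by rwa [hext]) (fun i hTi => ?_) hkn hkx
      by_contra hin
      exact hTi (by rw [extend, dif_neg (by omega)])
    · intro hv
      refine ⟨2 * j + 1, Finset.mem_range.2 (by omega), ?_⟩
      rw [hwalk _ (by omega), seqWalk_swapSeq_odd, hext, if_pos hv, hu₀]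
  have key : ∀ a b : ZMod 2, (a = 0 ↔ b = 0) → a = b := by decide
  intro v w hvw
  exact key _ _ (by rw [← hmem v, ← hmem w, hvw])

lemma extend_cons_succ {A : Type*} {l : ℕ} (a₀ a : A) (η : Fin l → A) (i : ℕ) :
    extend a₀ (Fin.cons a η : Fin (l + 1) → A) (i + 1) = extend a₀ η i := by
  by_cases hi : i < l
  · simp only [extend, hi, Nat.succ_lt_succ_iff, dif_pos]
    exact Fin.cons_succ (α := fun _ => A) a η ⟨i, hi⟩
  · simp [extend, hi]

lemma seqWalk_extend_cons {d l : ℕ} (a₀ a : Fin d × Bool) (η : Fin l → Fin d × Bool) (k : ℕ) :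
    seqWalk (extend a₀ (Fin.cons a η : Fin (l + 1) → Fin d × Bool)) (k + 1) =
      step a + seqWalk (extend a₀ η) k := by
  rw [add_comm k 1, seqWalk_add]
  congr 1
  · simp [seqWalk, extend]
  · congr 1
    funext i
    rw [add_comm 1 i, extend_cons_succ]

open Classical in
/-- A nonnegative function which is at least `1` on the ball of squared radius `ρ` and
superharmonic outside of it bounds the probability of ever hitting the ball. -/
lemma one_sub_mul_le_card_avoiding {d : ℕ} {ρ : ℤ} {g : (Fin d → ℤ) → ℝ} (hg : ∀ x, 0 ≤ g x)
    (hball : ∀ x, normSq x ≤ ρ → 1 ≤ g x)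
    (hsuper : ∀ x, ρ < normSq x → ∑ a, g (x + step a) ≤ 2 * d * g x)
    (a₀ : Fin d × Bool) (l : ℕ) (x : Fin d → ℤ) :
    (1 - g x) * (2 * d) ^ l ≤ (Finset.univ.filter fun η : Fin l → Fin d × Bool =>
      ∀ k ≤ l, ρ < normSq (x + seqWalk (extend a₀ η) k)).card := by
  induction l generalizing x with
  | zero =>
    rcases le_or_gt (normSq x) ρ with hx | hx
    · have := hball x hx
      rw [pow_zero, mul_one]
      exact (sub_nonpos.2 this).trans (Nat.cast_nonneg _)
    · have := hg x
      simp [seqWalk, hx, this]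
  | succ l ih =>
    rcases le_or_gt (normSq x) ρ with hx | hx
    · have := hball x hx
      refine le_trans ?_ (Nat.cast_nonneg _)
      exact mul_nonpos_of_nonpos_of_nonneg (sub_nonpos.2 this) (by positivity)
    have hcard : (Finset.univ.filter fun η : Fin (l + 1) → Fin d × Bool =>
        ∀ k ≤ l + 1, ρ < normSq (x + seqWalk (extend a₀ η) k)).card =
        ∑ a, (Finset.univ.filter fun η : Fin l → Fin d × Bool =>
          ∀ k ≤ l, ρ < normSq (x + step a + seqWalk (extend a₀ η) k)).card := by
      simp only [Finset.card_filter]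
      rw [← (Fin.consEquiv fun _ => Fin d × Bool).sum_comp, Fintype.sum_prod_type]
      refine Finset.sum_congr rfl fun a _ => Finset.sum_congr rfl fun η _ => ?_
      refine if_congr ?_ rfl rfl
      rw [show (Fin.consEquiv fun _ => Fin d × Bool) (a, η) = Fin.cons a η from rfl]
      constructor
      · intro h k hk
        have := h (k + 1) (by omega)
        rw [seqWalk_extend_cons, ← add_assoc] at this
        exact this
      · rintro h (_ | k) hk
        · simpa [seqWalk] using hx
        · rw [seqWalk_extend_cons, ← add_assoc]
          exact h k (by omega)
    rw [hcard, Nat.cast_sum]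
    refine le_trans ?_ (Finset.sum_le_sum fun a _ => ih (x + step a))
    rw [← Finset.sum_mul, pow_succ', ← mul_assoc]
    refine mul_le_mul_of_nonneg_right ?_ (by positivity)
    have hcard' : (Fintype.card (Fin d × Bool) : ℝ) = 2 * d := by simp [mul_comm]
    rw [Finset.sum_sub_distrib, Finset.sum_const, Finset.card_univ, nsmul_eq_mul, mul_one, hcard']
    linarith [hsuper x hx]

lemma one_le_quartic_mul {t : ℝ} (ht : |t| ≤ 1 / 20) :
    1 ≤ (1 - t / 4 + 11 / 64 * t ^ 2) ^ 4 * (1 + t) := by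
  obtain ⟨h1, h2⟩ := abs_le.1 ht
  have hsq : 1 - t / 2 + 2 / 5 * t ^ 2 ≤ (1 - t / 4 + 11 / 64 * t ^ 2) ^ 2 := by
    have : 0 ≤ t ^ 2 * (1 / 160 - 11 / 128 * t + 121 / 4096 * t ^ 2) :=
      mul_nonneg (sq_nonneg t) (by nlinarith [sq_nonneg t])
    linarith
  have hpos : 0 ≤ 1 - t / 2 + 2 / 5 * t ^ 2 := by nlinarith [sq_nonneg t]
  calc (1 : ℝ) ≤ (1 - t / 2 + 2 / 5 * t ^ 2) ^ 2 * (1 + t) := by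
        have : 0 ≤ t ^ 2 * (1 / 20 + 13 / 20 * t - 6 / 25 * t ^ 2 + 4 / 25 * t ^ 3) :=
          mul_nonneg (sq_nonneg t)
            (by nlinarith [sq_nonneg t, mul_nonneg (sq_nonneg t) (by linarith : 0 ≤ 1 + t)])
        linarith
    _ ≤ ((1 - t / 4 + 11 / 64 * t ^ 2) ^ 2) ^ 2 * (1 + t) :=
        mul_le_mul_of_nonneg_right (pow_le_pow_left₀ hpos hsq 2) (by linarith)
    _ = _ := by ring

/-- The decay of the superharmonic function `|x|^(-1/2)`, normalized and truncated so that it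
equals `1` on the ball of radius `60`. -/
noncomputable def barrier {d : ℕ} (x : Fin d → ℤ) : ℝ :=
  √√(3600 / max (normSq x : ℝ) 3600)

lemma barrier_eq_one {d : ℕ} {x : Fin d → ℤ} (hx : normSq x ≤ 3600) : barrier x = 1 := by
  have : (normSq x : ℝ) ≤ 3600 := by exact_mod_cast hx
  simp [barrier, max_eq_right this]

lemma barrier_le_of_normSq_eq {d : ℕ} {x y : Fin d → ℤ} {t : ℝ} (hx : 3600 < normSq x)
    (ht : |t| ≤ 1 / 20) (hy : (normSq y : ℝ) = normSq x * (1 + t)) :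
    barrier y ≤ barrier x * (1 - t / 4 + 11 / 64 * t ^ 2) := by
  have hs : (3600 : ℝ) < normSq x := by exact_mod_cast hx
  obtain ⟨h1, h2⟩ := abs_le.1 ht
  have ht1 : 0 < 1 + t := by linarith
  have hq : 0 ≤ 1 - t / 4 + 11 / 64 * t ^ 2 := by nlinarith [sq_nonneg t]
  have hypos : 0 < (normSq y : ℝ) := by rw [hy]; positivity
  have hle : 3600 / max (normSq y : ℝ) 3600 ≤
      3600 / normSq x * (1 - t / 4 + 11 / 64 * t ^ 2) ^ 4 := by
    calc 3600 / max (normSq y : ℝ) 3600 ≤ 3600 / normSq y := by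
          gcongr
          exact le_max_left _ _
      _ = 3600 / normSq x * (1 / (1 + t)) := by
          rw [hy]
          field_simp
      _ ≤ _ := by
          gcongr
          rw [div_le_iff₀ ht1]
          exact one_le_quartic_mul ht
  calc barrier y ≤ √√(3600 / normSq x * (1 - t / 4 + 11 / 64 * t ^ 2) ^ 4) :=
        Real.sqrt_le_sqrt (Real.sqrt_le_sqrt hle)
    _ = √√(3600 / normSq x) * (1 - t / 4 + 11 / 64 * t ^ 2) := by
        rw [Real.sqrt_mul (by positivity), show ∀ q : ℝ, q ^ 4 = (q ^ 2) ^ 2 by intro q; ring,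
          Real.sqrt_sq (by positivity), Real.sqrt_mul (by positivity), Real.sqrt_sq hq]
    _ = _ := by rw [barrier, max_eq_left hs.le]

lemma normSq_add_step {d : ℕ} (x : Fin d → ℤ) (a : Fin d × Bool) :
    normSq (x + step a) = normSq x + 1 + 2 * (if a.2 then x a.1 else -x a.1) := by
  have hcross : ∑ i, x i * step a i = if a.2 then x a.1 else -x a.1 := by
    rw [Finset.sum_eq_single a.1]
    · simp only [step]; split_ifs <;> simp_all
    · intro j _ hj
      simp [step, hj]
    · simp
  rw [← hcross, ← normSq_step a]
  simp only [normSq, Finset.mul_sum, ← Finset.sum_add_distrib, Pi.add_apply]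
  exact Finset.sum_congr rfl fun i _ => by ring

lemma sum_barrier_add_step_le {d : ℕ} (hd : 3 ≤ d) {x : Fin d → ℤ} (hx : 3600 < normSq x) :
    ∑ a, barrier (x + step a) ≤ 2 * d * barrier x := by
  obtain ⟨s, hs_def⟩ : ∃ s : ℝ, s = normSq x := ⟨_, rfl⟩
  have hs : 3600 < s := by rw [hs_def]; exact_mod_cast hx
  have hs0 : s ≠ 0 := by linarith
  have hsum : ∑ i, (x i : ℝ) ^ 2 = s := by simp [hs_def, normSq]
  have hxi : ∀ i, (x i : ℝ) ^ 2 ≤ s := fun i => by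
    rw [← hsum]
    exact Finset.single_le_sum (f := fun i => (x i : ℝ) ^ 2) (fun j _ => sq_nonneg _)
      (Finset.mem_univ i)
  have hsmall : ∀ i, ∀ ε : ℝ, |ε| = 1 → |(1 + 2 * (ε * x i)) / s| ≤ 1 / 20 := by
    intro i ε hε
    rw [abs_div, abs_of_pos (by linarith : 0 < s), div_le_iff₀ (by linarith)]
    have h1 : |1 + 2 * (ε * x i)| ≤ 1 + 2 * |(x i : ℝ)| := by
      refine (abs_add_le _ _).trans ?_
      simp [abs_mul, hε]
    have h2 := hxi i
    rw [← sq_abs] at h2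
    nlinarith [sq_nonneg (|(x i : ℝ)| - 40)]
  have hpair : ∀ i, barrier (x + step (i, true)) + barrier (x + step (i, false)) ≤
      barrier x * (2 - 1 / (2 * s) + 11 / 32 / s ^ 2 + 11 / 8 / s ^ 2 * (x i : ℝ) ^ 2) := by
    intro i
    have hp := barrier_le_of_normSq_eq (y := x + step (i, true)) hx (hsmall i 1 (by simp))
      (by rw [normSq_add_step]; push_cast; rw [← hs_def, if_pos rfl]; field_simp; ring)
    have hm := barrier_le_of_normSq_eq (y := x + step (i, false)) hx (hsmall i (-1) (by simp))
      (by rw [normSq_add_step]; push_cast; rw [← hs_def]; field_simp; ring)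
    refine (add_le_add hp hm).trans_eq ?_
    field_simp
    ring
  have hb : 0 ≤ barrier x := Real.sqrt_nonneg _
  calc ∑ a, barrier (x + step a)
      = ∑ i, (barrier (x + step (i, true)) + barrier (x + step (i, false))) := by
        rw [Fintype.sum_prod_type]
        simp
    _ ≤ ∑ i, barrier x * (2 - 1 / (2 * s) + 11 / 32 / s ^ 2 + 11 / 8 / s ^ 2 * (x i : ℝ) ^ 2) :=
        Finset.sum_le_sum fun i _ => hpair i
    _ = barrier x * (d * (2 - 1 / (2 * s) + 11 / 32 / s ^ 2) + 11 / 8 / s) := by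
        rw [← Finset.mul_sum, Finset.sum_add_distrib, ← Finset.mul_sum, hsum]
        simp only [Finset.sum_const, Finset.card_univ, Fintype.card_fin, nsmul_eq_mul]
        field_simp
    _ ≤ barrier x * (2 * d) := by
        refine mul_le_mul_of_nonneg_left ?_ hb
        have hd' : (3 : ℝ) ≤ d := by exact_mod_cast hd
        have : d * (2 - 1 / (2 * s) + 11 / 32 / s ^ 2) + 11 / 8 / s =
            2 * d - (16 * d * s - 11 * d - 44 * s) / (32 * s ^ 2) := by
          field_simp
          ring
        rw [this]
        have : 0 ≤ (16 * d * s - 11 * d - 44 * s) / (32 * s ^ 2) := by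
          apply div_nonneg _ (by positivity)
          nlinarith
        linarith
    _ = 2 * d * barrier x := by ring

lemma Escapes.congr {d : ℕ} {ρ : ℤ} {L n : ℕ} {e : Fin d × Bool} {u v : ℕ → Fin d × Bool}
    (h : Escapes ρ L n e u) (huv : ∀ i < n, v i = u i) : Escapes ρ L n e v := fun k hk => by
  rw [seqWalk_congr fun i hi => huv i (hi.trans_le hk)]
  exact h k hk

lemma seqWalk_const {d : ℕ} (e : Fin d × Bool) (k : ℕ) :
    seqWalk (fun _ => e) k = (k : ℤ) • step e := by
  simp [seqWalk]

lemma normSq_smul_step {d : ℕ} (k : ℤ) (e : Fin d × Bool) : normSq (k • step e) = k ^ 2 := by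
  have := normSq_step e
  simp only [normSq] at this
  simp only [normSq, Pi.smul_apply, smul_eq_mul, mul_pow, ← Finset.mul_sum, this, mul_one]

open Classical in
/-- In dimension at least three the probability to go straight for a while and never to return
near the origin is bounded from below uniformly in time. -/
lemma exists_le_card_escapes {d : ℕ} (hd : 3 ≤ d) (e : Fin d × Bool) :
    ∃ q : ℝ, 0 < q ∧ ∀ l : ℕ, q * (2 * d) ^ l ≤ (Finset.univ.filter fun η : Fin l → Fin d × Bool =>
      Escapes 3600 240 l e (extend e η)).card := by
  have hd' : (1 : ℝ) ≤ 2 * d := by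
    have : (3 : ℝ) ≤ d := by exact_mod_cast hd
    linarith
  refine ⟨(2 * ((2 * d) ^ 240))⁻¹, by positivity, fun l => ?_⟩
  rcases lt_or_ge l 240 with hl | hl
  · have hpos : 0 < (Finset.univ.filter fun η : Fin l → Fin d × Bool =>
        Escapes 3600 240 l e (extend e η)).card := by
      refine Finset.card_pos.2 ⟨fun _ => e, Finset.mem_filter.2 ⟨Finset.mem_univ _, ?_⟩⟩
      refine fun k hk => ⟨fun _ => ?_, fun hk' => by omega⟩
      rw [show extend e (fun _ : Fin l => e) = fun _ => e by funext i; simp [extend],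
        seqWalk_const]
    refine le_trans ?_ (Nat.one_le_cast.2 hpos)
    rw [inv_mul_le_iff₀ (by positivity), mul_one]
    have h1 := pow_le_pow_right₀ hd' hl.le
    have h2 : (0 : ℝ) ≤ (2 * d) ^ 240 := by positivity
    linarith
  obtain ⟨r, rfl⟩ := Nat.exists_eq_add_of_le hl
  have hcount := one_sub_mul_le_card_avoiding (ρ := 3600) (g := barrier)
    (fun x => Real.sqrt_nonneg _) (fun x hx => (barrier_eq_one hx).ge)
    (fun x hx => sum_barrier_add_step_le hd hx) e r ((240 : ℤ) • step e)
  have hbar : barrier ((240 : ℤ) • step e) = 1 / 2 := by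
    rw [barrier, normSq_smul_step, max_eq_left (by norm_num),
      show (3600 : ℝ) / ((240 ^ 2 : ℤ) : ℝ) = ((1 / 2) ^ 2) ^ 2 by norm_num,
      Real.sqrt_sq (by norm_num), Real.sqrt_sq (by norm_num)]
  rw [hbar] at hcount
  have hle : (2 * (2 * d : ℝ) ^ 240)⁻¹ * (2 * d : ℝ) ^ (240 + r) =
      (1 - 1 / 2) * (2 * d : ℝ) ^ r := by
    have h240 : (2 * d : ℝ) ^ 240 ≠ 0 := by positivity
    rw [pow_add]
    generalize (2 * d : ℝ) ^ 240 = D at h240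
    field_simp
    norm_num
  rw [hle]
  refine hcount.trans (Nat.cast_le.2 ?_)
  refine Finset.card_le_card_of_injOn
    (fun η i => if (i : ℕ) < 240 then e else extend e η (i - 240)) ?_ ?_
  · intro η hη
    have hη' := (Finset.mem_filter.1 hη).2
    refine Finset.mem_filter.2 ⟨Finset.mem_univ _, ?_⟩
    set u := extend e (fun i : Fin (240 + r) =>
      if (i : ℕ) < 240 then e else extend e η (i - 240)) with hu
    have hu0 : ∀ i < 240, u i = e := fun i hi => by
      simp [hu, extend, hi]
    have hu1 : ∀ i < r, u (240 + i) = extend e η i := fun i hi => by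
      simp [hu, extend, hi]
    intro k hk
    constructor
    · intro hk'
      rw [seqWalk_congr (v := fun _ => e) fun i hi => hu0 i (by omega), seqWalk_const]
    · intro hk'
      obtain ⟨m, rfl⟩ := Nat.exists_eq_add_of_le hk'
      rw [seqWalk_add, seqWalk_congr (v := fun _ => e) fun i hi => hu0 i hi, seqWalk_const,
        seqWalk_congr (v := extend e η) fun i hi => hu1 i (by omega)]
      exact hη' m (by omega)
  · intro η _ η' _ h
    funext i
    have := congrFun h ⟨240 + i, by omega⟩
    simpa [extend] using this

open Classical in
lemma card_mul_card_escapes_le {d n : ℕ} {i₀ i₁ : Fin d} (hi : i₀ ≠ i₁) (j : Fin (n / 2)) :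
    (Finset.univ.filter fun η : Fin (2 * j) → Fin d × Bool =>
        Escapes 3600 240 (2 * j) (i₀, true) (extend (i₀, true) η)).card *
      (Finset.univ.filter fun η : Fin (n - (2 * j + 2)) → Fin d × Bool =>
        Escapes 3600 240 (n - (2 * j + 2)) (i₀, true) (extend (i₀, true) η)).card ≤
      (Finset.univ.filter fun ω : Fin n → Fin d × Bool =>
        Decodable (swapPairs (i₀, true)) (rangeW 0) ω j).card := by
  have hj := j.2
  set e : Fin d × Bool := (i₀, true) with he
  rw [← Finset.card_product]
  let glue : (Fin (2 * j) → Fin d × Bool) × (Fin (n - (2 * j + 2)) → Fin d × Bool) →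
      Fin n → Fin d × Bool := fun p i =>
    if (i : ℕ) < 2 * j then extend e p.1 (2 * j - 1 - i)
    else if (i : ℕ) = 2 * j then e
    else if (i : ℕ) = 2 * j + 1 then (i₁, true)
    else extend e p.2 (i - (2 * j + 2))
  have hpast : ∀ p, ∀ i < 2 * (j : ℕ), extend e (glue p) (2 * j - 1 - i) = extend e p.1 i := by
    intro p i hi
    have h1 : 2 * (j : ℕ) - 1 - i < n := by omega
    have h2 : 2 * (j : ℕ) - 1 - i < 2 * j := by omega
    have h3 : 2 * (j : ℕ) - 1 - (2 * j - 1 - i) = i := by omega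
    rw [extend, dif_pos h1]
    simp only [glue, if_pos h2, h3]
  have hfut : ∀ p, ∀ i < n - (2 * (j : ℕ) + 2),
      extend e (glue p) (2 * j + 2 + i) = extend e p.2 i := by
    intro p i hi
    rw [extend, dif_pos (by omega)]
    simp only [glue]
    rw [if_neg (by omega), if_neg (by omega), if_neg (by omega), Nat.add_sub_cancel_left]
  refine Finset.card_le_card_of_injOn glue ?_ ?_
  · intro p hp
    obtain ⟨hp1, hp2⟩ := Finset.mem_product.1 hp
    refine Finset.mem_filter.2 ⟨Finset.mem_univ _, decodable_of_escapes j (by norm_num)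
      (by norm_num) hi e ?_ ?_ ((Finset.mem_filter.1 hp2).2.congr (hfut p))
      ((Finset.mem_filter.1 hp1).2.congr (hpast p))⟩
    · rw [extend, dif_pos (by omega)]
      simp [glue, he]
    · rw [extend, dif_pos (by omega)]
      simp [glue]
  · intro p _ p' _ h
    have h' : glue p = glue p' := h
    refine Prod.ext (funext fun i => ?_) (funext fun i => ?_)
    · have := hpast p i i.2
      rw [h', hpast p' i i.2] at this
      simpa [extend] using this.symm
    · have := hfut p i i.2
      rw [h', hfut p' i i.2] at this
      simpa [extend] using this.symm

lemma rangeW_one_injective {d : ℕ} :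
    Function.Injective (rangeW (0 : Fin d → ℤ) : (Fin 1 → Fin d × Bool) → _) := by
  have hrange : ∀ ω : Fin 1 → Fin d × Bool, rangeW 0 ω = {0, step (ω 0)} := fun ω => by
    have h0 : walk 0 ω 0 = 0 := by simp [walk]
    have h1 : walk 0 ω 1 = step (ω 0) := by simp [walk]
    ext y
    simp [rangeW, Finset.range_add_one, h0, h1, or_comm]
  have hne : ∀ a : Fin d × Bool, step a ≠ 0 := fun a h => by
    have := normSq_step a
    simp [h, normSq] at this
  intro ω ω' h
  rw [hrange, hrange] at h
  have hmem : step (ω 0) ∈ ({0, step (ω' 0)} : Finset (Fin d → ℤ)) := by simp [← h]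
  have : step (ω 0) = step (ω' 0) := by simpa [hne] using hmem
  funext i
  rw [Subsingleton.elim i 0]
  exact step_injective this

lemma one_le_entW_rangeW_one {d : ℕ} (hd : 0 < d) :
    1 ≤ entW d 1 (rangeW (0 : Fin d → ℤ)) := by
  have h := le_entW_of_weight hd (n := 1) (rangeW (0 : Fin d → ℤ)) (fun _ => 2)
    (fun _ => two_pos) fun a => ?_
  · rwa [logb_self_eq_one one_lt_two, Finset.sum_const, Finset.card_univ, nsmul_eq_mul, mul_one,
      ← card_steps, div_self (by positivity)] at h
  · have hcard : (Finset.univ.filter fun ω : Fin 1 → Fin d × Bool => rangeW 0 ω = a).card ≤ 1 := by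
      refine Finset.card_le_one.2 fun ω hω ω' hω' => rangeW_one_injective ?_
      rw [(Finset.mem_filter.1 hω).2, (Finset.mem_filter.1 hω').2]
    have h1 : ((Finset.univ.filter fun ω : Fin 1 → Fin d × Bool =>
        rangeW 0 ω = a).card : ℝ) ≤ 1 := by exact_mod_cast hcard
    have h2 : (1 : ℝ) ≤ d := by exact_mod_cast hd
    rw [Finset.sum_const, nsmul_eq_mul]
    linarith

lemma exists_mul_le_entW_rangeW {d : ℕ} (hd : 3 ≤ d) :
    ∃ p : ℝ, 0 < p ∧ ∀ n : ℕ, (n / 2 : ℕ) * p ≤ entW d n (rangeW (0 : Fin d → ℤ)) := by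
  classical
  obtain ⟨q, hq, hcard⟩ := exists_le_card_escapes hd (⟨0, by omega⟩, true)
  have hd0 : (0 : ℝ) < 2 * d := by
    have : (3 : ℝ) ≤ d := by exact_mod_cast hd
    linarith
  refine ⟨q ^ 2 / (2 * d) ^ 2, by positivity, fun n => ?_⟩
  have hi : (⟨0, by omega⟩ : Fin d) ≠ ⟨1, by omega⟩ := by simp
  refine le_entW_of_decodable (by omega) (swapPairs_zero (⟨0, by omega⟩, true))
    (swapPairs_add _) _ fun j => ?_
  have hj := j.2
  calc q ^ 2 / (2 * d) ^ 2 * (2 * d) ^ n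
      = q * (2 * d) ^ (2 * (j : ℕ)) * (q * (2 * d) ^ (n - (2 * j + 2))) := by
        have hn : (2 * d : ℝ) ^ n =
            (2 * d) ^ (2 * (j : ℕ)) * (2 * d) ^ 2 * (2 * d) ^ (n - (2 * j + 2)) := by
          rw [← pow_add, ← pow_add]
          congr 1
          omega
        rw [hn]
        field_simp
    _ ≤ _ := mul_le_mul (hcard _) (hcard _) (by positivity) (by positivity)
    _ ≤ _ := by exact_mod_cast card_mul_card_escapes_le hi j

/-- For `d ≥ 3`, the entropy of the range of `n`-step SRW on `ℤ^d` is of order `n`. -/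
theorem entropy_range_high_dim :
    ∀ d : ℕ, 3 ≤ d → ∃ c C : ℝ, 0 < c ∧ 0 < C ∧ ∀ n : ℕ,
      c * n ≤ entW d n (rangeW (0 : Fin d → ℤ)) ∧
      entW d n (rangeW (0 : Fin d → ℤ)) ≤ C * n := by
  intro d hd
  obtain ⟨p, hp, hlow⟩ := exists_mul_le_entW_rangeW hd
  have hd' : (3 : ℝ) ≤ d := by exact_mod_cast hd
  refine ⟨min 1 (p / 3), logb 2 (2 * d), by positivity, logb_pos one_lt_two (by linarith),
    fun n => ⟨?_, entW_le (by omega) n _⟩⟩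
  rcases n with _ | _ | n
  · simpa using entW_nonneg d 0 _
  · simpa using (min_le_left _ _).trans (one_le_entW_rangeW_one (by omega))
  · refine le_trans ?_ (hlow (n + 1 + 1))
    have hdiv : ((n + 1 + 1 : ℕ) : ℝ) ≤ 3 * ((n + 1 + 1) / 2 : ℕ) := by
      exact_mod_cast (by omega : n + 1 + 1 ≤ 3 * ((n + 1 + 1) / 2))
    calc min 1 (p / 3) * ((n + 1 + 1 : ℕ) : ℝ) ≤ p / 3 * (3 * ((n + 1 + 1) / 2 : ℕ)) := by
          gcongr
          exact min_le_right _ _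
      _ = _ := by ring
end
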